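/- Assume p̄ = 1/2. Then the parameters δ and δ̃ satisfy δ + δ̃ < 1, and: (i) if δ > 1 then P_η(lim_{n→∞} X_n = +∞) = 1; (ii) if δ̃ > 1 then P_η(lim_{n→∞} X_n = −∞) = 1; (iii) if δ ≤ 1 and δ̃ ≤ 1 then P_η(liminf_{n→∞} X_n = −∞ and limsup_{n→∞} X_n = +∞) = 1. -/

import Mathlib

open MeasureTheory Filter Set Matrix ProbabilityTheory
open scoped Classical

noncomputable section

/-- `K` is a (row-)stochastic matrix. -/
def IsStochastic {n : Type*} [Fintype n] (K : Matrix n n ℝ) : Prop :=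
  (∀ i j, 0 ≤ K i j) ∧ ∀ i, ∑ j, K i j = 1

/-- `v` is a probability (row) vector. -/
def IsProbVec {n : Type*} [Fintype n] (v : n → ℝ) : Prop :=
  (∀ i, 0 ≤ v i) ∧ ∑ i, v i = 1

/-- `μ` is a stationary distribution for `K`, i.e. `μ K = μ`. -/
def IsStationaryDist {n : Type*} [Fintype n] (K : Matrix n n ℝ) (μ : n → ℝ) : Prop :=
  IsProbVec μ ∧ Matrix.vecMul μ K = μ

/-- `μ` is the unique stationary distribution of `K` (equivalent, for a finite chain, to `K`
having a unique closed irreducible subset). -/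
def HasUniqueStationaryDist {n : Type*} [Fintype n] (K : Matrix n n ℝ) (μ : n → ℝ) : Prop :=
  IsStationaryDist K μ ∧ ∀ μ' : n → ℝ, IsStationaryDist K μ' → μ' = μ

/-- The vector `𝐫 = (I − K + 2(𝟏−𝐩)μD_{1−p}K)⁻¹ 𝐩 − 𝟏` (critical case `p̄ = 1/2`). -/
def rvec {n : Type*} [Fintype n] [DecidableEq n] (K : Matrix n n ℝ) (μ p : n → ℝ) : n → ℝ :=
  Matrix.mulVec
    (1 - K + (2 : ℝ) •
        Matrix.vecMulVec (fun i => 1 - p i)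
          (Matrix.vecMul μ (Matrix.diagonal (fun i => 1 - p i) * K)))⁻¹ p
    - 1

/-- The parameter `ν = 2 + 4 μ D_p K 𝐫` (critical case `p̄ = 1/2`). -/
def nuVal {n : Type*} [Fintype n] [DecidableEq n] (K : Matrix n n ℝ) (μ p : n → ℝ) : ℝ :=
  2 + 4 * ∑ i, Matrix.vecMul μ (Matrix.diagonal p * K) i * rvec K μ p i

/-- The parameter `δ = 2 (η·𝐫) / ν` (critical case `p̄ = 1/2`). -/
def deltaVal {n : Type*} [Fintype n] [DecidableEq n] (K : Matrix n n ℝ) (μ p η : n → ℝ) : ℝ :=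
  2 * (∑ i, η i * rvec K μ p i) / nuVal K μ p

/-- `(Pm, Rc, ξ)` is the averaged law of a Markovian cookie environment together with its
coin tosses: the site processes `(Rc x, ξ x)`, `x ∈ ℤ`, are i.i.d., at each site
`Rc x` is a Markov chain with transition matrix `K` and initial distribution `η`
(0-based indexing: `Rc x j` is `R^x_{j+1}` of the paper), and conditionally on the
environment the `ξ x j` are independent Bernoulli with success probability `p (Rc x j)`.
This is expressed through the finite-dimensional cylinder probabilities, which
characterize the joint law. -/
def IsCookieEnv {N : ℕ} {Ω : Type*} [MeasurableSpace Ω] (Pm : Measure Ω)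
    (K : Matrix (Fin N) (Fin N) ℝ) (p η : Fin N → ℝ)
    (Rc : ℤ → ℕ → Ω → Fin N) (ξ : ℤ → ℕ → Ω → Bool) : Prop :=
  (∀ x j, Measurable (Rc x j)) ∧ (∀ x j, Measurable (ξ x j)) ∧
    ∀ (S : Finset ℤ) (m : ℕ) (f : ℤ → ℕ → Fin N) (b : ℤ → ℕ → Bool),
      (Pm {ω | ∀ x ∈ S, ∀ j ≤ m, Rc x j ω = f x j ∧ ξ x j ω = b x j}).toReal =
        ∏ x ∈ S,
          (η (f x 0) * (∏ j ∈ Finset.range m, K (f x j) (f x (j + 1))) *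
            ∏ j ∈ Finset.range (m + 1), (if b x j then p (f x j) else 1 - p (f x j)))

/-- The history (most recent position first) of the excited random walk driven by the
coin tosses `ξ`: from position `x`, if `x` has been visited `j` times before, the walk
steps right iff `ξ x j` (so `ξ x j` is the outcome of the `(j+1)`-st cookie at `x`). -/
def walkHist (ξ : ℤ → ℕ → Bool) : ℕ → List ℤ
  | 0 => [0]
  | k + 1 =>
    let h := walkHist ξ k
    let x := h.headI
    (x + (if ξ x (h.tail.count x) then 1 else -1)) :: h

/-- The excited random walk driven by the coin tosses `ξ`, started at `0`. -/
def walk (ξ : ℤ → ℕ → Bool) (k : ℕ) : ℤ := (walkHist ξ k).headI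


section StochasticMatrix

variable {N : ℕ} {K : Matrix (Fin N) (Fin N) ℝ} {μ p η : Fin N → ℝ}

lemma IsStochastic.mulVec_const (hK : IsStochastic K) (a : ℝ) :
    K *ᵥ (fun _ => a) = fun _ => a := by
  ext i
  simp [Matrix.mulVec, dotProduct, ← Finset.sum_mul, hK.2 i]

lemma IsStochastic.sum_vecMul (hK : IsStochastic K) (x : Fin N → ℝ) :
    ∑ j, (x ᵥ* K) j = ∑ i, x i := by
  simp only [Matrix.vecMul, dotProduct]
  rw [Finset.sum_comm]
  simp [← Finset.mul_sum, hK.2]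

lemma invariant_of_nonneg (hμ : HasUniqueStationaryDist K μ) {y : Fin N → ℝ}
    (hy : ∀ i, 0 ≤ y i) (h : y ᵥ* K = y) : y = (∑ i, y i) • μ := by
  by_cases h0 : ∑ i, y i = 0
  · have := (Finset.sum_eq_zero_iff_of_nonneg (fun i _ => hy i)).1 h0
    ext i
    simp [h0, this i (Finset.mem_univ i)]
  · have hs : IsStationaryDist K ((∑ i, y i)⁻¹ • y) := by
      refine ⟨⟨fun i => ?_, ?_⟩, ?_⟩
      · have : 0 ≤ ∑ i, y i := Finset.sum_nonneg fun i _ => hy i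
        simp only [Pi.smul_apply, smul_eq_mul]
        have := hy i
        positivity
      · simp only [Pi.smul_apply, smul_eq_mul, ← Finset.mul_sum]
        exact inv_mul_cancel₀ h0
      · rw [Matrix.smul_vecMul, h]
    rw [← hμ.2 _ hs, smul_smul, mul_inv_cancel₀ h0, one_smul]

/-- The left-invariant vectors are the multiples of the stationary distribution. -/
lemma invariant_eq_smul (hK : IsStochastic K) (hμ : HasUniqueStationaryDist K μ)
    {x : Fin N → ℝ} (h : x ᵥ* K = x) : x = (∑ i, x i) • μ := by
  have hle : ∀ j, |x j| ≤ ((fun i => |x i|) ᵥ* K) j := by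
    intro j
    conv_lhs => rw [← h]
    simp only [Matrix.vecMul, dotProduct]
    refine (Finset.abs_sum_le_sum_abs _ _).trans_eq ?_
    refine Finset.sum_congr rfl fun i _ => ?_
    rw [abs_mul, abs_of_nonneg (hK.1 i j)]
  have habs : (fun i => |x i|) ᵥ* K = fun i => |x i| := by
    have := (Finset.sum_eq_sum_iff_of_le (fun j (_ : j ∈ Finset.univ) => hle j)).1
      (hK.sum_vecMul _).symm
    ext j
    exact (this j (Finset.mem_univ j)).symm
  have h1 := invariant_of_nonneg hμ (fun i => abs_nonneg (x i)) habs
  have h2 := invariant_of_nonneg hμ (y := (fun i => |x i|) + x)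
    (fun i => by have := neg_abs_le (x i); simp only [Pi.add_apply]; linarith)
    (by rw [Matrix.add_vecMul, habs, h])
  simp only [Pi.add_apply, Finset.sum_add_distrib, add_smul] at h2
  rw [← h1] at h2
  exact add_left_cancel h2

lemma isUnit_det_one_sub_add (hK : IsStochastic K) (hμ : HasUniqueStationaryDist K μ)
    {a c : Fin N → ℝ} (hc : ∑ i, c i ≠ 0) (ha : ∑ i, μ i * a i ≠ 0) :
    IsUnit (1 - K + Matrix.vecMulVec a c).det := by
  rw [isUnit_iff_ne_zero]
  intro h0
  obtain ⟨x, hx0, hx⟩ := Matrix.exists_vecMul_eq_zero_iff.2 h0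
  rw [Matrix.vecMul_add, Matrix.vecMul_sub, Matrix.vecMul_one] at hx
  have hv : x ᵥ* Matrix.vecMulVec a c = (∑ i, x i * a i) • c := by
    ext j
    simp [Matrix.vecMul, dotProduct, Matrix.vecMulVec_apply, Finset.sum_mul, mul_assoc]
  rw [hv] at hx
  have hs : (∑ i, x i * a i) * ∑ i, c i = 0 := by
    have := congrArg (fun y : Fin N → ℝ => ∑ i, y i) hx
    simp only [Pi.add_apply, Pi.sub_apply, Finset.sum_add_distrib, Finset.sum_sub_distrib,
      hK.sum_vecMul, sub_self, zero_add, Pi.smul_apply, smul_eq_mul, ← Finset.mul_sum,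
      Pi.zero_apply, Finset.sum_const_zero] at this
    exact this
  have hxa := (mul_eq_zero.1 hs).resolve_right hc
  rw [hxa, zero_smul, add_zero, sub_eq_zero] at hx
  have hxμ := invariant_eq_smul hK hμ hx.symm
  rw [hxμ] at hxa
  simp only [Pi.smul_apply, smul_eq_mul, mul_assoc, ← Finset.mul_sum] at hxa
  have := (mul_eq_zero.1 hxa).resolve_right ha
  rw [this, zero_smul] at hxμ
  exact hx0 hxμ

lemma vecMulVec_mulVec_apply (a c x : Fin N → ℝ) (i : Fin N) :
    (Matrix.vecMulVec a c *ᵥ x) i = a i * ∑ j, c j * x j := by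
  simp [Matrix.mulVec, dotProduct, Matrix.vecMulVec_apply, Finset.mul_sum, mul_assoc]

lemma stationary_mulVec (hμ : HasUniqueStationaryDist K μ) (x : Fin N → ℝ) :
    ∑ i, μ i * (K *ᵥ x) i = ∑ i, μ i * x i := by
  have : μ ⬝ᵥ (K *ᵥ x) = μ ⬝ᵥ x := by rw [Matrix.dotProduct_mulVec, hμ.1.2]
  exact this

/-- Solvability of the Poisson equation. -/
lemma exists_poisson (hK : IsStochastic K) (hμ : HasUniqueStationaryDist K μ)
    {v : Fin N → ℝ} (hv : ∑ i, μ i * v i = 0) : ∃ h : Fin N → ℝ, ∀ i, h i - (K *ᵥ h) i = v i := by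
  have hu := isUnit_det_one_sub_add hK hμ (a := fun _ => 1) (c := μ)
    (by rw [hμ.1.1.2]; exact one_ne_zero) (by simp [hμ.1.1.2])
  set M := 1 - K + Matrix.vecMulVec (fun _ => 1) μ
  refine ⟨M⁻¹ *ᵥ v, ?_⟩
  have hM : M *ᵥ (M⁻¹ *ᵥ v) = v := by
    rw [Matrix.mulVec_mulVec, Matrix.mul_nonsing_inv _ hu, Matrix.one_mulVec]
  set h := M⁻¹ *ᵥ v
  have hi : ∀ i, h i - (K *ᵥ h) i + ∑ j, μ j * h j = v i := by
    intro i
    have := congrFun hM i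
    rw [Matrix.add_mulVec, Matrix.sub_mulVec, Matrix.one_mulVec] at this
    simpa [vecMulVec_mulVec_apply] using this
  have h0 : ∑ j, μ j * h j = 0 := by
    have : ∑ i, μ i * (h i - (K *ᵥ h) i + ∑ j, μ j * h j) = 0 := by simp [hi, hv]
    simp only [mul_add, mul_sub, Finset.sum_add_distrib, Finset.sum_sub_distrib,
      stationary_mulVec hμ, sub_self, zero_add, ← Finset.sum_mul, hμ.1.1.2, one_mul] at this
    exact this
  intro i
  have := hi i
  rwa [h0, add_zero] at this

lemma harmonic_const (hK : IsStochastic K) (hμ : HasUniqueStationaryDist K μ)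
    {u : Fin N → ℝ} (hu : K *ᵥ u = u) (i : Fin N) : u i = ∑ j, μ j * u j := by
  have hunit := isUnit_det_one_sub_add hK hμ (a := fun _ => 1) (c := μ)
    (by rw [hμ.1.1.2]; exact one_ne_zero) (by simp [hμ.1.1.2])
  have hz : u - (fun _ => ∑ j, μ j * u j) = 0 := by
    refine Matrix.eq_zero_of_mulVec_eq_zero (M := 1 - K + Matrix.vecMulVec (fun _ => 1) μ)
      hunit.ne_zero ?_
    ext i
    rw [Matrix.add_mulVec, Matrix.sub_mulVec, Matrix.one_mulVec, Matrix.mulVec_sub, hu,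
      hK.mulVec_const]
    simp only [Pi.add_apply, vecMulVec_mulVec_apply, Pi.sub_apply, mul_sub,
      Finset.sum_sub_distrib, ← Finset.sum_mul, hμ.1.1.2]
    simp
  have := congrFun hz i
  simp only [Pi.sub_apply, Pi.zero_apply] at this
  linarith

/-- A nonempty set of states closed under the dynamics carries the stationary distribution. -/
lemma stationary_eq_zero_of_closed (hK : IsStochastic K) (hμ : HasUniqueStationaryDist K μ)
    {B : Set (Fin N)} {b : Fin N} (hb : b ∈ B) (hB : ∀ i ∈ B, ∀ j ∉ B, K i j = 0)
    {j : Fin N} (hj : j ∉ B) : μ j = 0 := by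
  set K' : Matrix (Fin N) (Fin N) ℝ := fun i j => if i ∈ B then K i j else if j = b then 1 else 0
    with hK'
  have hdet : (1 - K').det = 0 := by
    rw [← Matrix.exists_mulVec_eq_zero_iff]
    refine ⟨fun _ => 1, fun h => one_ne_zero (congrFun h b), ?_⟩
    ext i
    rw [Matrix.sub_mulVec, Matrix.one_mulVec]
    by_cases hi : i ∈ B <;> simp [Matrix.mulVec, dotProduct, hK', hi, hK.2 i]
  obtain ⟨x, hx0, hx⟩ := Matrix.exists_vecMul_eq_zero_iff.2 hdet
  rw [Matrix.vecMul_sub, Matrix.vecMul_one, sub_eq_zero] at hx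
  have hout : ∀ j ∉ B, x j = 0 := by
    intro j hj
    rw [hx]
    simp only [Matrix.vecMul, dotProduct]
    refine Finset.sum_eq_zero fun i _ => ?_
    have hjb : j ≠ b := fun h => hj (h ▸ hb)
    by_cases hi : i ∈ B <;> simp [hK', hi, hjb]
    right
    exact hB i hi j hj
  have hxK : x ᵥ* K = x := by
    conv_rhs => rw [hx]
    ext j
    simp only [Matrix.vecMul, dotProduct]
    refine Finset.sum_congr rfl fun i _ => ?_
    by_cases hi : i ∈ B
    · simp [hK', hi]
    · simp [hout i hi]
  have hxμ := invariant_eq_smul hK hμ hxK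
  have hs : ∑ i, x i ≠ 0 := fun h => hx0 (by rw [hxμ, h, zero_smul])
  have := hout j hj
  rw [hxμ] at this
  simpa [hs] using this

/-- One step of the cookie chain together with the coin tossed at the current cookie. -/
def stepMean (K : Matrix (Fin N) (Fin N) ℝ) (p : Fin N → ℝ) (i : Fin N)
    (f : Bool → Fin N → ℝ) : ℝ :=
  p i * (K *ᵥ f true) i + (1 - p i) * (K *ᵥ f false) i

lemma IsStochastic.mulVec_mono (hK : IsStochastic K) {x y : Fin N → ℝ} (h : ∀ i, x i ≤ y i)
    (i : Fin N) : (K *ᵥ x) i ≤ (K *ᵥ y) i := by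
  simp only [Matrix.mulVec, dotProduct]
  exact Finset.sum_le_sum fun j _ => mul_le_mul_of_nonneg_left (h j) (hK.1 i j)

lemma stepMean_mono (hK : IsStochastic K) (hp : ∀ i, p i ∈ Set.Ioo (0 : ℝ) 1) (i : Fin N)
    {f g : Bool → Fin N → ℝ} (h : ∀ b j, f b j ≤ g b j) :
    stepMean K p i f ≤ stepMean K p i g := by
  unfold stepMean
  have h1 := (hp i).1
  have h2 := (hp i).2
  exact add_le_add (mul_le_mul_of_nonneg_left (hK.mulVec_mono (h true) i) h1.le)
    (mul_le_mul_of_nonneg_left (hK.mulVec_mono (h false) i) (by linarith))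

lemma stepMean_const (hK : IsStochastic K) (i : Fin N) (a : ℝ) :
    stepMean K p i (fun _ _ => a) = a := by
  simp only [stepMean, hK.mulVec_const]
  ring

lemma stepMean_add (i : Fin N) (f g : Bool → Fin N → ℝ) :
    stepMean K p i (fun b j => f b j + g b j) = stepMean K p i f + stepMean K p i g := by
  have h : ∀ b, K *ᵥ (fun j => f b j + g b j) = K *ᵥ f b + K *ᵥ g b :=
    fun b => Matrix.mulVec_add K (f b) (g b)
  simp only [stepMean, h, Pi.add_apply]
  ring

lemma stepMean_const_mul (i : Fin N) (a : ℝ) (f : Bool → Fin N → ℝ) :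
    stepMean K p i (fun b j => a * f b j) = a * stepMean K p i f := by
  have h : ∀ b, K *ᵥ (fun j => a * f b j) = a • (K *ᵥ f b) :=
    fun b => Matrix.mulVec_smul K a (f b)
  simp only [stepMean, h, Pi.smul_apply, smul_eq_mul]
  ring

end StochasticMatrix

section Parameters

variable {N : ℕ} {K : Matrix (Fin N) (Fin N) ℝ} {μ p η : Fin N → ℝ}

/-- The displacement of a step whose coin toss is `b`. -/
def stepSign (b : Bool) : ℝ := if b then 1 else -1

lemma vecMul_diagonal_mul (q x : Fin N → ℝ) :
    ∑ i, (μ ᵥ* (Matrix.diagonal q * K)) i * x i = ∑ i, μ i * (q i * (K *ᵥ x) i) := by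
  have : (μ ᵥ* (Matrix.diagonal q * K)) ⬝ᵥ x = μ ⬝ᵥ (Matrix.diagonal q *ᵥ (K *ᵥ x)) := by
    rw [Matrix.mulVec_mulVec, Matrix.dotProduct_mulVec]
  simp only [dotProduct, Matrix.mulVec_diagonal] at this
  exact this

lemma rvec_spec (hK : IsStochastic K) (hμ : HasUniqueStationaryDist K μ)
    (hcrit : ∑ i, μ i * p i = 1 / 2) :
    (∀ i, (K *ᵥ rvec K μ p) i = rvec K μ p i - (2 * p i - 1)) ∧
      ∑ i, μ i * ((1 - p i) * (K *ᵥ rvec K μ p) i) = 0 := by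
  have hq : ∑ i, μ i * (1 - p i) = 1 / 2 := by
    simp only [mul_sub, mul_one, Finset.sum_sub_distrib, hcrit, hμ.1.1.2]
    norm_num
  set c := μ ᵥ* (Matrix.diagonal (fun i => 1 - p i) * K) with hc
  have hc1 : ∑ i, c i = 1 / 2 := by
    have := vecMul_diagonal_mul (K := K) (μ := μ) (fun i => 1 - p i) (fun _ => 1)
    simp only [hK.mulVec_const, mul_one, hq] at this
    exact this
  have hdet : IsUnit (1 - K + (2 : ℝ) • Matrix.vecMulVec (fun i => 1 - p i) c).det := by
    have h2 : (2 : ℝ) • Matrix.vecMulVec (fun i => 1 - p i) c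
        = Matrix.vecMulVec (fun i => 1 - p i) ((2 : ℝ) • c) := by
      ext i j
      simp [Matrix.vecMulVec_apply]
      ring
    rw [h2]
    refine isUnit_det_one_sub_add hK hμ ?_ (by rw [hq]; norm_num)
    simp [← Finset.mul_sum, hc1]
  set w := (1 - K + (2 : ℝ) • Matrix.vecMulVec (fun i => 1 - p i) c)⁻¹ *ᵥ p with hw
  have hr : rvec K μ p = w - 1 := rfl
  have hM : (1 - K + (2 : ℝ) • Matrix.vecMulVec (fun i => 1 - p i) c) *ᵥ w = p := by
    rw [hw, Matrix.mulVec_mulVec, Matrix.mul_nonsing_inv _ hdet, Matrix.one_mulVec]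
  have hi : ∀ i, w i - (K *ᵥ w) i + 2 * ((1 - p i) * ∑ j, c j * w j) = p i := by
    intro i
    have := congrFun hM i
    rw [Matrix.add_mulVec, Matrix.sub_mulVec, Matrix.one_mulVec, Matrix.smul_mulVec] at this
    simpa [vecMulVec_mulVec_apply] using this
  have hcw : ∑ j, c j * w j = 1 / 2 := by
    have h1 : ∑ i, μ i * (w i - (K *ᵥ w) i + 2 * ((1 - p i) * ∑ j, c j * w j)) = 1 / 2 := by
      simp only [hi, hcrit]
    have h2 : ∀ i, μ i * (w i - (K *ᵥ w) i + 2 * ((1 - p i) * ∑ j, c j * w j))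
        = μ i * w i - μ i * (K *ᵥ w) i + μ i * (1 - p i) * (2 * ∑ j, c j * w j) := fun i => by ring
    simp only [h2, Finset.sum_add_distrib, Finset.sum_sub_distrib, ← Finset.sum_mul,
      stationary_mulVec hμ, hq] at h1
    linarith
  have hKr : ∀ i, (K *ᵥ rvec K μ p) i = (K *ᵥ w) i - 1 := by
    intro i
    have h1 : (1 : Fin N → ℝ) = fun _ => 1 := rfl
    rw [hr, Matrix.mulVec_sub, h1, hK.mulVec_const]
    rfl
  refine ⟨fun i => ?_, ?_⟩
  · have := hi i
    rw [hcw] at this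
    rw [hKr, hr]
    simp only [Pi.sub_apply, Pi.one_apply]
    linarith
  · rw [← vecMul_diagonal_mul, hr]
    simp only [Pi.sub_apply, Pi.one_apply, mul_sub, mul_one, Finset.sum_sub_distrib]
    rw [← hc, hcw, hc1, sub_self]

lemma nuVal_eq : nuVal K μ p = 2 + 4 * ∑ i, μ i * (p i * (K *ᵥ rvec K μ p) i) := by
  rw [nuVal, vecMul_diagonal_mul]

/-- The conditional variance of the increments of the martingale attached to a site. -/
def stepVar (K : Matrix (Fin N) (Fin N) ℝ) (μ p : Fin N → ℝ) (i : Fin N) : ℝ :=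
  stepMean K p i (fun b j => (stepSign b + rvec K μ p j - rvec K μ p i) ^ 2)

lemma nuVal_eq_stepVar (hK : IsStochastic K) (hμ : HasUniqueStationaryDist K μ)
    (hcrit : ∑ i, μ i * p i = 1 / 2) : nuVal K μ p = 2 * ∑ i, μ i * stepVar K μ p i := by
  obtain ⟨hr, horth⟩ := rvec_spec hK hμ hcrit
  set r := rvec K μ p with hrdef
  have hb : ∀ (b : Bool) (i : Fin N), (K *ᵥ fun j => (stepSign b + r j - r i) ^ 2) i
      = (K *ᵥ fun j => r j ^ 2) i + 2 * (stepSign b - r i) * (K *ᵥ r) i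
        + (stepSign b - r i) ^ 2 := by
    intro b i
    have : (fun j => (stepSign b + r j - r i) ^ 2)
        = (fun j => r j ^ 2) + ((2 * (stepSign b - r i)) • r
          + fun _ => (stepSign b - r i) ^ 2) := by
      ext j
      simp only [Pi.add_apply, Pi.smul_apply, smul_eq_mul]
      ring
    rw [this, Matrix.mulVec_add, Matrix.mulVec_add, Matrix.mulVec_smul, hK.mulVec_const]
    simp only [Pi.add_apply, Pi.smul_apply, smul_eq_mul]
    ring
  have hv : ∀ i, μ i * stepVar K μ p i = μ i * (K *ᵥ fun j => r j ^ 2) i - μ i * r i ^ 2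
      + μ i * 1 + 2 * (μ i * (p i * (K *ᵥ r) i)) - 2 * (μ i * ((1 - p i) * (K *ᵥ r) i)) := by
    intro i
    simp only [stepVar, stepMean, ← hrdef]
    rw [hb, hb]
    simp only [stepSign, if_true, hr, Bool.false_eq_true, if_false]
    ring
  rw [nuVal_eq, ← hrdef]
  simp only [hv, Finset.sum_add_distrib, Finset.sum_sub_distrib, ← Finset.mul_sum,
    stationary_mulVec hμ, horth, mul_one, hμ.1.1.2]
  ring

lemma stepVar_pos (hK : IsStochastic K) (hp : ∀ i, p i ∈ Set.Ioo (0 : ℝ) 1) (i : Fin N) :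
    0 < stepVar K μ p i := by
  set r := rvec K μ p with hrdef
  have h1 := (hp i).1
  have h2 := (hp i).2
  have hlow : 0 < 4 * p i * (1 - p i) := by
    have : 0 < 1 - p i := by linarith
    positivity
  refine hlow.trans_le ?_
  have key : stepVar K μ p i
      = (K *ᵥ fun j => p i * (1 + r j - r i) ^ 2 + (1 - p i) * (-1 + r j - r i) ^ 2) i := by
    have : (fun j => p i * (1 + r j - r i) ^ 2 + (1 - p i) * (-1 + r j - r i) ^ 2)
        = p i • (fun j => (1 + r j - r i) ^ 2) + (1 - p i) • (fun j => (-1 + r j - r i) ^ 2) := by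
      ext j
      simp
    rw [this, Matrix.mulVec_add, Matrix.mulVec_smul, Matrix.mulVec_smul]
    simp [stepVar, stepMean, stepSign, ← hrdef]
  rw [key]
  rw [← congrFun (hK.mulVec_const (4 * p i * (1 - p i))) i]
  refine hK.mulVec_mono (fun j => ?_) i
  nlinarith [sq_nonneg (p i * (1 + r j - r i) + (1 - p i) * (-1 + r j - r i))]

lemma nuVal_pos (hK : IsStochastic K) (hμ : HasUniqueStationaryDist K μ)
    (hp : ∀ i, p i ∈ Set.Ioo (0 : ℝ) 1) (hcrit : ∑ i, μ i * p i = 1 / 2) :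
    0 < nuVal K μ p := by
  rw [nuVal_eq_stepVar hK hμ hcrit]
  have hex : ∃ i, 0 < μ i := by
    by_contra! h
    have : ∑ i, μ i ≤ 0 := Finset.sum_nonpos fun i _ => h i
    linarith [hμ.1.1.2]
  obtain ⟨i, hi⟩ := hex
  have := Finset.sum_pos' (s := Finset.univ) (f := fun i => μ i * stepVar K μ p i)
    (fun j _ => mul_nonneg (hμ.1.1.1 j) (stepVar_pos hK hp j).le)
    ⟨i, Finset.mem_univ i, mul_pos hi (stepVar_pos hK hp i)⟩
  linarith

lemma sum_stationary_one_sub (hμ : HasUniqueStationaryDist K μ)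
    (hcrit : ∑ i, μ i * p i = 1 / 2) : ∑ i, μ i * (1 - p i) = 1 / 2 := by
  simp only [mul_sub, mul_one, Finset.sum_sub_distrib, hcrit, hμ.1.1.2]
  norm_num

lemma deltaVal_add_lt_one (hK : IsStochastic K) (hμ : HasUniqueStationaryDist K μ)
    (hp : ∀ i, p i ∈ Set.Ioo (0 : ℝ) 1) (hη : IsProbVec η)
    (hcrit : ∑ i, μ i * p i = 1 / 2) :
    deltaVal K μ p η + deltaVal K μ (fun i => 1 - p i) η < 1 := by
  obtain ⟨hr, horth⟩ := rvec_spec hK hμ hcrit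
  obtain ⟨hr', horth'⟩ := rvec_spec (p := fun i => 1 - p i) hK hμ
    (sum_stationary_one_sub hμ hcrit)
  have hν := nuVal_pos hK hμ hp hcrit
  have hν' : nuVal K μ (fun i => 1 - p i) = 2 + 4 * ∑ i, μ i *
      ((1 - p i) * (K *ᵥ rvec K μ (fun i => 1 - p i)) i) := nuVal_eq
  rw [deltaVal, deltaVal]
  rw [nuVal_eq] at hν ⊢
  rw [hν']
  set r := rvec K μ p
  set r' := rvec K μ (fun i => 1 - p i)
  have hsum : ∀ i, r i + r' i = ∑ j, μ j * (r j + r' j) := by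
    refine harmonic_const (u := fun i => r i + r' i) hK hμ ?_
    ext i
    have : (fun i => r i + r' i) = r + r' := rfl
    rw [this, Matrix.mulVec_add]
    simp only [Pi.add_apply, hr, hr']
    ring
  set c := ∑ j, μ j * (r j + r' j)
  have hr'c : r' = (fun _ => c) - r := by
    ext i
    simp only [Pi.sub_apply]
    linarith [hsum i]
  have hKr' : ∀ i, (K *ᵥ r') i = c - (K *ᵥ r) i := by
    intro i
    rw [hr'c, Matrix.mulVec_sub, hK.mulVec_const]
    rfl
  have h1 : ∑ i, μ i * (p i * (K *ᵥ r) i) = c / 2 := by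
    have h2 : ∀ i, μ i * ((1 - (1 - p i)) * (K *ᵥ r') i)
        = μ i * p i * c - μ i * (p i * (K *ᵥ r) i) := fun i => by rw [hKr']; ring
    simp only [h2, Finset.sum_sub_distrib, ← Finset.sum_mul, hcrit] at horth'
    linarith
  have h2 : ∑ i, μ i * ((1 - p i) * (K *ᵥ r') i) = c / 2 := by
    have h2 : ∀ i, μ i * ((1 - p i) * (K *ᵥ r') i)
        = μ i * (1 - p i) * c - μ i * ((1 - p i) * (K *ᵥ r) i) := fun i => by rw [hKr']; ring
    simp only [h2, Finset.sum_sub_distrib, ← Finset.sum_mul, sum_stationary_one_sub hμ hcrit,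
      horth]
    ring
  have h3 : ∑ i, η i * r' i = c - ∑ i, η i * r i := by
    simp only [hr'c, Pi.sub_apply, mul_sub, Finset.sum_sub_distrib, ← Finset.sum_mul, hη.2,
      one_mul]
  rw [h1] at hν ⊢
  rw [h2, h3, ← add_div, div_lt_one hν]
  linarith

/-- A function satisfying a first-failure equation with nonnegative data is nonnegative. -/
lemma nonneg_of_failure_eq (hK : IsStochastic K) (hp : ∀ i, p i ∈ Set.Ioo (0 : ℝ) 1)
    {x f : Fin N → ℝ} (hf : ∀ i, 0 ≤ f i)
    (hx : ∀ i, x i = p i * (K *ᵥ x) i + (1 - p i) * (K *ᵥ f) i) (i : Fin N) : 0 ≤ x i := by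
  have : Nonempty (Fin N) := ⟨i⟩
  obtain ⟨m, hm⟩ := Finite.exists_min x
  have h1 := hK.mulVec_mono hm m
  rw [hK.mulVec_const] at h1
  have h2 := hK.mulVec_mono hf m
  rw [hK.mulVec_const] at h2
  have h3 := hx m
  have hp1 := (hp m).1
  have hp2 := (hp m).2
  have : p m * x m ≤ p m * (K *ᵥ x) m := mul_le_mul_of_nonneg_left h1 hp1.le
  have : 0 ≤ (1 - p m) * (K *ᵥ f) m := mul_nonneg (by linarith) h2
  have : 0 ≤ (1 - p m) * x m := by linarith
  have : 0 ≤ x m := nonneg_of_mul_nonneg_right this (by linarith)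
  exact this.trans (hm i)

lemma exists_failure_eq (hK : IsStochastic K) (hp : ∀ i, p i ∈ Set.Ioo (0 : ℝ) 1)
    (f : Fin N → ℝ) :
    ∃ x : Fin N → ℝ, ∀ i, x i = p i * (K *ᵥ x) i + (1 - p i) * (K *ᵥ f) i := by
  have hdet : IsUnit (1 - Matrix.diagonal p * K).det := by
    rw [isUnit_iff_ne_zero]
    intro h0
    obtain ⟨x, hx0, hx⟩ := Matrix.exists_mulVec_eq_zero_iff.2 h0
    have hxi : ∀ i, x i = p i * (K *ᵥ x) i := by
      intro i
      have := congrFun hx i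
      rw [Matrix.sub_mulVec, Matrix.one_mulVec, ← Matrix.mulVec_mulVec] at this
      simp only [Pi.sub_apply, Matrix.mulVec_diagonal, Pi.zero_apply] at this
      linarith
    have hK0 : ∀ i, (K *ᵥ fun _ => (0 : ℝ)) i = 0 := fun i => by rw [hK.mulVec_const]
    have h1 : ∀ i, 0 ≤ x i := nonneg_of_failure_eq hK hp (f := fun _ => 0) (fun _ => le_rfl)
      fun i => by rw [hK0, mul_zero, add_zero]; exact hxi i
    have h2 : ∀ i, 0 ≤ (-x) i := nonneg_of_failure_eq hK hp (f := fun _ => 0) (fun _ => le_rfl)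
      fun i => by
        rw [hK0, mul_zero, add_zero, Matrix.mulVec_neg, Pi.neg_apply, Pi.neg_apply, mul_neg,
          ← hxi i]
    refine hx0 (funext fun i => le_antisymm ?_ (h1 i))
    have := h2 i
    simp only [Pi.neg_apply] at this
    simp only [Pi.zero_apply]
    linarith
  refine ⟨(1 - Matrix.diagonal p * K)⁻¹ *ᵥ (fun i => (1 - p i) * (K *ᵥ f) i), fun i => ?_⟩
  set x := (1 - Matrix.diagonal p * K)⁻¹ *ᵥ (fun i => (1 - p i) * (K *ᵥ f) i) with hx
  have hM : (1 - Matrix.diagonal p * K) *ᵥ x = fun i => (1 - p i) * (K *ᵥ f) i := by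
    rw [hx, Matrix.mulVec_mulVec, Matrix.mul_nonsing_inv _ hdet, Matrix.one_mulVec]
  have := congrFun hM i
  rw [Matrix.sub_mulVec, Matrix.one_mulVec, ← Matrix.mulVec_mulVec] at this
  simp only [Pi.sub_apply, Matrix.mulVec_diagonal] at this
  linarith

end Parameters

section FailureChain

variable {N : ℕ} {K : Matrix (Fin N) (Fin N) ℝ} {μ p η : Fin N → ℝ}

/-- `x i` is the expectation, for the cookie chain started at `i`, of `f` evaluated at the cookie
following the first failure. -/
def IsFailureMean (K : Matrix (Fin N) (Fin N) ℝ) (p f x : Fin N → ℝ) : Prop :=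
  ∀ i, x i = p i * (K *ᵥ x) i + (1 - p i) * (K *ᵥ f) i

lemma mulVec_affine (hK : IsStochastic K) (α β γ : ℝ) (x y : Fin N → ℝ) (i : Fin N) :
    (K *ᵥ fun i => α + β * x i + γ * y i) i = α + β * (K *ᵥ x) i + γ * (K *ᵥ y) i := by
  have : (fun i => α + β * x i + γ * y i) = (fun _ => α) + (β • x + γ • y) := by
    ext j
    simp only [Pi.add_apply, Pi.smul_apply, smul_eq_mul]
    ring
  rw [this, Matrix.mulVec_add, Matrix.mulVec_add, Matrix.mulVec_smul, Matrix.mulVec_smul,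
    hK.mulVec_const]
  simp only [Pi.add_apply, Pi.smul_apply, smul_eq_mul]
  ring

lemma IsFailureMean.affine (hK : IsStochastic K) {f g x y : Fin N → ℝ}
    (hx : IsFailureMean K p f x) (hy : IsFailureMean K p g y) (α β γ : ℝ) :
    IsFailureMean K p (fun i => α + β * f i + γ * g i) (fun i => α + β * x i + γ * y i) := by
  intro i
  rw [mulVec_affine hK, mulVec_affine hK]
  have h1 := hx i
  have h2 := hy i
  linear_combination β * h1 + γ * h2

lemma IsFailureMean.nonneg (hK : IsStochastic K) (hp : ∀ i, p i ∈ Set.Ioo (0 : ℝ) 1)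
    {x f : Fin N → ℝ} (hx : IsFailureMean K p f x) (hf : ∀ i, 0 ≤ f i) (i : Fin N) : 0 ≤ x i :=
  nonneg_of_failure_eq hK hp hf hx i

lemma IsFailureMean.orthogonal (hμ : HasUniqueStationaryDist K μ) {x f : Fin N → ℝ}
    (hx : IsFailureMean K p f x) (hf : ∑ i, μ i * ((1 - p i) * (K *ᵥ f) i) = 0) :
    ∑ i, μ i * ((1 - p i) * (K *ᵥ x) i) = 0 := by
  have h1 : ∀ i, μ i * ((1 - p i) * (K *ᵥ x) i)
      = μ i * (K *ᵥ x) i - μ i * x i + μ i * ((1 - p i) * (K *ᵥ f) i) := by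
    intro i
    have := hx i
    linear_combination μ i * this
  simp only [h1, Finset.sum_add_distrib, Finset.sum_sub_distrib, stationary_mulVec hμ, hf]
  ring

lemma exists_uniform_hitting (hK : IsStochastic K) (hμ : HasUniqueStationaryDist K μ)
    (hp : ∀ i, p i ∈ Set.Ioo (0 : ℝ) 1) :
    ∃ (j₀ : Fin N) (y : Fin N → ℝ) (c : ℝ), 0 < c ∧ c < 1 ∧ (∀ i, c ≤ y i) ∧
      IsFailureMean K p (fun j => if j = j₀ then 1 else 0) y := by
  have hex : ∃ i, 0 < μ i := by
    by_contra! h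
    have : ∑ i, μ i ≤ 0 := Finset.sum_nonpos fun i _ => h i
    linarith [hμ.1.1.2]
  obtain ⟨j₀, hj₀⟩ := hex
  have : Nonempty (Fin N) := ⟨j₀⟩
  set f : Fin N → ℝ := fun j => if j = j₀ then 1 else 0 with hf
  have hf0 : ∀ i, 0 ≤ f i := fun i => by rw [hf]; simp only; split_ifs <;> norm_num
  obtain ⟨y, hy⟩ := exists_failure_eq hK hp f
  have hy0 := nonneg_of_failure_eq hK hp hf0 hy
  have hKf : ∀ i, (K *ᵥ f) i = K i j₀ := fun i => by simp [Matrix.mulVec, dotProduct, hf]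
  have hpos : ∀ i, 0 < y i := by
    by_contra! h
    obtain ⟨b, hb⟩ := h
    have hz : ∀ i, y i = 0 → (K *ᵥ y) i = 0 ∧ K i j₀ = 0 := by
      intro i hi
      have h1 := hy i
      have hp1 := (hp i).1
      have hp2 := (hp i).2
      have h2 : 0 ≤ (K *ᵥ y) i := by
        have := hK.mulVec_mono hy0 i
        rwa [hK.mulVec_const] at this
      have h3 := hK.1 i j₀
      rw [hi, hKf] at h1
      have h4 : 0 ≤ p i * (K *ᵥ y) i := mul_nonneg hp1.le h2
      have h5 : 0 ≤ (1 - p i) * K i j₀ := mul_nonneg (by linarith) h3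
      constructor
      · have : p i * (K *ᵥ y) i = 0 := by linarith
        exact (mul_eq_zero.1 this).resolve_left hp1.ne'
      · have : (1 - p i) * K i j₀ = 0 := by linarith
        exact (mul_eq_zero.1 this).resolve_left (by linarith)
    have hclosed : ∀ i ∈ {i | y i = 0}, ∀ j ∉ {i | y i = 0}, K i j = 0 := by
      intro i hi j hj
      have h1 := (hz i hi).1
      simp only [Matrix.mulVec, dotProduct] at h1
      rw [Finset.sum_eq_zero_iff_of_nonneg
        (fun k _ => mul_nonneg (hK.1 i k) (hy0 k))] at h1
      exact (mul_eq_zero.1 (h1 j (Finset.mem_univ j))).resolve_right hj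
    have hout : ∀ j ∉ {i | y i = 0}, μ j = 0 := fun j hj =>
      stationary_eq_zero_of_closed hK hμ (B := {i | y i = 0}) (b := b)
        (le_antisymm hb (hy0 b)) hclosed hj
    have : μ j₀ = 0 := by
      have h1 := congrFun hμ.1.2 j₀
      rw [← h1]
      simp only [Matrix.vecMul, dotProduct]
      refine Finset.sum_eq_zero fun i _ => ?_
      by_cases hi : y i = 0
      · rw [(hz i hi).2, mul_zero]
      · rw [hout i hi, zero_mul]
    linarith
  obtain ⟨m, hm⟩ := Finite.exists_min y
  refine ⟨j₀, y, min (y m) (1 / 2), lt_min (hpos m) (by norm_num),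
    (min_le_right _ _).trans_lt (by norm_num), fun i => (min_le_left _ _).trans (hm i), hy⟩

/-- Iterating the failure chain on a centred function gives exponential decay. -/
lemma exists_failure_decay (hK : IsStochastic K) (hμ : HasUniqueStationaryDist K μ)
    (hp : ∀ i, p i ∈ Set.Ioo (0 : ℝ) 1) (hcrit : ∑ i, μ i * p i = 1 / 2) {r : Fin N → ℝ}
    (hr : ∑ i, μ i * ((1 - p i) * (K *ᵥ r) i) = 0) :
    ∃ (C θ : ℝ) (a : ℕ → Fin N → ℝ), 0 ≤ C ∧ 0 ≤ θ ∧ θ < 1 ∧ a 0 = r ∧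
      (∀ d, IsFailureMean K p (a d) (a (d + 1))) ∧ ∀ d i, |a d i| ≤ C * θ ^ d := by
  obtain ⟨j₀, y, c, hc0, hc1, hcy, hy⟩ := exists_uniform_hitting hK hμ hp
  choose A hA using fun f => exists_failure_eq hK hp f
  have hA' : ∀ f, IsFailureMean K p f (A f) := hA
  set a : ℕ → Fin N → ℝ := fun d => A^[d] r with ha
  have ha1 : ∀ d, IsFailureMean K p (a d) (a (d + 1)) := by
    intro d
    simp only [ha, Function.iterate_succ_apply']
    exact hA' _
  have horth : ∀ d, ∑ i, μ i * ((1 - p i) * (K *ᵥ a d) i) = 0 := by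
    intro d
    induction d with
    | zero => exact hr
    | succ d ih => exact (ha1 d).orthogonal hμ ih
  obtain ⟨B, hB⟩ : ∃ B : ℝ, ∀ i, |r i| ≤ B := by
    obtain ⟨B, hB⟩ := (Set.finite_range fun i => |r i|).bddAbove
    exact ⟨B, fun i => hB ⟨i, rfl⟩⟩
  have hB0 : 0 ≤ B := (abs_nonneg _).trans (hB j₀)
  have hosc : ∀ d, ∃ l, ∀ i, l ≤ a d i ∧ a d i ≤ l + 2 * B * (1 - c) ^ d := by
    intro d
    induction d with
    | zero =>
      refine ⟨-B, fun i => ?_⟩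
      have := abs_le.1 (hB i)
      simp only [ha, Function.iterate_zero, id, pow_zero]
      exact ⟨this.1, by linarith⟩
    | succ d ih =>
      obtain ⟨l, hl⟩ := ih
      set o := 2 * B * (1 - c) ^ d with ho
      set t := a d j₀ with ht
      have htl := hl j₀
      rw [← ht] at htl
      refine ⟨l + c * (t - l), fun i => ?_⟩
      have hup := ((hy.affine hK (ha1 d) (l + o) (-(l + o - t)) (-1)).nonneg hK hp ?_) i
      have hlo := ((hy.affine hK (ha1 d) (-l) (-(t - l)) 1).nonneg hK hp ?_) i
      · have h1 := mul_le_mul_of_nonneg_left (hcy i) (sub_nonneg.2 htl.1)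
        have h2 := mul_le_mul_of_nonneg_left (hcy i) (sub_nonneg.2 htl.2)
        rw [pow_succ, ← mul_assoc, ← ho]
        constructor <;> nlinarith
      · intro j
        by_cases hj : j = j₀
        · subst hj
          simp only [if_true]
          linarith
        · simp only [hj, if_false]
          linarith [(hl j).1]
      · intro j
        by_cases hj : j = j₀
        · subst hj
          simp only [if_true]
          linarith
        · simp only [hj, if_false]
          linarith [(hl j).2]
  refine ⟨2 * B, 1 - c, a, by linarith, by linarith, by linarith, rfl, ha1, fun d i => ?_⟩
  obtain ⟨l, hl⟩ := hosc d
  have hq := sum_stationary_one_sub hμ hcrit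
  have hw : ∀ i, 0 ≤ μ i * (1 - p i) := fun i =>
    mul_nonneg (hμ.1.1.1 i) (by linarith [(hp i).2])
  have h1 : l ≤ 0 := by
    have h2 : ∑ i, μ i * (1 - p i) * l ≤ ∑ i, μ i * ((1 - p i) * (K *ᵥ a d) i) := by
      refine Finset.sum_le_sum fun i _ => ?_
      rw [← mul_assoc]
      refine mul_le_mul_of_nonneg_left ?_ (hw i)
      have := hK.mulVec_mono (fun j => (hl j).1) i
      rwa [hK.mulVec_const] at this
    rw [← Finset.sum_mul, hq, horth] at h2
    linarith
  have h3 : 0 ≤ l + 2 * B * (1 - c) ^ d := by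
    have h2 : ∑ i, μ i * ((1 - p i) * (K *ᵥ a d) i)
        ≤ ∑ i, μ i * (1 - p i) * (l + 2 * B * (1 - c) ^ d) := by
      refine Finset.sum_le_sum fun i _ => ?_
      rw [← mul_assoc]
      refine mul_le_mul_of_nonneg_left ?_ (hw i)
      have := hK.mulVec_mono (fun j => (hl j).2) i
      rwa [hK.mulVec_const] at this
    rw [← Finset.sum_mul, hq, horth] at h2
    linarith
  have := hl i
  exact abs_le.2 ⟨by linarith, by linarith⟩

end FailureChain

section StepOperator

variable {N : ℕ} {K : Matrix (Fin N) (Fin N) ℝ} {μ p η : Fin N → ℝ}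

/-- The transition operator of the toss-by-toss process of one cookie stack, in the state
`(i, a, d)`: next cookie `i`, number `a` of successes so far, and number `d` of failures still to
come; the process is frozen once `d = 0`. -/
def stepOp (K : Matrix (Fin N) (Fin N) ℝ) (p : Fin N → ℝ) (ψ : Fin N → ℕ → ℕ → ℝ) :
    Fin N → ℕ → ℕ → ℝ
  | i, a, 0 => ψ i a 0
  | i, a, d + 1 => stepMean K p i (fun b j => if b then ψ j (a + 1) (d + 1) else ψ j a d)

lemma stepOp_mono (hK : IsStochastic K) (hp : ∀ i, p i ∈ Set.Ioo (0 : ℝ) 1) :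
    Monotone (stepOp K p) := by
  intro ψ φ h i a d
  cases d with
  | zero => exact h i a 0
  | succ d =>
    simp only [stepOp]
    refine stepMean_mono hK hp i fun b j => ?_
    cases b
    · exact h j a d
    · exact h j (a + 1) (d + 1)

lemma stepOp_const (hK : IsStochastic K) (c : ℝ) :
    stepOp K p (fun _ _ _ => c) = fun _ _ _ => c := by
  ext i a d
  cases d with
  | zero => rfl
  | succ d => simpa [stepOp] using stepMean_const hK i c

lemma stepOp_combo (β γ : ℝ) (ψ φ : Fin N → ℕ → ℕ → ℝ) :
    stepOp K p (β • ψ + γ • φ) = β • stepOp K p ψ + γ • stepOp K p φ := by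
  ext i a d
  cases d with
  | zero => rfl
  | succ d =>
    simp only [stepOp, Pi.add_apply, Pi.smul_apply, smul_eq_mul]
    rw [← stepMean_const_mul, ← stepMean_const_mul, ← stepMean_add]
    congr 1
    ext b j
    cases b <;> simp

lemma iterate_stepOp_mono (hK : IsStochastic K) (hp : ∀ i, p i ∈ Set.Ioo (0 : ℝ) 1) (t : ℕ)
    {ψ φ : Fin N → ℕ → ℕ → ℝ} (h : ∀ i a d, ψ i a d ≤ φ i a d) (i : Fin N) (a d : ℕ) :
    (stepOp K p)^[t] ψ i a d ≤ (stepOp K p)^[t] φ i a d :=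
  (stepOp_mono hK hp).iterate t h i a d

lemma iterate_stepOp_const (hK : IsStochastic K) (t : ℕ) (c : ℝ) :
    (stepOp K p)^[t] (fun _ _ _ => c) = fun _ _ _ => c :=
  Function.iterate_fixed (stepOp_const hK c) t

lemma iterate_stepOp_combo (t : ℕ) (β γ : ℝ) (ψ φ : Fin N → ℕ → ℕ → ℝ) :
    (stepOp K p)^[t] (β • ψ + γ • φ) = β • (stepOp K p)^[t] ψ + γ • (stepOp K p)^[t] φ := by
  induction t with
  | zero => rfl
  | succ t ih => simp only [Function.iterate_succ_apply', ih, stepOp_combo]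

lemma iterate_stepOp_le (hK : IsStochastic K) (hp : ∀ i, p i ∈ Set.Ioo (0 : ℝ) 1) (t : ℕ)
    {ψ : Fin N → ℕ → ℕ → ℝ} (h : stepOp K p ψ ≤ ψ) : (stepOp K p)^[t] ψ ≤ ψ := by
  induction t with
  | zero => exact le_rfl
  | succ t ih =>
    rw [Function.iterate_succ_apply']
    exact (stepOp_mono hK hp ih).trans h

/-- Domination by an affine function of `φ` passes to the iterates. -/
lemma iterate_stepOp_le_affine (hK : IsStochastic K) (hp : ∀ i, p i ∈ Set.Ioo (0 : ℝ) 1) (t : ℕ)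
    {ψ φ : Fin N → ℕ → ℕ → ℝ} {β c : ℝ} (h : ∀ i a d, ψ i a d ≤ β * φ i a d + c)
    (i : Fin N) (a d : ℕ) :
    (stepOp K p)^[t] ψ i a d ≤ β * (stepOp K p)^[t] φ i a d + c := by
  have h1 := iterate_stepOp_mono hK hp t (φ := β • φ + (1 : ℝ) • fun _ _ _ => c)
    (fun i a d => by simpa using h i a d) i a d
  rw [iterate_stepOp_combo, iterate_stepOp_const hK] at h1
  simpa using h1

lemma abs_iterate_stepOp_sub_le (hK : IsStochastic K) (hp : ∀ i, p i ∈ Set.Ioo (0 : ℝ) 1) (t : ℕ)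
    {ψ ψ' φ : Fin N → ℕ → ℕ → ℝ} {β c : ℝ}
    (h : ∀ i a d, |ψ i a d - ψ' i a d| ≤ β * φ i a d + c) (i : Fin N) (a d : ℕ) :
    |(stepOp K p)^[t] ψ i a d - (stepOp K p)^[t] ψ' i a d|
      ≤ β * (stepOp K p)^[t] φ i a d + c := by
  have key : ∀ ψ ψ' : Fin N → ℕ → ℕ → ℝ, (∀ i a d, |ψ i a d - ψ' i a d| ≤ β * φ i a d + c) →
      (stepOp K p)^[t] ψ i a d - (stepOp K p)^[t] ψ' i a d
        ≤ β * (stepOp K p)^[t] φ i a d + c := by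
    intro ψ ψ' h
    have h1 := iterate_stepOp_le_affine hK hp t (ψ := (1 : ℝ) • ψ + (-1 : ℝ) • ψ') (φ := φ)
      (β := β) (c := c) (fun i a d => by
        have := (abs_le.1 (h i a d)).2
        simp only [Pi.add_apply, Pi.smul_apply, smul_eq_mul]
        linarith) i a d
    rw [iterate_stepOp_combo] at h1
    simp only [Pi.add_apply, Pi.smul_apply, smul_eq_mul] at h1
    linarith
  refine abs_le.2 ⟨?_, key ψ ψ' h⟩
  have := key ψ' ψ fun i a d => by rw [abs_sub_comm]; exact h i a d
  linarith

section Estimates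

variable {r : Fin N → ℝ}

lemma stepMean_increment (hK : IsStochastic K)
    (hr : ∀ i, (K *ᵥ r) i = r i - (2 * p i - 1)) (i : Fin N) :
    stepMean K p i (fun b j => stepSign b + r j - r i) = 0 := by
  have h : ∀ b, (K *ᵥ fun j => stepSign b + r j - r i) i = stepSign b - r i + (K *ᵥ r) i := by
    intro b
    have := mulVec_affine hK (stepSign b - r i) 1 0 r r i
    rw [one_mul, zero_mul, add_zero] at this
    rw [← this]
    congr 2
    ext j
    ring
  simp only [stepMean]
  rw [h, h, hr]
  simp only [stepSign]
  norm_num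
  ring

/-- `stepMean` of an affine function of the increment plus a further function. -/
lemma stepMean_increment_affine (hK : IsStochastic K)
    (hr : ∀ i, (K *ᵥ r) i = r i - (2 * p i - 1)) (i : Fin N) (α β : ℝ)
    (g : Bool → Fin N → ℝ) :
    stepMean K p i (fun b j => α + (β * (stepSign b + r j - r i) + g b j))
      = α + stepMean K p i g := by
  rw [stepMean_add, stepMean_add, stepMean_const_mul, stepMean_increment hK hr,
    stepMean_const hK]
  ring

lemma quartic_increment {c X Y x y a b e : ℝ} (hc : 1 ≤ c) (hY : 0 ≤ Y) (hx : |x| ≤ c)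
    (hy : |y| ≤ c) (ha : a = 4 * (6 * c ^ 2 + 4 * c ^ 3)) (hb : b = a * c ^ 2)
    (he : e = 2 * (4 * c ^ 3 + c ^ 4 + 4 * a * c ^ 4 + a * c ^ 3 + b * c ^ 2)) :
    (X + x) ^ 4 + a * (X + x) ^ 2 * (Y + y) + b * (Y + y) ^ 2 + e * (Y + y)
      ≤ X ^ 4 + a * X ^ 2 * Y + b * Y ^ 2 + e * Y + (4 * X ^ 3 + 2 * a * X * Y) * x
        + (a * X ^ 2 + 2 * b * Y + e) * (y + 1 / 2) := by
  have hc0 : 0 ≤ c := by linarith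
  have ha0 : 0 ≤ a := by rw [ha]; positivity
  have hb0 : 0 ≤ b := by rw [hb]; positivity
  have hx2 : x ^ 2 ≤ c ^ 2 := sq_le_sq' (abs_le.1 hx).1 (abs_le.1 hx).2
  have hy2 : y ^ 2 ≤ c ^ 2 := sq_le_sq' (abs_le.1 hy).1 (abs_le.1 hy).2
  have hX3 : X * x ^ 3 ≤ |X| * c ^ 3 := by
    calc X * x ^ 3 ≤ |X * x ^ 3| := le_abs_self _
      _ = |X| * |x| ^ 3 := by rw [abs_mul, abs_pow]
      _ ≤ |X| * c ^ 3 := by gcongr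
  have hx4 : x ^ 4 ≤ c ^ 4 := by
    calc x ^ 4 = |x| ^ 4 := by rw [← abs_pow, abs_of_nonneg (by positivity)]
      _ ≤ c ^ 4 := by gcongr
  have hXxy : X * (x * y) ≤ |X| * c ^ 2 := by
    calc X * (x * y) ≤ |X * (x * y)| := le_abs_self _
      _ = |X| * (|x| * |y|) := by rw [abs_mul, abs_mul]
      _ ≤ |X| * (c * c) := by gcongr
      _ = |X| * c ^ 2 := by ring
  have hxxy : x ^ 2 * y ≤ c ^ 3 := by
    calc x ^ 2 * y ≤ |x ^ 2 * y| := le_abs_self _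
      _ = |x| ^ 2 * |y| := by rw [abs_mul, abs_pow]
      _ ≤ c ^ 2 * c := by gcongr
      _ = c ^ 3 := by ring
  have hXX : X ^ 2 * x ^ 2 ≤ X ^ 2 * c ^ 2 := by gcongr
  have hYx : Y * x ^ 2 ≤ Y * c ^ 2 := by gcongr
  have hX1 : |X| ≤ X ^ 2 + 1 := by
    rw [← sq_abs]
    nlinarith [sq_nonneg (|X| - 1), abs_nonneg X]
  have hX2 : 2 * c ^ 2 * |X| ≤ X ^ 2 / 4 + 4 * c ^ 4 := by
    rw [← sq_abs X]
    nlinarith [sq_nonneg (|X| / 2 - 2 * c ^ 2)]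
  have e1 : (X + x) ^ 4 ≤ X ^ 4 + 4 * X ^ 3 * x + 6 * c ^ 2 * X ^ 2 + 4 * c ^ 3 * (X ^ 2 + 1)
      + c ^ 4 := by
    have h1 : c ^ 3 * |X| ≤ c ^ 3 * (X ^ 2 + 1) := by gcongr
    have h2 : (X + x) ^ 4 = X ^ 4 + 4 * X ^ 3 * x + 6 * (X ^ 2 * x ^ 2) + 4 * (X * x ^ 3) + x ^ 4 := by
      ring
    rw [h2]
    linarith
  have e2 : (X + x) ^ 2 * (Y + y) ≤ X ^ 2 * Y + X ^ 2 * y + 2 * X * Y * x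
      + (X ^ 2 / 4 + 4 * c ^ 4) + c ^ 2 * Y + c ^ 3 := by
    have h2 : (X + x) ^ 2 * (Y + y) = X ^ 2 * Y + X ^ 2 * y + 2 * X * Y * x + 2 * (X * (x * y))
      + Y * x ^ 2 + x ^ 2 * y := by ring
    rw [h2]
    linarith
  have e3 : (Y + y) ^ 2 ≤ Y ^ 2 + 2 * Y * y + c ^ 2 := by
    have : (Y + y) ^ 2 = Y ^ 2 + 2 * Y * y + y ^ 2 := by ring
    rw [this]
    linarith
  have e2' := mul_le_mul_of_nonneg_left e2 ha0
  have e3' := mul_le_mul_of_nonneg_left e3 hb0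
  have hfin : 6 * c ^ 2 * X ^ 2 + 4 * c ^ 3 * (X ^ 2 + 1) + c ^ 4
      + a * ((X ^ 2 / 4 + 4 * c ^ 4) + c ^ 2 * Y + c ^ 3) + b * c ^ 2
      = (a * X ^ 2 + 2 * b * Y + e) * (1 / 2) := by
    rw [he, hb, ha]
    ring
  linear_combination e1 + e2' + e3' + hfin

lemma abs_increment_le {B : ℝ} (hB : ∀ i, |r i| ≤ B) (b : Bool) (i j : Fin N) :
    |stepSign b + r j - r i| ≤ 1 + 2 * B := by
  have h1 := abs_le.1 (hB i)
  have h2 := abs_le.1 (hB j)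
  rw [abs_le]
  cases b <;> simp only [stepSign] <;> norm_num <;> constructor <;> linarith

/-- One step of the toss-by-toss process, for functions of the corrected displacement and of the
corrected number of failures still to come. -/
lemma stepOp_corrected (G : Fin N → ℝ → ℝ → ℝ) (m B : ℝ) (i : Fin N) (a d : ℕ) :
    stepOp K p (fun i a d => G i (a + d - m + r i) (d + r i / 2 + B)) i a (d + 1)
      = stepMean K p i (fun b j =>
          G j (a + (d + 1 : ℕ) - m + r i + (stepSign b + r j - r i))
            ((d + 1 : ℕ) + r i / 2 + B + ((stepSign b + r j - r i) / 2 - 1 / 2))) := by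
  simp only [stepOp]
  congr 1
  ext b j
  cases b
  · simp only [stepSign, Bool.false_eq_true, if_false]
    congr 1 <;> (push_cast; ring)
  · simp only [stepSign, if_true]
    congr 1 <;> (push_cast; ring)

lemma stepOp_quartic_le (hK : IsStochastic K) (hp : ∀ i, p i ∈ Set.Ioo (0 : ℝ) 1)
    (hr : ∀ i, (K *ᵥ r) i = r i - (2 * p i - 1)) {B c a b e : ℝ} (hB : ∀ i, |r i| ≤ B)
    (hc : c = 1 + 2 * B) (hc1 : 1 ≤ c) (ha : a = 4 * (6 * c ^ 2 + 4 * c ^ 3)) (hb : b = a * c ^ 2)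
    (he : e = 2 * (4 * c ^ 3 + c ^ 4 + 4 * a * c ^ 4 + a * c ^ 3 + b * c ^ 2)) (m : ℝ)
    {G : ℝ → ℝ → ℝ} (hG : G = fun X Y => X ^ 4 + a * X ^ 2 * Y + b * Y ^ 2 + e * Y) :
    stepOp K p (fun i k d => G (k + d - m + r i) (d + r i / 2 + B))
      ≤ fun (i : Fin N) (k d : ℕ) => G (k + d - m + r i) (d + r i / 2 + B) := by
  intro i k d
  cases d with
  | zero => exact le_rfl
  | succ d =>
    rw [stepOp_corrected fun _ => G]
    change _ ≤ G (k + (d + 1 : ℕ) - m + r i) ((d + 1 : ℕ) + r i / 2 + B)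
    have hY0 : 0 ≤ ((d + 1 : ℕ) : ℝ) + r i / 2 + B := by
      have h1 := (abs_le.1 (hB i)).1
      have h2 : (0 : ℝ) ≤ (d + 1 : ℕ) := Nat.cast_nonneg _
      have h3 := (abs_nonneg _).trans (hB i)
      linarith
    generalize (k : ℝ) + (d + 1 : ℕ) - m + r i = X at *
    generalize ((d + 1 : ℕ) : ℝ) + r i / 2 + B = Y at *
    calc stepMean K p i (fun β j => G (X + (stepSign β + r j - r i))
            (Y + ((stepSign β + r j - r i) / 2 - 1 / 2)))
        ≤ stepMean K p i (fun β j => G X Y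
            + ((4 * X ^ 3 + 2 * a * X * Y + (a * X ^ 2 + 2 * b * Y + e) / 2)
              * (stepSign β + r j - r i) + 0)) := by
          refine stepMean_mono hK hp i fun β j => ?_
          have hx := abs_increment_le hB β i j
          rw [← hc] at hx
          generalize stepSign β + r j - r i = x at *
          have hy : |x / 2 - 1 / 2| ≤ c := by
            rw [abs_le] at hx ⊢
            constructor <;> linarith
          rw [hG]
          refine (quartic_increment hc1 hY0 hx hy ha hb he).trans_eq ?_
          ring
      _ = G X Y := by rw [stepMean_increment_affine hK hr, stepMean_const hK, add_zero]

lemma pow_four_sub_le {X s B : ℝ} (hs : |s| ≤ B) :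
    (X - s) ^ 4 ≤ 8 * X ^ 4 + 8 * B ^ 4 := by
  have hs4 : s ^ 4 ≤ B ^ 4 := by
    calc s ^ 4 = |s| ^ 4 := by rw [← abs_pow, abs_of_nonneg (by positivity)]
      _ ≤ B ^ 4 := by gcongr
  have h1 : (X - s) ^ 2 ≤ 2 * X ^ 2 + 2 * s ^ 2 := by nlinarith [sq_nonneg (X + s)]
  have h2 : ((X - s) ^ 2) ^ 2 ≤ (2 * X ^ 2 + 2 * s ^ 2) ^ 2 :=
    pow_le_pow_left₀ (sq_nonneg _) h1 2
  nlinarith [sq_nonneg (X ^ 2 - s ^ 2)]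

lemma quartic_initial_le {a b e B c s n : ℝ} (ha : 0 ≤ a) (hb : 0 ≤ b) (he : 0 ≤ e)
    (hc : c = 1 + 2 * B) (hs : |s| ≤ B) (hn : 1 ≤ n) :
    s ^ 4 + a * s ^ 2 * (n + s / 2 + B) + b * (n + s / 2 + B) ^ 2 + e * (n + s / 2 + B)
      ≤ (B ^ 4 + a * B ^ 2 * c + b * c ^ 2 + e * c) * n ^ 2 := by
  have hsB := abs_le.1 hs
  have hB0 := (abs_nonneg _).trans hs
  have hc0 : 0 ≤ c := by linarith
  have hY1 : n + s / 2 + B ≤ c * n := by rw [hc]; nlinarith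
  have hY0 : 0 ≤ n + s / 2 + B := by linarith
  generalize n + s / 2 + B = Y at *
  have hs2 : s ^ 2 ≤ B ^ 2 := sq_le_sq' hsB.1 hsB.2
  have hs4 : s ^ 4 ≤ B ^ 4 := by
    calc s ^ 4 = (s ^ 2) ^ 2 := by ring
      _ ≤ (B ^ 2) ^ 2 := by gcongr
      _ = B ^ 4 := by ring
  have hnn : n ≤ n ^ 2 := by nlinarith
  have hY2 : Y ≤ c * n ^ 2 := hY1.trans (by gcongr)
  have t1 : s ^ 4 ≤ B ^ 4 * n ^ 2 :=
    hs4.trans (le_mul_of_one_le_right (by positivity) (by nlinarith))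
  have t2 : a * s ^ 2 * Y ≤ a * B ^ 2 * (c * n ^ 2) := by gcongr
  have t3 : b * Y ^ 2 ≤ b * (c * n) ^ 2 := by gcongr
  have t4 : e * Y ≤ e * (c * n ^ 2) := by gcongr
  linear_combination t1 + t2 + t3 + t4

lemma exists_abs_le (r : Fin N → ℝ) : ∃ B : ℝ, 0 ≤ B ∧ ∀ i, |r i| ≤ B := by
  obtain ⟨B, hB⟩ := (Set.finite_range fun i => |r i|).bddAbove
  exact ⟨max B 0, le_max_right _ _, fun i => (hB ⟨i, rfl⟩).trans (le_max_left _ _)⟩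

lemma exists_fourth_moment (hK : IsStochastic K) (hp : ∀ i, p i ∈ Set.Ioo (0 : ℝ) 1)
    (hr : ∀ i, (K *ᵥ r) i = r i - (2 * p i - 1)) :
    ∃ C : ℝ, 0 ≤ C ∧ ∀ (n t : ℕ) (i : Fin N), 1 ≤ n →
      (stepOp K p)^[t] (fun _ a d => ((a : ℝ) + d - n) ^ 4) i 0 n ≤ C * (n : ℝ) ^ 2 := by
  obtain ⟨B, hB0, hB⟩ := exists_abs_le r
  obtain ⟨c, hc⟩ : ∃ c, c = 1 + 2 * B := ⟨_, rfl⟩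
  have hc1 : 1 ≤ c := by linarith
  obtain ⟨a, ha⟩ : ∃ a, a = 4 * (6 * c ^ 2 + 4 * c ^ 3) := ⟨_, rfl⟩
  obtain ⟨b, hb⟩ : ∃ b, b = a * c ^ 2 := ⟨_, rfl⟩
  obtain ⟨e, he⟩ : ∃ e, e = 2 * (4 * c ^ 3 + c ^ 4 + 4 * a * c ^ 4 + a * c ^ 3 + b * c ^ 2) :=
    ⟨_, rfl⟩
  obtain ⟨G, hG⟩ : ∃ G : ℝ → ℝ → ℝ, G = fun X Y => X ^ 4 + a * X ^ 2 * Y + b * Y ^ 2 + e * Y :=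
    ⟨_, rfl⟩
  have hc0 : 0 ≤ c := by linarith
  have ha0 : 0 ≤ a := by rw [ha]; positivity
  have hb0 : 0 ≤ b := by rw [hb]; positivity
  have he0 : 0 ≤ e := by rw [he]; positivity
  refine ⟨8 * (B ^ 4 + a * B ^ 2 * c + b * c ^ 2 + e * c) + 8 * B ^ 4, by positivity,
    fun n t i hn => ?_⟩
  have hn1 : (1 : ℝ) ≤ n := by exact_mod_cast hn
  have h1 := iterate_stepOp_le_affine hK hp t (ψ := fun _ a d => ((a : ℝ) + d - n) ^ 4)
    (φ := fun i k d => G (k + d - n + r i) (d + r i / 2 + B))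
    (β := 8) (c := 8 * B ^ 4) (fun i k d => by
      have hY : 0 ≤ (d : ℝ) + r i / 2 + B := by
        have h1 := (abs_le.1 (hB i)).1
        have h2 : (0 : ℝ) ≤ d := Nat.cast_nonneg _
        linarith
      have h1 := pow_four_sub_le (X := (k : ℝ) + d - n + r i) (hB i)
      rw [add_sub_cancel_right] at h1
      refine h1.trans ?_
      rw [hG]
      have : 0 ≤ a * ((k : ℝ) + d - n + r i) ^ 2 * (d + r i / 2 + B)
        + b * (d + r i / 2 + B) ^ 2 + e * (d + r i / 2 + B) := by positivity
      linarith) i 0 n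
  refine h1.trans ?_
  have h2 := iterate_stepOp_le hK hp t (stepOp_quartic_le hK hp hr hB hc hc1 ha hb he n hG) i 0 n
  have h3 := quartic_initial_le ha0 hb0 he0 hc (hB i) hn1
  have hval : G ((0 : ℕ) + (n : ℝ) - n + r i) (n + r i / 2 + B) = r i ^ 4
      + a * r i ^ 2 * (n + r i / 2 + B) + b * (n + r i / 2 + B) ^ 2 + e * (n + r i / 2 + B) := by
    rw [hG]
    simp
  rw [← hval] at h3
  have h4 : B ^ 4 ≤ B ^ 4 * (n : ℝ) ^ 2 := le_mul_of_one_le_right (by positivity) (by nlinarith)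
  have h5 := h2.trans h3
  linear_combination 8 * h5 + 8 * h4

end Estimates

end StepOperator

section StepOperatorMoments

variable {N : ℕ} {K : Matrix (Fin N) (Fin N) ℝ} {μ p η : Fin N → ℝ}

lemma iterate_stepOp_eq_self {ψ : Fin N → ℕ → ℕ → ℝ}
    (h : ∀ i a d, stepOp K p ψ i a (d + 1) = ψ i a (d + 1)) (t : ℕ) : (stepOp K p)^[t] ψ = ψ := by
  refine Function.iterate_fixed ?_ t
  ext i a d
  cases d with
  | zero => rfl
  | succ d => exact h i a d

lemma exists_survival_decay (hK : IsStochastic K) (hp : ∀ i, p i ∈ Set.Ioo (0 : ℝ) 1) :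
    ∃ lam : ℝ, 0 ≤ lam ∧ lam < 1 ∧ ∀ (t : ℕ) (i : Fin N) (a d : ℕ),
      (stepOp K p)^[t] (fun _ _ d => if d = 0 then 0 else 1) i a d ≤ lam ^ t * 2 ^ d := by
  obtain ⟨q, hq0, hq1, hq⟩ : ∃ q : ℝ, 0 ≤ q ∧ q < 1 ∧ ∀ i, p i ≤ q := by
    rcases isEmpty_or_nonempty (Fin N) with h | h
    · exact ⟨0, le_rfl, one_pos, fun i => h.elim i⟩
    · obtain ⟨i, hi⟩ := Finite.exists_max p
      exact ⟨p i, (hp i).1.le, (hp i).2, hi⟩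
  obtain ⟨lam, hlam⟩ : ∃ lam, lam = (1 + q) / 2 := ⟨_, rfl⟩
  have hlam0 : 0 ≤ lam := by linarith
  refine ⟨lam, hlam0, by linarith, fun t i a d => ?_⟩
  obtain ⟨g, hg⟩ : ∃ g : Fin N → ℕ → ℕ → ℝ, g = fun _ _ d => if d = 0 then 0 else 2 ^ d :=
    ⟨_, rfl⟩
  have hg0 : stepOp K p g ≤ lam • g := by
    intro i a d
    cases d with
    | zero => simp [stepOp, hg]
    | succ d =>
      calc stepOp K p g i a (d + 1)
          ≤ stepMean K p i (fun b _ => if b then 2 ^ (d + 1) else 2 ^ d) := by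
            simp only [stepOp]
            refine stepMean_mono hK hp i fun b j => ?_
            cases b
            · simp only [hg]
              split_ifs <;> simp_all
            · simp [hg]
        _ = p i * 2 ^ (d + 1) + (1 - p i) * 2 ^ d := by
            simp [stepMean, hK.mulVec_const]
        _ ≤ lam * 2 ^ (d + 1) := by
            have h1 : (0 : ℝ) < 2 ^ d := by positivity
            have h2 := mul_le_mul_of_nonneg_right (hq i) h1.le
            rw [hlam, pow_succ]
            linarith
        _ = (lam • g) i a (d + 1) := by simp [hg]
  have hgt : ∀ t, (stepOp K p)^[t] g ≤ lam ^ t • g := by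
    intro t
    induction t with
    | zero => simp
    | succ t ih =>
      rw [Function.iterate_succ_apply']
      refine (stepOp_mono hK hp ih).trans ?_
      have h1 := stepOp_combo (K := K) (p := p) (lam ^ t) 0 g g
      rw [zero_smul, zero_smul, add_zero, add_zero] at h1
      rw [h1, pow_succ, mul_smul]
      intro i a d
      exact mul_le_mul_of_nonneg_left (hg0 i a d) (pow_nonneg hlam0 t)
  calc (stepOp K p)^[t] (fun _ _ d => if d = 0 then 0 else 1) i a d
      ≤ (stepOp K p)^[t] g i a d := by
        refine iterate_stepOp_mono hK hp t (fun i a d => ?_) i a d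
        simp only [hg]
        split_ifs
        · exact le_rfl
        · exact one_le_pow₀ one_le_two
    _ ≤ lam ^ t * g i a d := hgt t i a d
    _ ≤ lam ^ t * 2 ^ d := by
        refine mul_le_mul_of_nonneg_left ?_ (pow_nonneg hlam0 t)
        simp only [hg]
        split_ifs
        · positivity
        · exact le_rfl

lemma exists_first_moment (hK : IsStochastic K) (hμ : HasUniqueStationaryDist K μ)
    (hp : ∀ i, p i ∈ Set.Ioo (0 : ℝ) 1) (hcrit : ∑ i, μ i * p i = 1 / 2) :
    ∃ C θ : ℝ, 0 ≤ C ∧ 0 ≤ θ ∧ θ < 1 ∧ ∀ (n t : ℕ) (i : Fin N),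
      |(stepOp K p)^[t] (fun _ a d => (a : ℝ) + d - n) i 0 n - rvec K μ p i|
        ≤ C * θ ^ n + 2 * C * (stepOp K p)^[t] (fun _ _ d => if d = 0 then 0 else 1) i 0 n := by
  obtain ⟨hr, hr0⟩ := rvec_spec hK hμ hcrit
  obtain ⟨C, θ, s, hC, hθ0, hθ1, hs0, hs, hsC⟩ := exists_failure_decay hK hμ hp hcrit hr0
  generalize rvec K μ p = r at *
  refine ⟨C, θ, hC, hθ0, hθ1, fun n t i => ?_⟩
  have hX : (stepOp K p)^[t] (fun (i : Fin N) (a d : ℕ) => (a : ℝ) + d - n + r i)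
      = fun (i : Fin N) (a d : ℕ) => (a : ℝ) + d - n + r i := by
    refine iterate_stepOp_eq_self (fun i a d => ?_) t
    rw [stepOp_corrected (r := r) (fun _ X _ => X) n 0]
    have := stepMean_increment_affine hK hr i ((a : ℝ) + (d + 1 : ℕ) - n + r i) 1 (fun _ _ => 0)
    rw [stepMean_const hK, add_zero] at this
    simpa using this
  have hψ : (stepOp K p)^[t] (fun (i : Fin N) (_ d : ℕ) => s d i) = fun i _ d => s d i := by
    refine iterate_stepOp_eq_self (fun i a d => ?_) t
    rw [hs d i]
    simp [stepOp, stepMean]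
  have hsplit : (fun (_ : Fin N) (a d : ℕ) => (a : ℝ) + d - n)
      = (1 : ℝ) • (fun (i : Fin N) (a d : ℕ) => (a : ℝ) + d - n + r i)
        + (-1 : ℝ) • fun (i : Fin N) (_ _ : ℕ) => r i := by
    ext i a d
    simp
  rw [hsplit, iterate_stepOp_combo, hX]
  have h1 := abs_iterate_stepOp_sub_le hK hp t (ψ := fun i _ _ => r i) (ψ' := fun i _ d => s d i)
    (φ := fun _ _ d => if d = 0 then 0 else 1) (β := 2 * C) (c := 0) (fun i a d => by
      rcases eq_or_ne d 0 with rfl | hd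
      · simp [hs0]
      · have e1 := hsC 0 i
        have e2 := (hsC d i).trans (mul_le_of_le_one_right hC (pow_le_one₀ hθ0 hθ1.le))
        rw [hs0, pow_zero, mul_one] at e1
        simp only [hd, if_false]
        rw [abs_le] at *
        constructor <;> linarith) i 0 n
  rw [hψ] at h1
  have h2 := hsC n i
  simp only [Pi.add_apply, Pi.smul_apply, smul_eq_mul]
  push_cast
  rw [abs_le] at *
  constructor <;> linarith

lemma abs_le_add_pow_four_div {W s : ℝ} (hs : 0 < s) : |W| ≤ s + W ^ 4 / s ^ 3 := by
  have h4 : W ^ 4 = |W| ^ 4 := by rw [← abs_pow, abs_of_nonneg (by positivity)]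
  rw [h4]
  have hw := abs_nonneg W
  generalize |W| = w at *
  rcases le_or_gt w s with h | h
  · have : 0 ≤ w ^ 4 / s ^ 3 := by positivity
    linarith
  · have : w ≤ w ^ 4 / s ^ 3 := by
      rw [le_div_iff₀ (by positivity)]
      calc w * s ^ 3 ≤ w * w ^ 3 := by gcongr
        _ = w ^ 4 := by ring
    linarith

lemma exists_second_moment (hK : IsStochastic K) (hμ : HasUniqueStationaryDist K μ)
    (hp : ∀ i, p i ∈ Set.Ioo (0 : ℝ) 1) (hcrit : ∑ i, μ i * p i = 1 / 2) :
    ∃ C : ℝ, 0 ≤ C ∧ ∀ (n t : ℕ) (i : Fin N), 1 ≤ n →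
      |(stepOp K p)^[t] (fun _ a d => ((a : ℝ) + d - n) ^ 2 + nuVal K μ p * d) i 0 n
        - nuVal K μ p * n| ≤ C * √n := by
  obtain ⟨hr, hr0⟩ := rvec_spec hK hμ hcrit
  obtain ⟨C4, hC4, h4⟩ := exists_fourth_moment hK hp hr
  have hν := nuVal_pos hK hμ hp hcrit
  obtain ⟨h, hh⟩ := exists_poisson hK hμ (v := fun i => stepVar K μ p i - nuVal K μ p / 2) (by
    simp only [mul_sub, Finset.sum_sub_distrib, ← Finset.sum_mul]
    rw [hμ.1.1.2, nuVal_eq_stepVar hK hμ hcrit]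
    ring)
  have hvar : ∀ i, stepMean K p i (fun b j => (stepSign b + rvec K μ p j - rvec K μ p i) ^ 2)
      = stepVar K μ p i := fun i => rfl
  generalize rvec K μ p = r at *
  generalize nuVal K μ p = ν at *
  obtain ⟨B, hB0, hB⟩ := exists_abs_le r
  obtain ⟨D, hD0, hD⟩ := exists_abs_le h
  obtain ⟨A, hA⟩ : ∃ A, A = B ^ 2 + D + ν * B / 2 := ⟨_, rfl⟩
  have hA0 : 0 ≤ A := by rw [hA]; positivity
  refine ⟨2 * B * C4 + 2 * B + 2 * A, by positivity, fun n t i hn => ?_⟩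
  have hn1 : (1 : ℝ) ≤ n := by exact_mod_cast hn
  obtain ⟨s, hs⟩ : ∃ s, s = √(n : ℝ) := ⟨_, rfl⟩
  have hs1 : 1 ≤ s := by rw [hs]; exact Real.one_le_sqrt.2 hn1
  have hsn : s ^ 2 = n := by rw [hs]; exact Real.sq_sqrt (by linarith)
  rw [← hs]
  have hH : (stepOp K p)^[t]
      (fun (i : Fin N) (a d : ℕ) => ((a : ℝ) + d - n + r i) ^ 2 + h i + ν * (d + r i / 2))
      = fun (i : Fin N) (a d : ℕ) => ((a : ℝ) + d - n + r i) ^ 2 + h i + ν * (d + r i / 2) := by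
    refine iterate_stepOp_eq_self (fun i a d => ?_) t
    have := stepOp_corrected (K := K) (p := p) (r := r)
      (fun j X Y => X ^ 2 + h j + ν * Y) n 0 i a d
    simp only [add_zero] at this
    rw [this]
    generalize (a : ℝ) + (d + 1 : ℕ) - n + r i = X
    generalize ((d + 1 : ℕ) : ℝ) + r i / 2 = Y
    have hhj : stepMean K p i (fun _ j => h j) = h i - (stepVar K μ p i - ν / 2) := by
      rw [← hh i]
      simp only [stepMean]
      ring
    calc stepMean K p i (fun b j => (X + (stepSign b + r j - r i)) ^ 2 + h j
            + ν * (Y + ((stepSign b + r j - r i) / 2 - 1 / 2)))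
        = stepMean K p i (fun b j => (X ^ 2 + ν * Y - ν / 2)
            + ((2 * X + ν / 2) * (stepSign b + r j - r i)
              + ((stepSign b + r j - r i) ^ 2 + h j))) := by
          congr 1
          ext b j
          ring
      _ = X ^ 2 + h i + ν * Y := by
          rw [stepMean_increment_affine hK hr, stepMean_add, hvar, hhj]
          ring
  have h1 := abs_iterate_stepOp_sub_le hK hp t
    (ψ := fun _ a d => ((a : ℝ) + d - n) ^ 2 + ν * d)
    (ψ' := fun i a d => ((a : ℝ) + d - n + r i) ^ 2 + h i + ν * (d + r i / 2))
    (φ := fun _ a d => ((a : ℝ) + d - n) ^ 4) (β := 2 * B / s ^ 3) (c := 2 * B * s + A)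
    (fun i a d => by
      have e1 := abs_le_add_pow_four_div (W := (a : ℝ) + d - n) (s := s) (by linarith)
      generalize (a : ℝ) + d - n = W at *
      have e2 : W ^ 2 + ν * d - ((W + r i) ^ 2 + h i + ν * (d + r i / 2))
          = -(2 * (r i * W)) - (r i ^ 2 + h i + ν * r i / 2) := by ring
      have e3 : |r i * W| ≤ B * (s + W ^ 4 / s ^ 3) := by
        rw [abs_mul]
        exact mul_le_mul (hB i) e1 (abs_nonneg _) hB0
      have e4 := abs_le.1 (hB i)
      have e5 := abs_le.1 (hD i)
      have e6 : r i ^ 2 ≤ B ^ 2 := sq_le_sq' e4.1 e4.2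
      have e7 := sq_nonneg (r i)
      have e8 : ν * r i ≤ ν * B := by gcongr; exact e4.2
      have e9 : ν * -B ≤ ν * r i := by gcongr; exact e4.1
      have e10 : 2 * B / s ^ 3 * W ^ 4 = 2 * (B * (W ^ 4 / s ^ 3)) := by ring
      rw [e2, e10, hA]
      rw [abs_le] at e3 ⊢
      constructor <;> linarith) i 0 n
  rw [hH] at h1
  have h2 := h4 n t i hn
  have h3 : 2 * B / s ^ 3 * (stepOp K p)^[t] (fun _ a d => ((a : ℝ) + d - n) ^ 4) i 0 n
      ≤ 2 * B * C4 * s := by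
    calc _ ≤ 2 * B / s ^ 3 * (C4 * (n : ℝ) ^ 2) := by gcongr
      _ = 2 * B * C4 * s := by
        rw [← hsn]
        field_simp
  have hri := abs_le.1 (hB i)
  have hhi := abs_le.1 (hD i)
  have e6 : r i ^ 2 ≤ B ^ 2 := sq_le_sq' hri.1 hri.2
  have e7 := sq_nonneg (r i)
  have e8 : ν * r i ≤ ν * B := by gcongr; exact hri.2
  have e9 : ν * -B ≤ ν * r i := by gcongr; exact hri.1
  have e10 : A ≤ A * s := le_mul_of_one_le_right hA0 hs1
  simp only [Nat.cast_zero, zero_add, sub_self] at h1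
  rw [abs_le] at h1 ⊢
  constructor <;> linarith

lemma le_iterate_stepOp_all_failures (hK : IsStochastic K) (hp : ∀ i, p i ∈ Set.Ioo (0 : ℝ) 1)
    {c : ℝ} (hc0 : 0 ≤ c) (hc : ∀ i, c ≤ 1 - p i) (i : Fin N) (n : ℕ) :
    c ^ n ≤ (stepOp K p)^[n] (fun _ a d => if a = 0 ∧ d = 0 then 1 else 0) i 0 n := by
  induction n generalizing i with
  | zero => simp
  | succ n ih =>
    have hnonneg : ∀ t i a d, 0 ≤ (stepOp K p)^[t]
        (fun (_ : Fin N) a d => if a = 0 ∧ d = 0 then (1 : ℝ) else 0) i a d := by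
      intro t i a d
      have := iterate_stepOp_mono hK hp t (ψ := fun _ _ _ => 0)
        (φ := fun _ a d => if a = 0 ∧ d = 0 then 1 else 0)
        (fun i a d => by split_ifs <;> norm_num) i a d
      rwa [iterate_stepOp_const hK] at this
    rw [Function.iterate_succ_apply']
    generalize hφ : (stepOp K p)^[n]
        (fun (_ : Fin N) a d => if a = 0 ∧ d = 0 then (1 : ℝ) else 0) = φ at ih
    have hφ0 : ∀ i a d, 0 ≤ φ i a d := fun i a d => hφ ▸ hnonneg n i a d
    calc c ^ (n + 1) ≤ (1 - p i) * c ^ n := by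
          rw [pow_succ']
          exact mul_le_mul_of_nonneg_right (hc i) (pow_nonneg hc0 n)
      _ = stepMean K p i (fun b _ => if b then 0 else c ^ n) := by
          simp [stepMean, hK.mulVec_const]
      _ ≤ stepOp K p φ i 0 (n + 1) := by
          simp only [stepOp]
          refine stepMean_mono hK hp i fun b j => ?_
          cases b
          · simpa using ih j
          · simpa using hφ0 j _ _

lemma le_iterate_stepOp_all_successes (hK : IsStochastic K) (hp : ∀ i, p i ∈ Set.Ioo (0 : ℝ) 1)
    {c : ℝ} (hc0 : 0 ≤ c) (hc : ∀ i, c ≤ p i) (i : Fin N) (m k M : ℕ) (hM : M ≤ k + m) :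
    c ^ m ≤ (stepOp K p)^[m] (fun _ a _ => if M ≤ a then 1 else 0) i k 1 := by
  induction m generalizing i k with
  | zero => simp [show M ≤ k by simpa using hM]
  | succ m ih =>
    have hnonneg : ∀ i a d, 0 ≤ (stepOp K p)^[m]
        (fun (_ : Fin N) a _ => if M ≤ a then (1 : ℝ) else 0) i a d := by
      intro i a d
      have := iterate_stepOp_mono hK hp m (ψ := fun _ _ _ => 0)
        (φ := fun _ a _ => if M ≤ a then 1 else 0)
        (fun i a d => by split_ifs <;> norm_num) i a d
      rwa [iterate_stepOp_const hK] at this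
    rw [Function.iterate_succ_apply']
    have hk := fun j => ih j (k + 1) (by omega)
    generalize (stepOp K p)^[m]
        (fun (_ : Fin N) a _ => if M ≤ a then (1 : ℝ) else 0) = φ at *
    calc c ^ (m + 1) ≤ p i * c ^ m := by
          rw [pow_succ']
          exact mul_le_mul_of_nonneg_right (hc i) (pow_nonneg hc0 m)
      _ = stepMean K p i (fun b _ => if b then c ^ m else 0) := by
          simp [stepMean, hK.mulVec_const]
      _ ≤ stepOp K p φ i k 1 := by
          simp only [stepOp]
          refine stepMean_mono hK hp i fun b j => ?_
          cases b
          · simpa using hnonneg j _ _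
          · simpa using hk j

end StepOperatorMoments

section TossLaw

variable {N : ℕ} {K : Matrix (Fin N) (Fin N) ℝ} {μ p η : Fin N → ℝ}

/-- Mean of a function of the first `t` tosses of a cookie stack whose first cookie is `i`. -/
def tossMean (K : Matrix (Fin N) (Fin N) ℝ) (p : Fin N → ℝ) :
    ℕ → (List Bool → ℝ) → Fin N → ℝ
  | 0, φ, _ => φ []
  | t + 1, φ, i => stepMean K p i (fun b j => tossMean K p t (fun l => φ (b :: l)) j)

/-- The numbers of successes and of failures still to come after the tosses `l`, when stopped once
no failure is left to come. -/
def tossRun : ℕ → ℕ → List Bool → ℕ × ℕ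
  | a, 0, _ => (a, 0)
  | a, d + 1, [] => (a, d + 1)
  | a, d + 1, true :: l => tossRun (a + 1) (d + 1) l
  | a, d + 1, false :: l => tossRun a d l

lemma tossMean_tossRun (hK : IsStochastic K) (ψ : ℕ → ℕ → ℝ) (t : ℕ) (i : Fin N) (a d : ℕ) :
    tossMean K p t (fun l => ψ (tossRun a d l).1 (tossRun a d l).2) i
      = (stepOp K p)^[t] (fun _ => ψ) i a d := by
  induction t generalizing i a d with
  | zero => cases d <;> rfl
  | succ t ih =>
    rw [Function.iterate_succ_apply']
    cases d with
    | zero =>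
      have h : ∀ a, ∀ l, tossRun a 0 l = (a, 0) := fun a l => by cases l <;> rfl
      simp only [stepOp, ← ih, tossMean, h]
      have : ∀ (t : ℕ) (i : Fin N) (c : ℝ), tossMean K p t (fun _ => c) i = c := by
        intro t
        induction t with
        | zero => intro _ _; rfl
        | succ t ih =>
          intro i c
          simp only [tossMean, ih]
          exact stepMean_const hK i c
      simp only [this]
      exact stepMean_const hK i _
    | succ d =>
      simp only [stepOp, tossMean]
      congr 1
      ext b j
      cases b
      · simpa [tossRun] using ih j a d
      · simpa [tossRun] using ih j (a + 1) (d + 1)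

/-- Probability of the toss outcome `b` with the cookie `i`. -/
def tossProb (p : Fin N → ℝ) (b : Bool) (i : Fin N) : ℝ := if b then p i else 1 - p i

lemma stepMean_eq_sum (i : Fin N) (f : Bool → Fin N → ℝ) :
    stepMean K p i f = ∑ b, tossProb p b i * ∑ j, K i j * f b j := by
  simp [stepMean, tossProb, Matrix.mulVec, dotProduct]

lemma sum_fin_succ_fun {α M : Type*} [Fintype α] [AddCommMonoid M] (m : ℕ)
    (F : (Fin (m + 1) → α) → M) :
    ∑ f, F f = ∑ a, ∑ g : Fin m → α, F (Fin.cons a g) := by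
  rw [← (Fin.consEquiv fun _ : Fin (m + 1) => α).sum_comp F, Fintype.sum_prod_type]
  rfl

lemma tossMean_succ_eq_sum (hK : IsStochastic K) (m : ℕ) (φ : List Bool → ℝ) (i : Fin N) :
    tossMean K p (m + 1) φ i = ∑ g : Fin m → Fin N, ∑ b : Fin (m + 1) → Bool,
      (∏ j : Fin m, K ((Fin.cons i g : Fin (m + 1) → Fin N) j.castSucc) (g j)) *
        (∏ j : Fin (m + 1), tossProb p (b j) ((Fin.cons i g : Fin (m + 1) → Fin N) j)) *
        φ (List.ofFn b) := by
  induction m generalizing i φ with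
  | zero =>
    rw [tossMean, stepMean_eq_sum]
    simp only [tossMean, ← Finset.sum_mul, hK.2, one_mul]
    rw [Fintype.sum_unique (ι := Fin 0 → Fin N), sum_fin_succ_fun]
    refine Finset.sum_congr rfl fun b _ => ?_
    rw [Fintype.sum_unique]
    simp
  | succ m ih =>
    rw [tossMean, stepMean_eq_sum, sum_fin_succ_fun]
    simp only [ih]
    calc ∑ b, tossProb p b i * ∑ j, K i j * ∑ g : Fin m → Fin N, ∑ b' : Fin (m + 1) → Bool,
          (∏ k : Fin m, K ((Fin.cons j g : Fin (m + 1) → Fin N) k.castSucc) (g k)) *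
          (∏ k : Fin (m + 1), tossProb p (b' k) ((Fin.cons j g : Fin (m + 1) → Fin N) k)) *
          φ (b :: List.ofFn b')
        = ∑ j, ∑ g : Fin m → Fin N, ∑ b, ∑ b' : Fin (m + 1) → Bool,
          tossProb p b i * (K i j * ((∏ k : Fin m,
          K ((Fin.cons j g : Fin (m + 1) → Fin N) k.castSucc) (g k)) *
          (∏ k : Fin (m + 1), tossProb p (b' k) ((Fin.cons j g : Fin (m + 1) → Fin N) k)) *
          φ (b :: List.ofFn b'))) := by
          simp only [Finset.mul_sum]
          rw [Finset.sum_comm]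
          refine Finset.sum_congr rfl fun j _ => ?_
          rw [Finset.sum_comm]
      _ = _ := by
          refine Finset.sum_congr rfl fun j _ => Finset.sum_congr rfl fun g _ => ?_
          rw [sum_fin_succ_fun]
          refine Finset.sum_congr rfl fun b _ => Finset.sum_congr rfl fun b' _ => ?_
          have h1 : ∏ k : Fin (m + 1), K ((Fin.cons i (Fin.cons j g) : Fin (m + 2) → Fin N)
              k.castSucc) ((Fin.cons j g : Fin (m + 1) → Fin N) k)
              = K i j * ∏ k : Fin m, K ((Fin.cons j g : Fin (m + 1) → Fin N) k.castSucc) (g k) := by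
            rw [Fin.prod_univ_succ]
            simp only [← Fin.succ_castSucc, Fin.cons_succ]
            rfl
          have h2 : ∏ k : Fin (m + 2), tossProb p ((Fin.cons b b' : Fin (m + 2) → Bool) k)
              ((Fin.cons i (Fin.cons j g) : Fin (m + 2) → Fin N) k) = tossProb p b i *
              ∏ k : Fin (m + 1), tossProb p (b' k) ((Fin.cons j g : Fin (m + 1) → Fin N) k) := by
            rw [Fin.prod_univ_succ]
            simp only [Fin.cons_succ, Fin.cons_zero]
          have h3 : List.ofFn (Fin.cons b b' : Fin (m + 2) → Bool) = b :: List.ofFn b' := by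
            rw [List.ofFn_succ]
            simp only [Fin.cons_succ, Fin.cons_zero]
          rw [h1, h2, h3]
          ring

/-- The law of the tosses of one cookie stack. -/
def IsTossLaw {Ω : Type*} [MeasurableSpace Ω] (P : Measure Ω) (K : Matrix (Fin N) (Fin N) ℝ)
    (p η : Fin N → ℝ) (s : ℕ → Ω → Bool) : Prop :=
  ∀ (m : ℕ) (φ : List Bool → ℝ), ∫ ω, φ (List.ofFn fun j : Fin m => s j ω) ∂P
    = ∑ i, η i * tossMean K p m φ i

lemma IsCookieEnv.isTossLaw {Ω : Type*} [MeasurableSpace Ω] {P : Measure Ω}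
    [IsProbabilityMeasure P] {Rc : ℤ → ℕ → Ω → Fin N} {ξ : ℤ → ℕ → Ω → Bool}
    (hK : IsStochastic K) (hη : IsProbVec η) (henv : IsCookieEnv P K p η Rc ξ) (x : ℤ) :
    IsTossLaw P K p η (ξ x) := by
  intro m φ
  obtain ⟨hR, hξ, hcyl⟩ := henv
  cases m with
  | zero => simp [tossMean, ← Finset.sum_mul, hη.2]
  | succ m =>
    let Z : Ω → (Fin (m + 1) → Fin N) × (Fin (m + 1) → Bool) :=
      fun ω => (fun j => Rc x j ω, fun j => ξ x j ω)
    have hZ : Measurable Z := by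
      refine Measurable.prodMk ?_ ?_
      · exact measurable_pi_lambda _ fun j => hR x j
      · exact measurable_pi_lambda _ fun j => hξ x j
    have hprob : ∀ f b, (P.map Z).real {(f, b)} = η (f 0) *
        (∏ j : Fin m, K (f j.castSucc) (f j.succ)) *
        ∏ j : Fin (m + 1), tossProb p (b j) (f j) := by
      intro f b
      have h := hcyl {x} m (fun _ j => f (Fin.ofNat (m + 1) j)) (fun _ j => b (Fin.ofNat (m + 1) j))
      rw [Finset.prod_singleton] at h
      have hset : Z ⁻¹' {(f, b)} = {ω | ∀ y ∈ ({x} : Finset ℤ), ∀ j ≤ m,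
          Rc y j ω = f (Fin.ofNat (m + 1) j) ∧ ξ y j ω = b (Fin.ofNat (m + 1) j)} := by
        ext ω
        simp only [Set.mem_preimage, Set.mem_singleton_iff, Finset.mem_singleton, forall_eq,
          Set.mem_ofPred_eq, Z, Prod.mk.injEq, funext_iff]
        constructor
        · rintro ⟨h1, h2⟩ j hj
          have hj' : (Fin.ofNat (m + 1) j : ℕ) = j := Nat.mod_eq_of_lt (by omega)
          have := h1 (Fin.ofNat (m + 1) j)
          have h2 := h2 (Fin.ofNat (m + 1) j)
          rw [hj'] at this h2
          exact ⟨this, h2⟩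
        · intro h
          have h' : ∀ j : Fin (m + 1), Rc x j ω = f j ∧ ξ x j ω = b j := fun j => by
            have := h j (by omega)
            rwa [show Fin.ofNat (m + 1) (j : ℕ) = j from Fin.ext (Nat.mod_eq_of_lt j.2)] at this
          exact ⟨fun j => (h' j).1, fun j => (h' j).2⟩
      rw [measureReal_def, Measure.map_apply hZ (measurableSet_singleton _), hset, h,
        Finset.prod_range, Finset.prod_range]
      have e1 : ∀ j : Fin (m + 1), Fin.ofNat (m + 1) (j : ℕ) = j :=
        fun j => Fin.ext (Nat.mod_eq_of_lt j.2)
      have e2 : ∀ j : Fin m, Fin.ofNat (m + 1) (j : ℕ) = j.castSucc :=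
        fun j => Fin.ext (Nat.mod_eq_of_lt (by omega))
      have e3 : ∀ j : Fin m, Fin.ofNat (m + 1) ((j : ℕ) + 1) = j.succ :=
        fun j => Fin.ext (Nat.mod_eq_of_lt (by omega))
      simp only [e1, e2, e3, tossProb]
      rfl
    have hint : ∫ ω, φ (List.ofFn fun j : Fin (m + 1) => ξ x j ω) ∂P
        = ∫ z, φ (List.ofFn z.2) ∂(P.map Z) := by
      rw [integral_map hZ.aemeasurable (measurable_of_finite _).aestronglyMeasurable]
    have : IsProbabilityMeasure (P.map Z) := Measure.isProbabilityMeasure_map hZ.aemeasurable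
    rw [hint, integral_fintype .of_finite, Fintype.sum_prod_type, sum_fin_succ_fun]
    refine Finset.sum_congr rfl fun i _ => ?_
    rw [tossMean_succ_eq_sum hK, Finset.mul_sum]
    refine Finset.sum_congr rfl fun g _ => ?_
    rw [Finset.mul_sum]
    refine Finset.sum_congr rfl fun b _ => ?_
    rw [hprob]
    simp only [Fin.cons_zero, Fin.cons_succ, smul_eq_mul]
    ring

end TossLaw

section SuccessesBeforeFailure

/-- The number of failures among the first `t` tosses of `s`. -/
def failCount (s : ℕ → Bool) (t : ℕ) : ℕ := Nat.count (fun j => s j = false) t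

/-- The number of successes of `s` before its `n`-th failure. -/
def succBefore (s : ℕ → Bool) (n : ℕ) : ℕ := sInf {k | n ≤ failCount s (n + k)}

/-- `s` has infinitely many failures. -/
def InfFail (s : ℕ → Bool) : Prop := ∀ n, ∃ t, n ≤ failCount s t

variable {s : ℕ → Bool}

lemma failCount_zero : failCount s 0 = 0 := Nat.count_zero _

lemma failCount_le (t : ℕ) : failCount s t ≤ t := Nat.count_le _

lemma failCount_mono : Monotone (failCount s) := Nat.count_monotone _

lemma failCount_succ (t : ℕ) :
    failCount s (t + 1) = failCount s t + if s t = false then 1 else 0 := Nat.count_succ _ _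

lemma failCount_succ_shift (t : ℕ) :
    failCount s (t + 1) = failCount (fun j => s (j + 1)) t + if s 0 = false then 1 else 0 :=
  Nat.count_succ' _ _

lemma InfFail.shift (h : InfFail s) : InfFail fun j => s (j + 1) := by
  intro n
  obtain ⟨t, ht⟩ := h (n + 1)
  cases t with
  | zero => simp [failCount_zero] at ht
  | succ t =>
    rw [failCount_succ_shift] at ht
    refine ⟨t, ?_⟩
    split_ifs at ht <;> omega

lemma InfFail.nonempty (h : InfFail s) (n : ℕ) : {k | n ≤ failCount s (n + k)}.Nonempty := by
  obtain ⟨t, ht⟩ := h n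
  exact ⟨t, ht.trans (failCount_mono (by omega))⟩

lemma succBefore_zero : succBefore s 0 = 0 :=
  Nat.sInf_eq_zero.2 (Or.inl (Nat.zero_le _))

lemma succBefore_of_true (h : InfFail s) (h0 : s 0 = true) (d : ℕ) :
    succBefore s (d + 1) = succBefore (fun j => s (j + 1)) (d + 1) + 1 := by
  have hset : ∀ k, (d + 1 ≤ failCount s (d + 1 + (k + 1)) ↔
      d + 1 ≤ failCount (fun j => s (j + 1)) (d + 1 + k)) := fun k => by
    rw [show d + 1 + (k + 1) = d + 1 + k + 1 by ring, failCount_succ_shift]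
    simp [h0]
  have h1 : 1 ≤ succBefore s (d + 1) := by
    rw [Nat.one_le_iff_ne_zero]
    intro h2
    have h3 := Nat.sInf_mem (h.nonempty (d + 1))
    change d + 1 ≤ failCount s (d + 1 + succBefore s (d + 1)) at h3
    rw [h2, add_zero, failCount_succ_shift, h0] at h3
    have := failCount_le (s := fun j => s (j + 1)) d
    simp at h3
    omega
  apply le_antisymm
  · refine Nat.sInf_le ?_
    exact (hset _).2 (Nat.sInf_mem (h.shift.nonempty (d + 1)))
  · obtain ⟨k, hk⟩ : ∃ k, succBefore s (d + 1) = k + 1 := ⟨succBefore s (d + 1) - 1, by omega⟩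
    have h3 := Nat.sInf_mem (h.nonempty (d + 1))
    change d + 1 ≤ failCount s (d + 1 + succBefore s (d + 1)) at h3
    rw [hk] at h3 ⊢
    exact Nat.succ_le_succ (Nat.sInf_le ((hset k).1 h3))

lemma succBefore_of_false (h0 : s 0 = false) (d : ℕ) :
    succBefore s (d + 1) = succBefore (fun j => s (j + 1)) d := by
  have hset : ∀ k, (d + 1 ≤ failCount s (d + 1 + k) ↔
      d ≤ failCount (fun j => s (j + 1)) (d + k)) := fun k => by
    rw [show d + 1 + k = d + k + 1 by ring, failCount_succ_shift]
    simp [h0]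
  simp only [succBefore, hset]

lemma tossRun_zero (a : ℕ) (l : List Bool) : tossRun a 0 l = (a, 0) := by cases l <;> rfl

lemma tossRun_spec (h : InfFail s) (t a d : ℕ) :
    (tossRun a d (List.ofFn fun j : Fin t => s j)).1 ≤ a + succBefore s d ∧
    (tossRun a d (List.ofFn fun j : Fin t => s j)).2 ≤ d ∧
    ((tossRun a d (List.ofFn fun j : Fin t => s j)).2 = 0 ↔ d ≤ failCount s t) ∧
    ((tossRun a d (List.ofFn fun j : Fin t => s j)).2 = 0 →
      (tossRun a d (List.ofFn fun j : Fin t => s j)).1 = a + succBefore s d) := by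
  induction t generalizing s a d with
  | zero =>
    cases d with
    | zero => simp [tossRun, succBefore_zero]
    | succ d => simp [tossRun, failCount_zero]
  | succ t ih =>
    cases d with
    | zero => simp [tossRun_zero, succBefore_zero]
    | succ d =>
      have hl : (List.ofFn fun j : Fin (t + 1) => s j)
          = s 0 :: List.ofFn fun j : Fin t => s (j + 1) := by
        rw [List.ofFn_succ]
        simp
      rw [hl, failCount_succ_shift]
      cases h0 : s 0 with
      | false =>
        have := ih h.shift a d
        rw [succBefore_of_false h0]
        simp only [tossRun, if_true, add_le_add_iff_right]
        exact ⟨this.1, this.2.1.trans (Nat.le_succ d), this.2.2.1, this.2.2.2⟩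
      | true =>
        have := ih h.shift (a + 1) (d + 1)
        rw [succBefore_of_true h h0]
        simp only [tossRun, Bool.true_eq_false, if_false, add_zero]
        refine ⟨this.1.trans_eq (by ring), this.2.1, this.2.2.1, fun h2 => ?_⟩
        rw [this.2.2.2 h2]
        ring

lemma measurable_failCount (t : ℕ) : Measurable fun s : ℕ → Bool => failCount s t := by
  induction t with
  | zero => simp only [failCount_zero]; exact measurable_const
  | succ t ih =>
    simp only [failCount_succ]
    refine ih.add (Measurable.ite ?_ measurable_const measurable_const)
    exact measurableSet_eq_fun (measurable_pi_apply t) measurable_const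

lemma measurableSet_le_failCount (n t : ℕ) : MeasurableSet {s : ℕ → Bool | n ≤ failCount s t} :=
  measurable_failCount t measurableSet_Ici

lemma measurable_succBefore (n : ℕ) : Measurable fun s : ℕ → Bool => succBefore s n := by
  refine measurable_of_Iic fun k => ?_
  have : (fun s : ℕ → Bool => succBefore s n) ⁻¹' Set.Iic k
      = (⋃ i ∈ Set.Iic k, {s | n ≤ failCount s (n + i)}) ∪ ⋂ i, {s | n ≤ failCount s (n + i)}ᶜ := by
    ext s
    simp only [Set.mem_preimage, Set.mem_Iic, Set.mem_union, Set.mem_iUnion, Set.mem_iInter,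
      Set.mem_compl_iff, exists_prop]
    constructor
    · intro h
      by_cases hne : {k | n ≤ failCount s (n + k)}.Nonempty
      · exact Or.inl ⟨_, h, Nat.sInf_mem hne⟩
      · exact Or.inr fun i hi => hne ⟨i, hi⟩
    · rintro (⟨i, hi, h⟩ | h)
      · exact le_trans (Nat.sInf_le (s := {k | n ≤ failCount s (n + k)}) h) hi
      · have : {k | n ≤ failCount s (n + k)} = ∅ := Set.eq_empty_of_forall_notMem h
        change sInf {k | n ≤ failCount s (n + k)} ≤ k
        rw [this, Nat.sInf_empty]
        exact Nat.zero_le _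
  rw [this]
  exact (MeasurableSet.biUnion (Set.to_countable _)
    fun i _ => measurableSet_le_failCount _ _).union
    (MeasurableSet.iInter fun i => (measurableSet_le_failCount _ _).compl)

end SuccessesBeforeFailure

section SiteMoments

variable {N : ℕ} {K : Matrix (Fin N) (Fin N) ℝ} {μ p η : Fin N → ℝ}

lemma tossRun_snd_eq_zero_iff {s : ℕ → Bool} (t a d : ℕ) :
    (tossRun a d (List.ofFn fun j : Fin t => s j)).2 = 0 ↔ d ≤ failCount s t := by
  induction t generalizing s a d with
  | zero => cases d <;> simp [tossRun, failCount_zero]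
  | succ t ih =>
    cases d with
    | zero => simp [tossRun_zero]
    | succ d =>
      have hl : (List.ofFn fun j : Fin (t + 1) => s j)
          = s 0 :: List.ofFn fun j : Fin t => s (j + 1) := by
        rw [List.ofFn_succ]
        simp
      rw [hl, failCount_succ_shift]
      cases h0 : s 0 with
      | false => simpa [tossRun] using ih (s := fun j => s (j + 1)) a d
      | true => simpa [tossRun] using ih (s := fun j => s (j + 1)) (a + 1) (d + 1)

lemma tossRun_eventually_eq {s : ℕ → Bool} (h : InfFail s) (n : ℕ) :
    ∀ᶠ t in atTop, tossRun 0 n (List.ofFn fun j : Fin t => s j) = (succBefore s n, 0) := by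
  obtain ⟨T, hT⟩ := h n
  filter_upwards [eventually_ge_atTop T] with t ht
  have h0 := (tossRun_snd_eq_zero_iff (s := s) t 0 n).2 (hT.trans (failCount_mono ht))
  refine Prod.ext ?_ h0
  simpa using (tossRun_spec h t 0 n).2.2.2 h0

lemma measurable_prefix (t : ℕ) :
    Measurable fun (s : ℕ → Bool) (j : Fin t) => s j :=
  measurable_pi_lambda _ fun j => measurable_pi_apply (j : ℕ)

lemma measurable_comp_prefix {α : Type*} [MeasurableSpace α] (t : ℕ) (φ : List Bool → α) :
    Measurable fun s : ℕ → Bool => φ (List.ofFn fun j : Fin t => s j) :=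
  (measurable_of_finite fun l : Fin t → Bool => φ (List.ofFn l)).comp (measurable_prefix t)

lemma integrable_comp_prefix (Q : Measure (ℕ → Bool)) [IsFiniteMeasure Q] (t : ℕ)
    (φ : List Bool → ℝ) : Integrable (fun s => φ (List.ofFn fun j : Fin t => s j)) Q :=
  (Integrable.of_finite (μ := Q.map fun (s : ℕ → Bool) (j : Fin t) => s j)
    (f := fun l : Fin t → Bool => φ (List.ofFn l))).comp_measurable (measurable_prefix t)

variable {Q : Measure (ℕ → Bool)}

lemma IsTossLaw.integral_tossRun (hK : IsStochastic K)
    (hQ : IsTossLaw Q K p η fun j s => s j) (ψ : ℕ → ℕ → ℝ) (t a d : ℕ) :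
    ∫ s, ψ (tossRun a d (List.ofFn fun j : Fin t => s j)).1
      (tossRun a d (List.ofFn fun j : Fin t => s j)).2 ∂Q
      = ∑ i, η i * (stepOp K p)^[t] (fun _ => ψ) i a d := by
  rw [hQ t fun l => ψ (tossRun a d l).1 (tossRun a d l).2]
  simp only [tossMean_tossRun hK]

lemma IsProbVec.sum_mul_le (hη : IsProbVec η) {x : Fin N → ℝ} {c : ℝ} (h : ∀ i, x i ≤ c) :
    ∑ i, η i * x i ≤ c := by
  calc ∑ i, η i * x i ≤ ∑ i, η i * c := Finset.sum_le_sum fun i _ =>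
        mul_le_mul_of_nonneg_left (h i) (hη.1 i)
    _ = c := by rw [← Finset.sum_mul, hη.2, one_mul]

lemma IsProbVec.le_sum_mul (hη : IsProbVec η) {x : Fin N → ℝ} {c : ℝ} (h : ∀ i, c ≤ x i) :
    c ≤ ∑ i, η i * x i := by
  have := hη.sum_mul_le (x := fun i => -x i) (c := -c) fun i => neg_le_neg (h i)
  simp only [mul_neg, Finset.sum_neg_distrib] at this
  linarith

lemma IsProbVec.abs_sum_mul_sub_le (hη : IsProbVec η) {x : Fin N → ℝ} {y : Fin N → ℝ} {c : ℝ}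
    (h : ∀ i, |x i - y i| ≤ c) : |∑ i, η i * x i - ∑ i, η i * y i| ≤ c := by
  rw [← Finset.sum_sub_distrib]
  simp only [← mul_sub]
  exact abs_le.2 ⟨hη.le_sum_mul fun i => (abs_le.1 (h i)).1,
    hη.sum_mul_le fun i => (abs_le.1 (h i)).2⟩

variable [IsProbabilityMeasure Q]

lemma IsTossLaw.ae_infFail (hK : IsStochastic K) (hp : ∀ i, p i ∈ Set.Ioo (0 : ℝ) 1)
    (hη : IsProbVec η) (hQ : IsTossLaw Q K p η fun j s => s j) : ∀ᵐ s ∂Q, InfFail s := by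
  obtain ⟨lam, hlam0, hlam1, hlam⟩ := exists_survival_decay hK hp
  refine ae_all_iff.2 fun n => ?_
  have hle : ∀ t : ℕ, Q.real {s | ¬ ∃ t, n ≤ failCount s t} ≤ lam ^ t * 2 ^ n := by
    intro t
    have hm : MeasurableSet {s : ℕ → Bool | n ≤ failCount s t}ᶜ :=
      (measurableSet_le_failCount n t).compl
    calc Q.real {s | ¬ ∃ t, n ≤ failCount s t} ≤ Q.real {s : ℕ → Bool | n ≤ failCount s t}ᶜ :=
          measureReal_mono fun s hs h => hs ⟨t, h⟩
      _ = ∫ s, {s : ℕ → Bool | n ≤ failCount s t}ᶜ.indicator 1 s ∂Q := by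
          rw [integral_indicator_one hm]
      _ = ∫ s, (fun _ d => if d = 0 then (0 : ℝ) else 1)
            (tossRun 0 n (List.ofFn fun j : Fin t => s j)).1
            (tossRun 0 n (List.ofFn fun j : Fin t => s j)).2 ∂Q := by
          congr 1
          ext s
          simp only [tossRun_snd_eq_zero_iff, Set.indicator, Set.mem_compl_iff, Set.mem_ofPred_eq,
            Pi.one_apply, ite_not]
      _ = ∑ i, η i * (stepOp K p)^[t] (fun _ _ d => if d = 0 then 0 else 1) i 0 n :=
          hQ.integral_tossRun hK (fun _ d => if d = 0 then 0 else 1) t 0 n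
      _ ≤ lam ^ t * 2 ^ n := hη.sum_mul_le fun i => hlam t i 0 n
  have hlim : Tendsto (fun t : ℕ => lam ^ t * (2 : ℝ) ^ n) atTop (nhds 0) := by
    simpa using (tendsto_pow_atTop_nhds_zero_of_lt_one hlam0 hlam1).mul_const ((2 : ℝ) ^ n)
  have h0 := ge_of_tendsto' hlim hle
  rw [ae_iff]
  exact (measureReal_eq_zero_iff).1 (le_antisymm h0 measureReal_nonneg)

/-- Moment bounds for the number of successes before the `n`-th failure. -/
structure SiteBounds (Q : Measure (ℕ → Bool)) (ρ ν C c : ℝ) : Prop where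
  infFail : ∀ᵐ s ∂Q, InfFail s
  integrable : ∀ n : ℕ, Integrable (fun s => ((succBefore s n : ℝ) - n) ^ 4) Q
  fourth : ∀ n : ℕ, 1 ≤ n → ∫ s, ((succBefore s n : ℝ) - n) ^ 4 ∂Q ≤ C * (n : ℝ) ^ 2
  first : ∀ n : ℕ, 1 ≤ n → |∫ s, ((succBefore s n : ℝ) - n) ∂Q - ρ| ≤ C / √n
  second : ∀ n : ℕ, 1 ≤ n → |∫ s, ((succBefore s n : ℝ) - n) ^ 2 ∂Q - ν * n| ≤ C * √n
  zero : ∀ n : ℕ, c ^ n ≤ Q.real {s | succBefore s n = 0}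
  large : ∀ M : ℕ, c ^ M ≤ Q.real {s | M ≤ succBefore s 1}

lemma IsTossLaw.integrable_and_fourth (hK : IsStochastic K)
    (hη : IsProbVec η) (hQ : IsTossLaw Q K p η fun j s => s j) (hinf : ∀ᵐ s ∂Q, InfFail s)
    {n : ℕ} {D : ℝ} (hD0 : 0 ≤ D)
    (hD : ∀ t i, (stepOp K p)^[t] (fun _ a d => ((a : ℝ) + d - n) ^ 4) i 0 n ≤ D) :
    Integrable (fun s => ((succBefore s n : ℝ) - n) ^ 4) Q ∧
      ∫ s, ((succBefore s n : ℝ) - n) ^ 4 ∂Q ≤ D := by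
  obtain ⟨w, hw⟩ : ∃ w : ℕ → (ℕ → Bool) → ℝ, w = fun t s =>
    (((tossRun 0 n (List.ofFn fun j : Fin t => s j)).1 : ℝ)
      + (tossRun 0 n (List.ofFn fun j : Fin t => s j)).2 - n) ^ 4 := ⟨_, rfl⟩
  have hw0 : ∀ t s, 0 ≤ w t s := fun t s => by rw [hw]; positivity
  have hwint : ∀ t, Integrable (w t) Q := fun t => by
    rw [hw]
    exact integrable_comp_prefix Q t
      fun l => (((tossRun 0 n l).1 : ℝ) + (tossRun 0 n l).2 - n) ^ 4
  have hwm : ∀ t, Measurable (w t) := fun t => by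
    rw [hw]
    exact measurable_comp_prefix t
      fun l => (((tossRun 0 n l).1 : ℝ) + (tossRun 0 n l).2 - n) ^ 4
  have hwD : ∀ t, ∫⁻ s, ENNReal.ofReal (w t s) ∂Q ≤ ENNReal.ofReal D := by
    intro t
    rw [← ofReal_integral_eq_lintegral_ofReal (hwint t) (ae_of_all _ (hw0 t))]
    refine ENNReal.ofReal_le_ofReal ?_
    rw [hw]
    refine (hQ.integral_tossRun hK (fun a d => ((a : ℝ) + d - n) ^ 4) t 0 n).trans_le ?_
    exact hη.sum_mul_le fun i => hD t i
  have hlim : ∀ᵐ s ∂Q, ENNReal.ofReal (((succBefore s n : ℝ) - n) ^ 4)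
      = liminf (fun t => ENNReal.ofReal (w t s)) atTop := by
    filter_upwards [hinf] with s hs
    refine (Tendsto.liminf_eq ?_).symm
    refine tendsto_const_nhds.congr' ?_
    filter_upwards [tossRun_eventually_eq hs n] with t ht
    rw [hw]
    simp [ht]
  have hfatou : ∫⁻ s, ENNReal.ofReal (((succBefore s n : ℝ) - n) ^ 4) ∂Q ≤ ENNReal.ofReal D := by
    rw [lintegral_congr_ae hlim]
    refine (lintegral_liminf_le fun t => (hwm t).ennreal_ofReal).trans ?_
    exact (liminf_le_liminf (Eventually.of_forall hwD)).trans_eq (liminf_const _)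
  have hnn : ∀ s, 0 ≤ ((succBefore s n : ℝ) - n) ^ 4 := fun s => by positivity
  have hm : AEStronglyMeasurable (fun s => ((succBefore s n : ℝ) - n) ^ 4) Q := by
    have : Measurable fun s => (succBefore s n : ℝ) :=
      measurable_from_top.comp (measurable_succBefore n)
    exact ((this.sub_const _).pow_const 4).aestronglyMeasurable
  refine ⟨⟨hm, (hasFiniteIntegral_iff_ofReal (ae_of_all _ hnn)).2
    (hfatou.trans_lt ENNReal.ofReal_lt_top)⟩, ?_⟩
  rw [integral_eq_lintegral_of_nonneg_ae (ae_of_all _ hnn) hm]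
  exact ENNReal.toReal_le_of_le_ofReal hD0 hfatou

lemma IsTossLaw.tendsto_iterate_stepOp (hK : IsStochastic K)
    (hQ : IsTossLaw Q K p η fun j s => s j) (hinf : ∀ᵐ s ∂Q, InfFail s) {n : ℕ}
    (hint : Integrable (fun s => ((succBefore s n : ℝ) - n) ^ 4) Q) (G : ℕ → ℕ → ℝ) {A : ℝ}
    (hG : ∀ a d, d ≤ n → |G a d| ≤ A * (1 + (a : ℝ) ^ 4)) :
    Tendsto (fun t => ∑ i, η i * (stepOp K p)^[t] (fun _ => G) i 0 n) atTop
      (nhds (∫ s, G (succBefore s n) 0 ∂Q)) := by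
  simp only [← hQ.integral_tossRun hK]
  have hA : 0 ≤ A := by
    have := (abs_nonneg _).trans (hG 0 0 (Nat.zero_le _))
    simpa using this
  have hF4 : Integrable (fun s => (succBefore s n : ℝ) ^ 4) Q := by
    refine ((hint.const_mul 8).add (integrable_const (8 * (n : ℝ) ^ 4))).mono' ?_
      (ae_of_all _ fun s => ?_)
    · exact ((measurable_from_top.comp (measurable_succBefore n)).pow_const 4).aestronglyMeasurable
    · have h := pow_four_sub_le (X := (succBefore s n : ℝ) - n) (s := -n) (B := n) (by simp)
      rw [sub_neg_eq_add, sub_add_cancel] at h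
      rw [Real.norm_eq_abs, abs_of_nonneg (by positivity)]
      exact h
  refine tendsto_integral_of_dominated_convergence
    (fun s => A * (1 + (succBefore s n : ℝ) ^ 4)) (fun t => ?_)
    (((integrable_const 1).add hF4).const_mul A) (fun t => ?_) ?_
  · exact (measurable_comp_prefix t
      fun l => G (tossRun 0 n l).1 (tossRun 0 n l).2).aestronglyMeasurable
  · filter_upwards [hinf] with s hs
    have h := tossRun_spec hs t 0 n
    rw [zero_add] at h
    refine (hG _ _ h.2.1).trans (mul_le_mul_of_nonneg_left ?_ hA)
    have : ((tossRun 0 n (List.ofFn fun j : Fin t => s j)).1 : ℝ) ≤ succBefore s n := by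
      exact_mod_cast h.1
    gcongr
  · filter_upwards [hinf] with s hs
    refine tendsto_const_nhds.congr' ?_
    filter_upwards [tossRun_eventually_eq hs n] with t ht
    rw [ht]

lemma exists_geometric_le_inv_sqrt {θ : ℝ} (h0 : 0 ≤ θ) (h1 : θ < 1) :
    ∃ D : ℝ, 0 ≤ D ∧ ∀ n : ℕ, 1 ≤ n → θ ^ n ≤ D / √n := by
  obtain ⟨D, hD⟩ := (tendsto_self_mul_const_pow_of_lt_one h0 h1).bddAbove_range
  have hD' : ∀ n : ℕ, n * θ ^ n ≤ D := fun n => hD ⟨n, rfl⟩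
  refine ⟨D, by simpa using hD' 0, fun n hn => ?_⟩
  have hn1 : (1 : ℝ) ≤ n := by exact_mod_cast hn
  rw [le_div_iff₀ (Real.sqrt_pos.2 (by linarith))]
  calc θ ^ n * √n ≤ θ ^ n * n := by
        gcongr
        exact Real.sqrt_le_iff.2 ⟨by linarith, by nlinarith⟩
    _ ≤ D := by rw [mul_comm]; exact hD' n

lemma IsTossLaw.exists_siteBounds (hK : IsStochastic K) (hμ : HasUniqueStationaryDist K μ)
    (hp : ∀ i, p i ∈ Set.Ioo (0 : ℝ) 1) (hη : IsProbVec η) (hcrit : ∑ i, μ i * p i = 1 / 2) :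
    ∃ C c : ℝ, 0 ≤ C ∧ 0 < c ∧ ∀ (Q : Measure (ℕ → Bool)) [IsProbabilityMeasure Q],
      IsTossLaw Q K p η (fun j s => s j) →
      SiteBounds Q (∑ i, η i * rvec K μ p i) (nuVal K μ p) C c := by
  obtain ⟨hr, hr0⟩ := rvec_spec hK hμ hcrit
  obtain ⟨lam, hlam0, hlam1, hlam⟩ := exists_survival_decay hK hp
  obtain ⟨C1, θ, hC1, hθ0, hθ1, h1⟩ := exists_first_moment hK hμ hp hcrit
  obtain ⟨C2, hC2, h2⟩ := exists_second_moment hK hμ hp hcrit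
  obtain ⟨C4, hC4, h4⟩ := exists_fourth_moment hK hp hr
  obtain ⟨D, hD0, hD⟩ := exists_geometric_le_inv_sqrt hθ0 hθ1
  have hν := nuVal_pos hK hμ hp hcrit
  generalize rvec K μ p = r at *
  generalize nuVal K μ p = ν at *
  obtain ⟨c, hc0, hc⟩ : ∃ c : ℝ, 0 < c ∧ ∀ i, c ≤ p i ∧ c ≤ 1 - p i := by
    rcases isEmpty_or_nonempty (Fin N) with h | h
    · exact ⟨1, one_pos, fun i => h.elim i⟩
    · obtain ⟨i, hi⟩ := Finite.exists_min fun i => min (p i) (1 - p i)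
      exact ⟨_, lt_min (hp i).1 (sub_pos.2 (hp i).2), fun j => le_min_iff.1 (hi j)⟩
  refine ⟨max (C1 * D) (max C2 C4), c, le_max_of_le_right (le_max_of_le_left hC2), hc0,
    fun Q _ hQ => ?_⟩
  have hinf := hQ.ae_infFail hK hp hη
  have hfourth : ∀ n : ℕ, 1 ≤ n → Integrable (fun s => ((succBefore s n : ℝ) - n) ^ 4) Q ∧
      ∫ s, ((succBefore s n : ℝ) - n) ^ 4 ∂Q ≤ C4 * (n : ℝ) ^ 2 := fun n hn =>
    hQ.integrable_and_fourth hK hη hinf (by positivity) fun t i => h4 n t i hn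
  refine ⟨hinf, fun n => ?_, fun n hn => ?_, fun n hn => ?_, fun n hn => ?_, fun n => ?_,
    fun M => ?_⟩
  · rcases Nat.eq_zero_or_pos n with rfl | hn
    · simp [succBefore_zero]
    · exact (hfourth n hn).1
  · refine (hfourth n hn).2.trans ?_
    gcongr
    exact le_max_of_le_right (le_max_right _ _)
  · have hlim := hQ.tendsto_iterate_stepOp hK hinf (hfourth n hn).1
      (fun a d => (a : ℝ) + d - n) (A := 1 + n) (fun a d hd => by
        have ha : (a : ℝ) ≤ 1 + (a : ℝ) ^ 4 := by
          nlinarith [sq_nonneg ((a : ℝ) ^ 2 - 1), sq_nonneg ((a : ℝ) - 1)]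
        have ha0 : (0 : ℝ) ≤ a := Nat.cast_nonneg a
        have hd0 : (0 : ℝ) ≤ d := Nat.cast_nonneg d
        have hd' : (d : ℝ) ≤ n := by exact_mod_cast hd
        have hn0 : (0 : ℝ) ≤ n := Nat.cast_nonneg n
        have ha4 : (0 : ℝ) ≤ (a : ℝ) ^ 4 := by positivity
        have : |(a : ℝ) + d - n| ≤ a + n := by rw [abs_le]; constructor <;> linarith
        nlinarith [mul_nonneg hn0 ha4])
    simp only [Nat.cast_zero, add_zero] at hlim
    have hb : Tendsto (fun t : ℕ => C1 * θ ^ n + 2 * C1 * (lam ^ t * 2 ^ n)) atTop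
        (nhds (C1 * θ ^ n)) := by
      simpa using (((tendsto_pow_atTop_nhds_zero_of_lt_one hlam0 hlam1).mul_const
        ((2 : ℝ) ^ n)).const_mul (2 * C1)).const_add (C1 * θ ^ n)
    have hle := le_of_tendsto_of_tendsto' (hlim.sub_const (∑ i, η i * r i)).abs hb fun t =>
      hη.abs_sum_mul_sub_le fun i => (h1 n t i).trans (by gcongr; exact hlam t i 0 n)
    calc _ ≤ C1 * θ ^ n := hle
      _ ≤ C1 * (D / √n) := by gcongr; exact hD n hn
      _ = C1 * D / √n := by ring
      _ ≤ _ := by gcongr; exact le_max_left _ _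
  · have hlim := hQ.tendsto_iterate_stepOp hK hinf (hfourth n hn).1
      (fun a d => ((a : ℝ) + d - n) ^ 2 + ν * d) (A := 2 + 2 * (n : ℝ) ^ 2 + ν * n)
      (fun a d hd => by
        have ha : (a : ℝ) ^ 2 ≤ 1 + (a : ℝ) ^ 4 := by
          nlinarith [sq_nonneg ((a : ℝ) ^ 2 - 1)]
        have ha0 : (0 : ℝ) ≤ a := Nat.cast_nonneg a
        have hd0 : (0 : ℝ) ≤ d := Nat.cast_nonneg d
        have hd' : (d : ℝ) ≤ n := by exact_mod_cast hd
        have hn0 : (0 : ℝ) ≤ n := Nat.cast_nonneg n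
        have ha4 : (0 : ℝ) ≤ (a : ℝ) ^ 4 := by positivity
        have hνd : ν * d ≤ ν * n := by gcongr
        rw [abs_of_nonneg (by positivity)]
        have h3 : ((a : ℝ) + d - n) ^ 2 ≤ 2 * (a : ℝ) ^ 2 + 2 * (n : ℝ) ^ 2 := by
          nlinarith [sq_nonneg ((a : ℝ) - (d - n))]
        nlinarith [mul_nonneg (mul_nonneg hν.le hn0) ha4, mul_nonneg (sq_nonneg (n : ℝ)) ha4])
    simp only [Nat.cast_zero, add_zero, mul_zero] at hlim
    have hle := le_of_tendsto' (hlim.sub_const (ν * n)).abs (b := C2 * √n) fun t => by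
      have := hη.abs_sum_mul_sub_le (y := fun _ => ν * n) fun i => h2 n t i hn
      rwa [← Finset.sum_mul, hη.2, one_mul] at this
    refine hle.trans ?_
    gcongr
    exact le_max_of_le_right (le_max_left _ _)
  · have hm : MeasurableSet {s : ℕ → Bool | succBefore s n = 0} :=
      measurableSet_eq_fun (measurable_succBefore n) measurable_const
    calc c ^ n ≤ ∑ i, η i * (stepOp K p)^[n] (fun _ a d => if a = 0 ∧ d = 0 then 1 else 0) i 0 n :=
          hη.le_sum_mul fun i =>
            le_iterate_stepOp_all_failures hK hp hc0.le (fun i => (hc i).2) i n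
      _ = ∫ s, (if (tossRun 0 n (List.ofFn fun j : Fin n => s j)).1 = 0 ∧
            (tossRun 0 n (List.ofFn fun j : Fin n => s j)).2 = 0 then 1 else 0) ∂Q :=
          (hQ.integral_tossRun hK (fun a d => if a = 0 ∧ d = 0 then 1 else 0) n 0 n).symm
      _ ≤ ∫ s, {s : ℕ → Bool | succBefore s n = 0}.indicator 1 s ∂Q := by
          refine integral_mono_ae (integrable_comp_prefix Q n fun l =>
            if (tossRun 0 n l).1 = 0 ∧ (tossRun 0 n l).2 = 0 then 1 else 0)
            ((integrable_const 1).indicator hm) ?_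
          filter_upwards [hinf] with s hs
          have h := (tossRun_spec hs n 0 n).2.2.2
          simp only [Set.indicator, Set.mem_ofPred_eq, Pi.one_apply]
          split_ifs with ha hb hb
          · exact le_rfl
          · exact absurd ((zero_add _).symm.trans ((h ha.2).symm.trans ha.1)) hb
          · exact zero_le_one
          · exact le_rfl
      _ = _ := integral_indicator_one hm
  · have hm : MeasurableSet {s : ℕ → Bool | M ≤ succBefore s 1} :=
      measurable_succBefore 1 measurableSet_Ici
    calc c ^ M ≤ ∑ i, η i * (stepOp K p)^[M] (fun _ a _ => if M ≤ a then 1 else 0) i 0 1 :=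
          hη.le_sum_mul fun i =>
            le_iterate_stepOp_all_successes hK hp hc0.le (fun i => (hc i).1) i M 0 M (by omega)
      _ = ∫ s, (if M ≤ (tossRun 0 1 (List.ofFn fun j : Fin M => s j)).1 then 1 else 0) ∂Q :=
          (hQ.integral_tossRun hK (fun a _ => if M ≤ a then 1 else 0) M 0 1).symm
      _ ≤ ∫ s, {s : ℕ → Bool | M ≤ succBefore s 1}.indicator 1 s ∂Q := by
          refine integral_mono_ae (integrable_comp_prefix Q M fun l =>
            if M ≤ (tossRun 0 1 l).1 then 1 else 0)
            ((integrable_const 1).indicator hm) ?_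
          filter_upwards [hinf] with s hs
          have h := (tossRun_spec hs M 0 1).1
          simp only [Set.indicator, Set.mem_ofPred_eq, Pi.one_apply]
          split_ifs with ha hb hb
          · exact le_rfl
          · exact absurd (by omega) hb
          · exact zero_le_one
          · exact le_rfl
      _ = _ := integral_indicator_one hm

end SiteMoments

section RealEstimates

lemma nonneg_of_mul_deriv_nonneg {g g' : ℝ → ℝ} {u : ℝ} (h0 : g 0 = 0)
    (hg : ∀ x ∈ Set.uIcc 0 u, HasDerivAt g (g' x) x) (hg' : ∀ x ∈ Set.uIcc 0 u, 0 ≤ x * g' x) :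
    0 ≤ g u := by
  rcases lt_trichotomy u 0 with hu | rfl | hu
  · rw [Set.uIcc_of_ge hu.le] at hg hg'
    obtain ⟨c, hc, hc'⟩ := exists_hasDerivAt_eq_slope g g' hu
      (fun x hx => (hg x hx).continuousAt.continuousWithinAt)
      fun x hx => hg x ⟨hx.1.le, hx.2.le⟩
    have h1 := hg' c ⟨hc.1.le, hc.2.le⟩
    have h2 : g' c ≤ 0 := by
      by_contra! h
      nlinarith [hc.2]
    rw [h0, eq_div_iff (by linarith)] at hc'
    nlinarith
  · exact h0.ge
  · rw [Set.uIcc_of_le hu.le] at hg hg'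
    obtain ⟨c, hc, hc'⟩ := exists_hasDerivAt_eq_slope g g' hu
      (fun x hx => (hg x hx).continuousAt.continuousWithinAt)
      fun x hx => hg x ⟨hx.1.le, hx.2.le⟩
    have h1 := hg' c ⟨hc.1.le, hc.2.le⟩
    have h2 : 0 ≤ g' c := by
      by_contra! h
      nlinarith [hc.1]
    rw [h0, eq_div_iff (by linarith)] at hc'
    nlinarith

lemma log_one_add_le_cubic {u : ℝ} (hu : -1 < u) :
    Real.log (1 + u) ≤ u - u ^ 2 / 2 + u ^ 3 / 3 := by
  have hx : ∀ x ∈ Set.uIcc 0 u, 0 < 1 + x := by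
    intro x hx
    rcases Set.mem_uIcc.1 hx with h | h <;> linarith [h.1, h.2]
  have := nonneg_of_mul_deriv_nonneg
    (g := fun u => u - u ^ 2 / 2 + u ^ 3 / 3 - Real.log (1 + u))
    (g' := fun u => 1 - u + u ^ 2 - 1 / (1 + u)) (u := u) (by simp) (fun x hx' => by
      have h1 := (((hasDerivAt_id x).sub (((hasDerivAt_id x).pow 2).div_const 2)).add
        (((hasDerivAt_id x).pow 3).div_const 3)).sub
        (((hasDerivAt_id x).const_add 1).log (hx x hx').ne')
      refine HasDerivAt.congr_deriv (f' := _) h1 ?_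
      simp) (fun x hx' => by
      have hpos := hx x hx'
      have : x * (1 - x + x ^ 2 - 1 / (1 + x)) = x ^ 4 / (1 + x) := by
        field_simp
        ring
      rw [this]
      positivity)
  simpa using this

lemma le_log_one_add_of_nonneg {u : ℝ} (hu : 0 ≤ u) : u - u ^ 2 / 2 ≤ Real.log (1 + u) := by
  refine le_trans ?_ (Real.le_log_one_add_of_nonneg hu)
  rw [le_div_iff₀ (by linarith)]
  nlinarith [pow_nonneg hu 3]

lemma le_log_one_add_of_nonpos {u : ℝ} (hu : -1 / 2 ≤ u) (hu0 : u ≤ 0) :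
    u - u ^ 2 / 2 + 2 * u ^ 3 ≤ Real.log (1 + u) := by
  have hx : ∀ x ∈ Set.uIcc 0 u, -1 / 2 ≤ x ∧ x ≤ 0 := by
    intro x hx
    rw [Set.uIcc_of_ge hu0] at hx
    exact ⟨hu.trans hx.1, hx.2⟩
  have := nonneg_of_mul_deriv_nonneg
    (g := fun u => Real.log (1 + u) - (u - u ^ 2 / 2 + 2 * u ^ 3))
    (g' := fun u => 1 / (1 + u) - (1 - u + 6 * u ^ 2)) (u := u) (by simp) (fun x hx' => by
      have hpos : (0 : ℝ) < 1 + x := by linarith [(hx x hx').1]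
      have h1 := (((hasDerivAt_id x).const_add 1).log hpos.ne').sub
        (((hasDerivAt_id x).sub (((hasDerivAt_id x).pow 2).div_const 2)).add
        (((hasDerivAt_id x).pow 3).const_mul 2))
      refine HasDerivAt.congr_deriv (f' := _) h1 ?_
      simp
      ring) (fun x hx' => by
      obtain ⟨h1, h2⟩ := hx x hx'
      have hpos : (0 : ℝ) < 1 + x := by linarith
      have : x * (1 / (1 + x) - (1 - x + 6 * x ^ 2)) = x ^ 2 * (-x * (5 + 6 * x)) / (1 + x) := by
        field_simp
        ring
      rw [this]
      have h3 : 0 ≤ -x * (5 + 6 * x) := mul_nonneg (by linarith) (by linarith)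
      positivity)
  simpa using this

lemma sq_sub_abs_cube_le_sq_log {u : ℝ} (hu : -1 < u) :
    u ^ 2 - |u| ^ 3 ≤ Real.log (1 + u) ^ 2 := by
  rcases le_or_gt 0 u with h | h
  · rw [abs_of_nonneg h]
    rcases le_or_gt u 1 with h1 | h1
    · have h2 := le_log_one_add_of_nonneg h
      have h3 : 0 ≤ u - u ^ 2 / 2 := by nlinarith
      have h4 : (u - u ^ 2 / 2) ^ 2 ≤ Real.log (1 + u) ^ 2 := by gcongr
      nlinarith [pow_nonneg h 4]
    · nlinarith [sq_nonneg (Real.log (1 + u)), mul_pos (show 0 < u by linarith)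
        (show 0 < u by linarith)]
  · have h1 : Real.log (1 + u) ≤ u := by
      have := Real.log_le_sub_one_of_pos (show 0 < 1 + u by linarith)
      linarith
    have h2 : 0 ≤ |u| ^ 3 := by positivity
    nlinarith

lemma cube_log_le_abs_cube {u : ℝ} (hu : -1 < u) : Real.log (1 + u) ^ 3 ≤ |u| ^ 3 := by
  have h1 : Real.log (1 + u) ≤ |u| := by
    have := Real.log_le_sub_one_of_pos (show 0 < 1 + u by linarith)
    linarith [le_abs_self u]
  exact (Odd.strictMono_pow (by decide : Odd 3)).monotone h1

lemma sqrt_one_add_le_cubic {t : ℝ} (ht : -1 ≤ t) :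
    √(1 + t) ≤ 1 + t / 2 - t ^ 2 / 8 + t ^ 3 / 16 := by
  refine Real.sqrt_le_iff.2 ⟨?_, ?_⟩
  · have h1 : 0 ≤ 1 + t := by linarith
    have h2 : 1 + t / 2 - t ^ 2 / 8 + t ^ 3 / 16
        = 5 / 16 + (1 + t) * (11 / 16 - 3 * t / 16 + t ^ 2 / 16) := by ring
    rw [h2]
    have h3 : 0 ≤ 11 / 16 - 3 * t / 16 + t ^ 2 / 16 := by nlinarith [sq_nonneg (t - 3 / 2)]
    positivity
  · have h2 : (1 + t / 2 - t ^ 2 / 8 + t ^ 3 / 16) ^ 2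
        = 1 + t + t ^ 4 * ((t - 2) ^ 2 / 256 + 1 / 16) := by ring
    rw [h2]
    have : 0 ≤ t ^ 4 * ((t - 2) ^ 2 / 256 + 1 / 16) := by positivity
    linarith

/-- Expansion of `√log` around `m`, in terms of the relative increment `u`. -/
lemma sqrt_log_le {m u L : ℝ} (hm : 0 < m) (hL : L = Real.log m) (hL1 : 1 ≤ L)
    (hu : 1 ≤ m * (1 + u)) :
    √(Real.log (m * (1 + u))) ≤ √L * (1 + (u - u ^ 2 / 2 - u ^ 2 / (4 * L) + |u| ^ 3) / (2 * L)) := by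
  have hu1 : 0 < 1 + u := by
    by_contra! h
    nlinarith
  have hu' : -1 < u := by linarith
  have hL0 : 0 < L := by linarith
  obtain ⟨y, hy⟩ : ∃ y, y = Real.log (1 + u) := ⟨_, rfl⟩
  have hlog : Real.log (m * (1 + u)) = L * (1 + y / L) := by
    rw [Real.log_mul hm.ne' hu1.ne', ← hL, ← hy]
    field_simp
  have hlog0 : 0 ≤ L * (1 + y / L) := hlog ▸ Real.log_nonneg hu
  have ht : -1 ≤ y / L := by
    have := nonneg_of_mul_nonneg_right hlog0 hL0
    linarith
  rw [hlog, Real.sqrt_mul hL0.le]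
  refine mul_le_mul_of_nonneg_left ((sqrt_one_add_le_cubic ht).trans ?_) (Real.sqrt_nonneg _)
  have h1 := log_one_add_le_cubic hu'
  have h2 := sq_sub_abs_cube_le_sq_log hu'
  have h3 := cube_log_le_abs_cube hu'
  rw [← hy] at h1 h2 h3
  have h4 : u ^ 3 ≤ |u| ^ 3 := by rw [← abs_pow]; exact le_abs_self _
  have hb : 0 ≤ |u| ^ 3 := by positivity
  generalize |u| ^ 3 = b at *
  have hi1 : 0 < 1 / L := by positivity
  have hi2 : 1 / L ≤ 1 := by rw [div_le_one hL0]; exact hL1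
  obtain ⟨q, hq⟩ : ∃ q, q = 1 / L := ⟨_, rfl⟩
  rw [← hq] at hi1 hi2
  have e1 : 1 + y / L / 2 - (y / L) ^ 2 / 8 + (y / L) ^ 3 / 16
      = 1 + (q / 2) * (y - q / 4 * y ^ 2 + q ^ 2 / 8 * y ^ 3) := by
    rw [hq]; field_simp; ring
  have e2 : 1 + (u - u ^ 2 / 2 - u ^ 2 / (4 * L) + b) / (2 * L)
      = 1 + (q / 2) * (u - u ^ 2 / 2 - q / 4 * u ^ 2 + b) := by
    rw [hq]; field_simp
  rw [e1, e2]
  have f1 : q / 4 * (u ^ 2 - b) ≤ q / 4 * y ^ 2 := by gcongr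
  have f2 : q ^ 2 / 8 * y ^ 3 ≤ q ^ 2 / 8 * b := by gcongr
  have f3 : q / 4 * b ≤ 1 / 4 * b := by gcongr
  have f4 : q ^ 2 / 8 * b ≤ 1 / 8 * b := by
    gcongr
    exact pow_le_one₀ hi1.le hi2
  have : y - q / 4 * y ^ 2 + q ^ 2 / 8 * y ^ 3 ≤ u - u ^ 2 / 2 - q / 4 * u ^ 2 + b := by
    linarith
  have := mul_le_mul_of_nonneg_left this (show 0 ≤ q / 2 by positivity)
  linarith

/-- Expansion of `1 / log` around `m`, in terms of the relative increment `u`. -/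
lemma inv_log_le {m u L : ℝ} (hm : 0 < m) (hL : L = Real.log m) (hL2 : 2 ≤ L)
    (hu : 3 ≤ m * (1 + u)) :
    1 / Real.log (m * (1 + u))
      ≤ 1 / L + (-u + u ^ 2 / 2 + 2 * |u| ^ 3 + 8 * u ^ 2 / L + 16 * L ^ 2 * u ^ 4) / L ^ 2 := by
  have hu1 : 0 < 1 + u := by
    by_contra! h
    nlinarith
  have hL0 : 0 < L := by linarith
  rcases le_or_gt (-1 / 2) u with h | h
  · obtain ⟨y, hy⟩ : ∃ y, y = Real.log (1 + u) := ⟨_, rfl⟩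
    have hlog : Real.log (m * (1 + u)) = L + y := by
      rw [Real.log_mul hm.ne' hu1.ne', ← hL, ← hy]
    have hylow : u - u ^ 2 / 2 - 2 * |u| ^ 3 ≤ y := by
      rw [hy]
      rcases le_or_gt 0 u with h0 | h0
      · have := le_log_one_add_of_nonneg h0
        have : 0 ≤ |u| ^ 3 := by positivity
        linarith
      · have := le_log_one_add_of_nonpos h h0.le
        have h3 : |u| ^ 3 = -u ^ 3 := by rw [abs_of_neg h0]; ring
        linarith
    have hyup : y ≤ u := by
      have := Real.log_le_sub_one_of_pos hu1
      linarith
    have hy2 : y ^ 2 ≤ 4 * u ^ 2 := by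
      have h2 : -(2 * |u|) ≤ y := by
        have : 1 - (1 + u)⁻¹ ≤ y := hy ▸ Real.one_sub_inv_le_log_of_pos hu1
        rcases le_or_gt 0 u with h0 | h0
        · have h4 : 0 ≤ y := hy ▸ Real.log_nonneg (by linarith)
          have := abs_nonneg u
          linarith
        · rw [abs_of_neg h0]
          have h5 : 2 * u ≤ 1 - (1 + u)⁻¹ := by
            have : 1 - (1 + u)⁻¹ = u / (1 + u) := by field_simp; ring
            rw [this, le_div_iff₀ hu1]
            nlinarith
          linarith
      have h3 : y ≤ 2 * |u| := by linarith [le_abs_self u, abs_nonneg u]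
      have := sq_le_sq' h2 h3
      rwa [mul_pow, sq_abs, show (2 : ℝ) ^ 2 = 4 by norm_num] at this
    have hyL : -(L / 2) ≤ y := by
      have h1 : Real.log (1 / 2) ≤ y := hy ▸ Real.log_le_log (by norm_num) (by linarith)
      have h2 : -1 ≤ Real.log (1 / 2) := by
        have := Real.one_sub_inv_le_log_of_pos (show (0 : ℝ) < 1 / 2 by norm_num)
        norm_num at this ⊢
        linarith
      linarith
    have hLy : 0 < L + y := by linarith
    have e1 : 1 / (L + y) ≤ 1 / L + (-y + 2 * y ^ 2 / L) / L ^ 2 := by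
      have e2 : 1 / L + (-y + 2 * y ^ 2 / L) / L ^ 2 - 1 / (L + y)
          = y ^ 2 * (L + 2 * y) / (L ^ 3 * (L + y)) := by
        field_simp
        ring
      have : 0 ≤ y ^ 2 * (L + 2 * y) / (L ^ 3 * (L + y)) := by
        have : 0 ≤ L + 2 * y := by linarith
        positivity
      linarith
    rw [hlog]
    refine e1.trans ?_
    have e3 : 2 * y ^ 2 / L ≤ 8 * u ^ 2 / L := by
      gcongr ?_ / L
      linarith
    have e4 : 0 ≤ 16 * L ^ 2 * u ^ 4 := by positivity
    have e5 := div_le_div_of_nonneg_right (show -y + 2 * y ^ 2 / L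
      ≤ -u + u ^ 2 / 2 + 2 * |u| ^ 3 + 8 * u ^ 2 / L + 16 * L ^ 2 * u ^ 4 by linarith)
      (show 0 ≤ L ^ 2 by positivity)
    linarith
  · have h1 : 1 ≤ Real.log (m * (1 + u)) := by
      rw [Real.le_log_iff_exp_le (by linarith)]
      exact (Real.exp_one_lt_d9.le.trans (by norm_num)).trans hu
    have h2 : 1 / Real.log (m * (1 + u)) ≤ 1 := by
      rw [div_le_one (by linarith)]
      exact h1
    have h3 : 1 ≤ 16 * u ^ 4 := by nlinarith [sq_nonneg (u ^ 2 - 1 / 4)]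
    have h4 : 1 / L + (-u + u ^ 2 / 2 + 2 * |u| ^ 3 + 8 * u ^ 2 / L + 16 * L ^ 2 * u ^ 4) / L ^ 2
        = 1 / L + (-u + u ^ 2 / 2 + 2 * |u| ^ 3 + 8 * u ^ 2 / L) / L ^ 2 + 16 * u ^ 4 := by
      field_simp
      ring
    have h5 : 0 ≤ (-u + u ^ 2 / 2 + 2 * |u| ^ 3 + 8 * u ^ 2 / L) / L ^ 2 := by
      have : 0 ≤ -u := by linarith
      positivity
    have h6 : 0 ≤ 1 / L := by positivity
    rw [h4]
    linarith

lemma eventually_log_le_mul_sqrt {ε : ℝ} (hε : 0 < ε) :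
    ∀ᶠ n : ℕ in atTop, Real.log (n + 3) ≤ ε * √n := by
  have h := (isLittleO_log_rpow_atTop (show (0 : ℝ) < 1 / 2 by norm_num)).bound
    (show 0 < ε / 2 by positivity)
  have htend : Tendsto (fun n : ℕ => (n : ℝ) + 3) atTop atTop :=
    tendsto_atTop_add_const_right _ _ tendsto_natCast_atTop_atTop
  filter_upwards [htend.eventually h, eventually_ge_atTop 1] with n hn hn1
  have hn1' : (1 : ℝ) ≤ n := by exact_mod_cast hn1
  rw [← Real.sqrt_eq_rpow, Real.norm_eq_abs, Real.norm_eq_abs, abs_of_nonneg (Real.sqrt_nonneg _)]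
    at hn
  have h2 : √((n : ℝ) + 3) ≤ 2 * √n := by
    refine Real.sqrt_le_iff.2 ⟨by positivity, ?_⟩
    rw [mul_pow, Real.sq_sqrt (by linarith)]
    linarith
  calc Real.log (n + 3) ≤ ε / 2 * √((n : ℝ) + 3) := (le_abs_self _).trans hn
    _ ≤ ε / 2 * (2 * √n) := by gcongr
    _ = ε * √n := by ring

end RealEstimates

section Lyapunov

lemma abs_pow_le_one_add_pow_four (x : ℝ) {k : ℕ} (hk : k ≤ 4) : |x| ^ k ≤ 1 + x ^ 4 := by
  have h4 : x ^ 4 = |x| ^ 4 := by rw [← abs_pow, abs_of_nonneg (by positivity)]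
  rcases le_total |x| 1 with h | h
  · have := pow_le_one₀ (n := k) (abs_nonneg x) h
    have : 0 ≤ x ^ 4 := by positivity
    linarith
  · have := pow_le_pow_right₀ h hk
    linarith

lemma abs_pow_three_le (x : ℝ) {s : ℝ} (hs : 0 < s) :
    |x| ^ 3 ≤ s / 2 * x ^ 2 + 1 / (2 * s) * x ^ 4 := by
  have h4 : x ^ 4 = |x| ^ 4 := by rw [← abs_pow, abs_of_nonneg (by positivity)]
  have h2 : x ^ 2 = |x| ^ 2 := (sq_abs x).symm
  rw [h4, h2]
  have : s / 2 * |x| ^ 2 + 1 / (2 * s) * |x| ^ 4 - |x| ^ 3 = |x| ^ 2 * (s - |x|) ^ 2 / (2 * s) := by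
    field_simp
    ring
  have h : 0 ≤ |x| ^ 2 * (s - |x|) ^ 2 / (2 * s) := by positivity
  linarith

/-- The drift of `√log` is nonpositive under the moment bounds with `ρ ≤ ν / 2`. -/
lemma drift_sqrt_log_nonpos {s m L a1 a2 a3 ρ ν C : ℝ} (hs : 1 ≤ s) (hm : m = s ^ 2 + 3)
    (hL : 1 ≤ L) (hν : 0 < ν) (hC : 0 ≤ C) (hρ : ρ ≤ ν / 2) (h1 : a1 ≤ ρ + C / s)
    (h2 : ν * s ^ 2 - C * s ≤ a2) (h3 : a3 ≤ (ν + 2 * C) / 2 * s ^ 3)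
    (hLs : 4 * (6 * C + 2 * ν) * L ≤ ν * s) :
    a1 / m - a2 / m ^ 2 / 2 - a2 / m ^ 2 / (4 * L) + a3 / m ^ 3 ≤ 0 := by
  have hs0 : 0 < s := by linarith
  have hm0 : 0 < m := by rw [hm]; positivity
  have hL0 : 0 < L := by linarith
  have hss : s ≤ s ^ 2 := by nlinarith
  have e1 : m * a1 ≤ s ^ 2 * (ν / 2) + 3 / 2 * ν * s + 4 * C * s := by
    have : m * a1 ≤ m * (ν / 2 + C / s) := by gcongr; linarith
    have h5 : m * (ν / 2 + C / s) = s ^ 2 * (ν / 2) + 3 / 2 * ν + C * s + 3 * (C / s) := by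
      rw [hm]; field_simp; ring
    have h6 : C / s ≤ C * s := by
      rw [div_le_iff₀ hs0]
      nlinarith [mul_nonneg hC (show 0 ≤ s * s - 1 by nlinarith)]
    have h7 : 3 / 2 * ν ≤ 3 / 2 * ν * s := by nlinarith
    linarith
  have e2 : a3 / m ≤ (ν + 2 * C) / 2 * s := by
    rw [div_le_iff₀ hm0, hm]
    have : 0 ≤ (ν + 2 * C) / 2 * s * 3 := by positivity
    nlinarith
  have e3 : -(a2 / (4 * L)) ≤ -(ν * s ^ 2 / (4 * L)) + C * s / 4 := by
    have h5 : (ν * s ^ 2 - C * s) / (4 * L) ≤ a2 / (4 * L) := by gcongr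
    have h6 : C * s / (4 * L) ≤ C * s / 4 := by
      gcongr
      linarith
    rw [sub_div] at h5
    linarith
  have e4 : (6 * C + 2 * ν) * s ≤ ν * s ^ 2 / (4 * L) := by
    rw [le_div_iff₀ (by positivity)]
    nlinarith
  have e5 : m * a1 - a2 / 2 - a2 / (4 * L) + a3 / m ≤ 0 := by
    have : 0 ≤ C * s := by positivity
    nlinarith
  have e6 : a1 / m - a2 / m ^ 2 / 2 - a2 / m ^ 2 / (4 * L) + a3 / m ^ 3
      = (m * a1 - a2 / 2 - a2 / (4 * L) + a3 / m) / m ^ 2 := by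
    field_simp
  rw [e6]
  exact div_nonpos_of_nonpos_of_nonneg e5 (by positivity)

/-- The drift of `1 / log` is nonpositive under the moment bounds with `ν / 2 < ρ`. -/
lemma drift_inv_log_nonpos {s m L a1 a2 a3 a4 ρ ν C : ℝ} (hs : 1 ≤ s) (hm : m = s ^ 2 + 3)
    (hL : 1 ≤ L) (hν : 0 < ν) (hC : 0 ≤ C) (hρ : 0 < ρ) (h1 : ρ - C / s ≤ a1)
    (h2 : a2 ≤ ν * s ^ 2 + C * s) (h3 : a3 ≤ (ν + 2 * C) / 2 * s ^ 3) (h4 : a4 ≤ C * s ^ 4)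
    (hs1 : (7 * C + ν) * s ≤ (ρ - ν / 2) / 4 * s ^ 2) (hL1 : 8 * (ν + C) ≤ (ρ - ν / 2) / 4 * L)
    (hLs : 16 * C * L ^ 2 ≤ (ρ - ν / 2) / 4 * s ^ 2) :
    -(a1 / m) + a2 / m ^ 2 / 2 + 2 * (a3 / m ^ 3) + 8 * (a2 / m ^ 2) / L
      + 16 * L ^ 2 * (a4 / m ^ 4) ≤ 0 := by
  have hs0 : 0 < s := by linarith
  have hm0 : 0 < m := by rw [hm]; positivity
  have hL0 : 0 < L := by linarith
  have hss : s ≤ s ^ 2 := by nlinarith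
  have e1 : -(m * a1) ≤ -(s ^ 2 * ρ) + 4 * C * s := by
    have : m * (ρ - C / s) ≤ m * a1 := by gcongr
    have h5 : m * (ρ - C / s) = s ^ 2 * ρ + 3 * ρ - C * s - 3 * (C / s) := by
      rw [hm]; field_simp; ring
    have h6 : C / s ≤ C * s := by
      rw [div_le_iff₀ hs0]
      nlinarith [mul_nonneg hC (show 0 ≤ s * s - 1 by nlinarith)]
    linarith
  have e2 : a3 / m ≤ (ν + 2 * C) / 2 * s := by
    rw [div_le_iff₀ hm0, hm]
    have : 0 ≤ (ν + 2 * C) / 2 * s * 3 := by positivity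
    nlinarith
  have e3 : 8 * a2 / L ≤ (ρ - ν / 2) / 4 * s ^ 2 := by
    rw [div_le_iff₀ hL0]
    have h5 : a2 ≤ (ν + C) * s ^ 2 := by nlinarith
    nlinarith [mul_le_mul_of_nonneg_right hL1 (sq_nonneg s)]
  have e4 : a4 / m ^ 2 ≤ C := by
    rw [div_le_iff₀ (by positivity)]
    refine h4.trans ?_
    have : s ^ 4 ≤ m ^ 2 := by
      rw [show s ^ 4 = (s ^ 2) ^ 2 by ring]
      gcongr
      linarith
    gcongr
  have e5 : 16 * L ^ 2 * (a4 / m ^ 2) ≤ 16 * L ^ 2 * C := by gcongr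
  have e6 : -(m * a1) + a2 / 2 + 2 * (a3 / m) + 8 * a2 / L + 16 * L ^ 2 * (a4 / m ^ 2) ≤ 0 := by
    have : 0 ≤ C * s := by positivity
    have : 0 ≤ (ρ - ν / 2) / 4 * s ^ 2 := le_trans (by positivity) hs1
    nlinarith
  have e7 : -(a1 / m) + a2 / m ^ 2 / 2 + 2 * (a3 / m ^ 3) + 8 * (a2 / m ^ 2) / L
      + 16 * L ^ 2 * (a4 / m ^ 4)
      = (-(m * a1) + a2 / 2 + 2 * (a3 / m) + 8 * a2 / L + 16 * L ^ 2 * (a4 / m ^ 2)) / m ^ 2 := by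
    field_simp
  rw [e7]
  exact div_nonpos_of_nonpos_of_nonneg e6 (by positivity)

variable {Q : Measure (ℕ → Bool)} [IsProbabilityMeasure Q] {ρ ν C c : ℝ}

lemma measurable_succBefore_sub (n : ℕ) :
    Measurable fun s : ℕ → Bool => (succBefore s n : ℝ) - n :=
  (measurable_from_top.comp (measurable_succBefore n)).sub_const _

lemma SiteBounds.integrable_abs_pow (h : SiteBounds Q ρ ν C c) (n : ℕ) {k : ℕ} (hk : k ≤ 4) :
    Integrable (fun s => |(succBefore s n : ℝ) - n| ^ k) Q := by
  refine ((integrable_const 1).add (h.integrable n)).mono'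
    ((measurable_succBefore_sub n).abs.pow_const k).aestronglyMeasurable
    (Eventually.of_forall fun s => ?_)
  rw [Real.norm_of_nonneg (by positivity)]
  exact abs_pow_le_one_add_pow_four _ hk

lemma SiteBounds.integrable_sub (h : SiteBounds Q ρ ν C c) (n : ℕ) :
    Integrable (fun s => (succBefore s n : ℝ) - n) Q := by
  have := h.integrable_abs_pow n (k := 1) (by norm_num)
  simp only [pow_one] at this
  exact (integrable_norm_iff (measurable_succBefore_sub n).aestronglyMeasurable).1 this

lemma SiteBounds.integrable_sq (h : SiteBounds Q ρ ν C c) (n : ℕ) :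
    Integrable (fun s => ((succBefore s n : ℝ) - n) ^ 2) Q := by
  simpa only [sq_abs] using h.integrable_abs_pow n (k := 2) (by norm_num)

lemma SiteBounds.third (h : SiteBounds Q ρ ν C c) (hC : 0 ≤ C) {n : ℕ} (hn : 1 ≤ n) :
    ∫ s, |(succBefore s n : ℝ) - n| ^ 3 ∂Q ≤ (ν + 2 * C) / 2 * √n ^ 3 := by
  have hn' : (1 : ℝ) ≤ n := by exact_mod_cast hn
  have hs1 : 1 ≤ √(n : ℝ) := Real.one_le_sqrt.2 hn'
  have hsq : √(n : ℝ) ^ 2 = n := Real.sq_sqrt (by linarith)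
  have h2 := (abs_le.1 (h.second n hn)).2
  have h4 := h.fourth n hn
  have h4' : ∫ s, ((succBefore s n : ℝ) - n) ^ 4 ∂Q ≤ C * (√(n : ℝ) ^ 2) ^ 2 := by rwa [hsq]
  have h2' : ∫ s, ((succBefore s n : ℝ) - n) ^ 2 ∂Q ≤ ν * √(n : ℝ) ^ 2 + C * √(n : ℝ) := by
    rw [hsq]
    linarith
  have hi2 := (h.integrable_sq n).const_mul (√(n : ℝ) / 2)
  have hi4 := (h.integrable n).const_mul (1 / (2 * √(n : ℝ)))
  have hle : ∫ s, |(succBefore s n : ℝ) - n| ^ 3 ∂Q ≤ ∫ s, (√(n : ℝ) / 2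
      * ((succBefore s n : ℝ) - n) ^ 2 + 1 / (2 * √(n : ℝ)) * ((succBefore s n : ℝ) - n) ^ 4) ∂Q :=
    integral_mono (h.integrable_abs_pow n (by norm_num)) (hi2.add hi4)
      fun s => abs_pow_three_le _ (by linarith)
  rw [integral_add hi2 hi4, integral_const_mul, integral_const_mul] at hle
  refine hle.trans ?_
  clear h2 h4 hi2 hi4 hle
  generalize √(n : ℝ) = t at *
  have ht : 0 < t := by linarith
  have e1 : t / 2 * ∫ s, ((succBefore s n : ℝ) - n) ^ 2 ∂Q ≤ t / 2 * (ν * t ^ 2 + C * t) := by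
    gcongr
  have e2 : 1 / (2 * t) * ∫ s, ((succBefore s n : ℝ) - n) ^ 4 ∂Q ≤ 1 / (2 * t) * (C * (t ^ 2) ^ 2) := by
    gcongr
  have e3 : 1 / (2 * t) * (C * (t ^ 2) ^ 2) = C / 2 * t ^ 3 := by field_simp
  have e4 : C * t ^ 2 ≤ C * t ^ 3 := by
    gcongr
    norm_num
  nlinarith

lemma one_le_log_add_three (n : ℝ) (hn : 0 ≤ n) : 1 ≤ Real.log (n + 3) := by
  rw [Real.le_log_iff_exp_le (by linarith)]
  linarith [Real.exp_one_lt_d9]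

lemma SiteBounds.integrable_of_le (h : SiteBounds Q ρ ν C c) (n : ℕ) {f : ℕ → ℝ}
    (hf : ∀ z, |f z| ≤ z + 3) : Integrable (fun s => f (succBefore s n)) Q := by
  have h1 := (h.integrable_sub n).add (integrable_const ((n : ℝ) + 3))
  refine h1.mono' (measurable_from_top.comp (measurable_succBefore n)).aestronglyMeasurable
    (Eventually.of_forall fun s => ?_)
  simp only [Pi.add_apply, Real.norm_eq_abs]
  linarith [hf (succBefore s n)]

lemma sqrt_log_add_three_le (z : ℕ) : √(Real.log (z + 3)) ≤ z + 3 := by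
  have hz : (0 : ℝ) ≤ z := Nat.cast_nonneg z
  refine Real.sqrt_le_iff.2 ⟨by linarith, ?_⟩
  have := Real.log_le_self (show (0 : ℝ) ≤ z + 3 by linarith)
  nlinarith

lemma abs_sqrt_log_add_three_le (z : ℕ) : |√(Real.log (z + 3))| ≤ z + 3 := by
  rw [abs_of_nonneg (Real.sqrt_nonneg _)]
  exact sqrt_log_add_three_le z

lemma abs_inv_log_add_three_le (z : ℕ) : |1 / Real.log ((z : ℝ) + 3)| ≤ z + 3 := by
  have hz : (0 : ℝ) ≤ z := Nat.cast_nonneg z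
  have h1 := one_le_log_add_three z hz
  rw [abs_of_nonneg (by positivity), div_le_iff₀ (by linarith)]
  nlinarith

lemma exists_integral_sqrt_log_le (hν : 0 < ν) (hC : 0 ≤ C) (hρ : ρ ≤ ν / 2) :
    ∃ n₀ : ℕ, 1 ≤ n₀ ∧ ∀ (Q : Measure (ℕ → Bool)) [IsProbabilityMeasure Q],
      SiteBounds Q ρ ν C c → ∀ n ≥ n₀,
        ∫ s, √(Real.log (succBefore s n + 3)) ∂Q ≤ √(Real.log (n + 3)) := by
  obtain ⟨n₀, hn₀⟩ := ((eventually_log_le_mul_sqrt (show 0 < ν / (4 * (6 * C + 2 * ν)) by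
    positivity)).and (eventually_ge_atTop 1)).exists_forall_of_atTop
  refine ⟨n₀, (hn₀ n₀ le_rfl).2, fun Q _ h n hn => ?_⟩
  obtain ⟨hlog, hn1⟩ := hn₀ n hn
  have hn' : (1 : ℝ) ≤ n := by exact_mod_cast hn1
  have hs1 : 1 ≤ √(n : ℝ) := Real.one_le_sqrt.2 hn'
  have hsq : √(n : ℝ) ^ 2 = n := Real.sq_sqrt (by linarith)
  obtain ⟨L, hL⟩ : ∃ L, L = Real.log ((n : ℝ) + 3) := ⟨_, rfl⟩
  obtain ⟨m, hm⟩ : ∃ m : ℝ, m = n + 3 := ⟨_, rfl⟩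
  have hL1 : 1 ≤ L := hL ▸ one_le_log_add_three n (by linarith)
  have hm0 : 0 < m := by linarith
  rw [← hL] at hlog ⊢
  have h2 := (abs_le.1 (h.second n hn1)).1
  have hdrift := drift_sqrt_log_nonpos (m := m) hs1 (by rw [hsq]; exact hm) hL1 hν hC hρ
    (a1 := ∫ s, ((succBefore s n : ℝ) - n) ∂Q) (a2 := ∫ s, ((succBefore s n : ℝ) - n) ^ 2 ∂Q)
    (by linarith [(abs_le.1 (h.first n hn1)).2]) (by rw [hsq]; linarith) (h.third hC hn1) (by
      calc _ ≤ 4 * (6 * C + 2 * ν) * (ν / (4 * (6 * C + 2 * ν)) * √(n : ℝ)) := by gcongr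
        _ = ν * √(n : ℝ) := by field_simp)
  have i1 := (h.integrable_sub n).div_const m
  have i2 := ((h.integrable_sq n).div_const (m ^ 2)).div_const 2
  have i2' := ((h.integrable_sq n).div_const (m ^ 2)).div_const (4 * L)
  have i3 := (h.integrable_abs_pow n (k := 3) (by norm_num)).div_const (m ^ 3)
  have hI : Integrable (fun s => ((succBefore s n : ℝ) - n) / m
      - ((succBefore s n : ℝ) - n) ^ 2 / m ^ 2 / 2
      - ((succBefore s n : ℝ) - n) ^ 2 / m ^ 2 / (4 * L)
      + |(succBefore s n : ℝ) - n| ^ 3 / m ^ 3) Q := ((i1.sub i2).sub i2').add i3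
  have hle : ∀ s, √(Real.log (succBefore s n + 3)) ≤ √L * (1 + ((succBefore s n - (n : ℝ)) / m
      - ((succBefore s n : ℝ) - n) ^ 2 / m ^ 2 / 2
      - ((succBefore s n : ℝ) - n) ^ 2 / m ^ 2 / (4 * L)
      + |(succBefore s n : ℝ) - n| ^ 3 / m ^ 3) / (2 * L)) := by
    intro s
    have hF : (0 : ℝ) ≤ succBefore s n := Nat.cast_nonneg _
    have e : m * (1 + ((succBefore s n : ℝ) - n) / m) = succBefore s n + 3 := by
      field_simp
      rw [hm]
      ring
    have := sqrt_log_le (u := ((succBefore s n : ℝ) - n) / m) hm0 (hm ▸ hL) hL1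
      (by rw [e]; linarith)
    rw [e, div_pow, abs_div, div_pow, abs_of_pos hm0] at this
    exact this
  calc ∫ s, √(Real.log (succBefore s n + 3)) ∂Q
      ≤ ∫ s, √L * (1 + ((succBefore s n - (n : ℝ)) / m
        - ((succBefore s n : ℝ) - n) ^ 2 / m ^ 2 / 2
        - ((succBefore s n : ℝ) - n) ^ 2 / m ^ 2 / (4 * L)
        + |(succBefore s n : ℝ) - n| ^ 3 / m ^ 3) / (2 * L)) ∂Q :=
        integral_mono (h.integrable_of_le n abs_sqrt_log_add_three_le)
          (((integrable_const 1).add (hI.div_const (2 * L))).const_mul √L) hle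
    _ = √L * (1 + ((∫ s, ((succBefore s n : ℝ) - n) ∂Q) / m
        - (∫ s, ((succBefore s n : ℝ) - n) ^ 2 ∂Q) / m ^ 2 / 2
        - (∫ s, ((succBefore s n : ℝ) - n) ^ 2 ∂Q) / m ^ 2 / (4 * L)
        + (∫ s, |(succBefore s n : ℝ) - n| ^ 3 ∂Q) / m ^ 3) / (2 * L)) := by
      rw [integral_const_mul, integral_add (integrable_const 1) (hI.div_const (2 * L)),
        integral_div]
      have := integral_add ((i1.sub i2).sub i2') i3
      simp only [Pi.sub_apply] at this
      rw [this]
      have := integral_sub (i1.sub i2) i2'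
      simp only [Pi.sub_apply] at this
      rw [this, integral_sub i1 i2]
      simp only [integral_div]
      simp
    _ ≤ √L * (1 + 0 / (2 * L)) := by gcongr
    _ = √L := by simp

lemma exists_integral_inv_log_le (hν : 0 < ν) (hC : 0 ≤ C) (hρ : ν / 2 < ρ) :
    ∃ n₀ : ℕ, ∀ (Q : Measure (ℕ → Bool)) [IsProbabilityMeasure Q],
      SiteBounds Q ρ ν C c → ∀ n ≥ n₀,
        ∫ s, 1 / Real.log (succBefore s n + 3) ∂Q ≤ 1 / Real.log (n + 3) := by
  obtain ⟨κ, hκ⟩ : ∃ κ, κ = (ρ - ν / 2) / 4 := ⟨_, rfl⟩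
  have hκ0 : 0 < κ := by rw [hκ]; linarith
  have hsq_tend : Tendsto (fun n : ℕ => √(n : ℝ)) atTop atTop :=
    Real.tendsto_sqrt_atTop.comp tendsto_natCast_atTop_atTop
  have hlog_tend : Tendsto (fun n : ℕ => Real.log ((n : ℝ) + 3)) atTop atTop :=
    Real.tendsto_log_atTop.comp
      (tendsto_atTop_add_const_right _ _ tendsto_natCast_atTop_atTop)
  have hε : 0 < √(κ / (16 * C + 1)) := by positivity
  obtain ⟨n₀, hn₀⟩ := ((((eventually_log_le_mul_sqrt hε).and (eventually_ge_atTop 1)).and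
    (hsq_tend.eventually_ge_atTop ((7 * C + ν) / κ))).and
    ((hlog_tend.eventually_ge_atTop (8 * (ν + C) / κ)).and
      (hlog_tend.eventually_ge_atTop 2))).exists_forall_of_atTop
  refine ⟨n₀, fun Q _ h n hn => ?_⟩
  obtain ⟨⟨⟨hlog, hn1⟩, hs2⟩, hL3, hL2⟩ := hn₀ n hn
  have hn' : (1 : ℝ) ≤ n := by exact_mod_cast hn1
  have hs1 : 1 ≤ √(n : ℝ) := Real.one_le_sqrt.2 hn'
  have hsq : √(n : ℝ) ^ 2 = n := Real.sq_sqrt (by linarith)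
  obtain ⟨L, hL⟩ : ∃ L, L = Real.log ((n : ℝ) + 3) := ⟨_, rfl⟩
  obtain ⟨m, hm⟩ : ∃ m : ℝ, m = n + 3 := ⟨_, rfl⟩
  have hm0 : 0 < m := by linarith
  rw [← hL] at hlog hL3 hL2 ⊢
  have hL0 : 0 < L := by linarith
  rw [div_le_iff₀ hκ0] at hs2 hL3
  have h2 := (abs_le.1 (h.second n hn1)).2
  have h4 := h.fourth n hn1
  have hdrift := drift_inv_log_nonpos (m := m) hs1 (by rw [hsq]; exact hm) (by linarith : 1 ≤ L) hν hC
    (by linarith : 0 < ρ)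
    (a1 := ∫ s, ((succBefore s n : ℝ) - n) ∂Q) (a2 := ∫ s, ((succBefore s n : ℝ) - n) ^ 2 ∂Q)
    (a4 := ∫ s, ((succBefore s n : ℝ) - n) ^ 4 ∂Q)
    (by linarith [(abs_le.1 (h.first n hn1)).1]) (by rw [hsq]; linarith) (h.third hC hn1)
    (by rw [show √(n : ℝ) ^ 4 = (√(n : ℝ) ^ 2) ^ 2 by ring, hsq]; exact h4)
    (by rw [← hκ]; nlinarith) (by rw [← hκ]; linarith) (by
      rw [← hκ]
      have h5 : L ^ 2 ≤ κ / (16 * C + 1) * √(n : ℝ) ^ 2 := by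
        calc L ^ 2 ≤ (√(κ / (16 * C + 1)) * √(n : ℝ)) ^ 2 := by gcongr
          _ = κ / (16 * C + 1) * √(n : ℝ) ^ 2 := by
            rw [mul_pow, Real.sq_sqrt (by positivity)]
      have h6 : (16 * C + 1) * L ^ 2 ≤ κ * √(n : ℝ) ^ 2 := by
        calc (16 * C + 1) * L ^ 2 ≤ (16 * C + 1) * (κ / (16 * C + 1) * √(n : ℝ) ^ 2) := by gcongr
          _ = κ * √(n : ℝ) ^ 2 := by field_simp
      nlinarith [sq_nonneg L])
  have i1 := ((h.integrable_sub n).div_const m).neg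
  have i2 := ((h.integrable_sq n).div_const (m ^ 2)).div_const 2
  have i3 := ((h.integrable_abs_pow n (k := 3) (by norm_num)).div_const (m ^ 3)).const_mul 2
  have i2' := (((h.integrable_sq n).div_const (m ^ 2)).const_mul 8).div_const L
  have i4 := ((h.integrable n).div_const (m ^ 4)).const_mul (16 * L ^ 2)
  have hI : Integrable (fun s => -((succBefore s n - (n : ℝ)) / m)
      + ((succBefore s n : ℝ) - n) ^ 2 / m ^ 2 / 2 + 2 * (|(succBefore s n : ℝ) - n| ^ 3 / m ^ 3)
      + 8 * (((succBefore s n : ℝ) - n) ^ 2 / m ^ 2) / L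
      + 16 * L ^ 2 * (((succBefore s n : ℝ) - n) ^ 4 / m ^ 4)) Q :=
    (((i1.add i2).add i3).add i2').add i4
  have hle : ∀ s, 1 / Real.log (succBefore s n + 3) ≤ 1 / L + (-((succBefore s n - (n : ℝ)) / m)
      + ((succBefore s n : ℝ) - n) ^ 2 / m ^ 2 / 2 + 2 * (|(succBefore s n : ℝ) - n| ^ 3 / m ^ 3)
      + 8 * (((succBefore s n : ℝ) - n) ^ 2 / m ^ 2) / L
      + 16 * L ^ 2 * (((succBefore s n : ℝ) - n) ^ 4 / m ^ 4)) / L ^ 2 := by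
    intro s
    have hF : (0 : ℝ) ≤ succBefore s n := Nat.cast_nonneg _
    have e : m * (1 + ((succBefore s n : ℝ) - n) / m) = succBefore s n + 3 := by
      field_simp
      rw [hm]
      ring
    have := inv_log_le (u := ((succBefore s n : ℝ) - n) / m) hm0 (hm ▸ hL) hL2
      (by rw [e]; linarith)
    rw [e, div_pow, abs_div, div_pow, abs_of_pos hm0, div_pow] at this
    exact this
  calc ∫ s, 1 / Real.log (succBefore s n + 3) ∂Q
      ≤ ∫ s, (1 / L + (-((succBefore s n - (n : ℝ)) / m)
      + ((succBefore s n : ℝ) - n) ^ 2 / m ^ 2 / 2 + 2 * (|(succBefore s n : ℝ) - n| ^ 3 / m ^ 3)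
      + 8 * (((succBefore s n : ℝ) - n) ^ 2 / m ^ 2) / L
      + 16 * L ^ 2 * (((succBefore s n : ℝ) - n) ^ 4 / m ^ 4)) / L ^ 2) ∂Q :=
        integral_mono (h.integrable_of_le n abs_inv_log_add_three_le)
          ((integrable_const (1 / L)).add (hI.div_const (L ^ 2))) hle
    _ = 1 / L + (-((∫ s, ((succBefore s n : ℝ) - n) ∂Q) / m)
        + (∫ s, ((succBefore s n : ℝ) - n) ^ 2 ∂Q) / m ^ 2 / 2
        + 2 * ((∫ s, |(succBefore s n : ℝ) - n| ^ 3 ∂Q) / m ^ 3)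
        + 8 * ((∫ s, ((succBefore s n : ℝ) - n) ^ 2 ∂Q) / m ^ 2) / L
        + 16 * L ^ 2 * ((∫ s, ((succBefore s n : ℝ) - n) ^ 4 ∂Q) / m ^ 4)) / L ^ 2 := by
      rw [integral_add (integrable_const _) (hI.div_const (L ^ 2)), integral_div (L ^ 2)]
      have j1 := integral_add (((i1.add i2).add i3).add i2') i4
      have j2 := integral_add ((i1.add i2).add i3) i2'
      have j3 := integral_add (i1.add i2) i3
      have j4 := integral_add i1 i2
      simp only [Pi.add_apply, Pi.neg_apply] at j1 j2 j3 j4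
      rw [j1, j2, j3, j4]
      simp only [integral_div, integral_neg, integral_const_mul]
      simp
    _ ≤ 1 / L + 0 / L ^ 2 := by gcongr
    _ = 1 / L := by simp

/-- A Lyapunov function tending to infinity for the branching chain when `ρ ≤ ν / 2`. -/
lemma exists_lyapunov_atTop (hν : 0 < ν) (hC : 0 ≤ C) (hc : 0 < c) (hc1 : c ≤ 1)
    (hρ : ρ ≤ ν / 2) :
    ∃ w : ℕ → ℝ, w 0 = 0 ∧ (∀ n, 0 ≤ w n) ∧ Tendsto w atTop atTop ∧
      ∀ (Q : Measure (ℕ → Bool)) [IsProbabilityMeasure Q], SiteBounds Q ρ ν C c →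
        ∀ n, Integrable (fun s => w (succBefore s n)) Q ∧ ∫ s, w (succBefore s n) ∂Q ≤ w n := by
  obtain ⟨n₀, hn₀, hdrift⟩ := exists_integral_sqrt_log_le (c := c) hν hC hρ
  obtain ⟨f, hf⟩ : ∃ f : ℕ → ℝ, f = fun z : ℕ => √(Real.log ((z : ℝ) + 3)) := ⟨_, rfl⟩
  have hfmono : Monotone f := by
    intro a b hab
    simp only [hf]
    have : (a : ℝ) ≤ b := by exact_mod_cast hab
    gcongr
  have hfabs : ∀ z, |f z| ≤ z + 3 := fun z => by rw [hf]; exact abs_sqrt_log_add_three_le z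
  obtain ⟨A, hA⟩ : ∃ A : ℝ, A = (n₀ + 4 + C * (n₀ : ℝ) ^ 2) / c ^ n₀ := ⟨_, rfl⟩
  have hA0 : 0 ≤ A := by rw [hA]; positivity
  obtain ⟨e, he⟩ : ∃ e : ℕ → ℝ, e = fun z => if z = 0 then 1 else 0 := ⟨_, rfl⟩
  have heabs : ∀ z : ℕ, |e z| ≤ z + 3 := by
    intro z
    have : (0 : ℝ) ≤ z := Nat.cast_nonneg z
    simp only [he]
    split_ifs <;> simp <;> linarith
  refine ⟨fun n => f n - f 0 + A * (1 - e n), ?_, ?_, ?_, fun Q _ h n => ?_⟩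
  · simp [he]
  · intro n
    have h1 := hfmono (Nat.zero_le n)
    have h2 : 0 ≤ 1 - e n := by
      simp only [he]
      split_ifs <;> simp
    have := mul_nonneg hA0 h2
    linarith
  · have hlog_tend : Tendsto f atTop atTop := by
      rw [hf]
      exact Real.tendsto_sqrt_atTop.comp (Real.tendsto_log_atTop.comp
        (tendsto_atTop_add_const_right _ _ tendsto_natCast_atTop_atTop))
    refine tendsto_atTop_mono' _ ?_ (tendsto_atTop_add_const_right _ (-f 0) hlog_tend)
    refine Eventually.of_forall fun n => ?_
    have h2 : 0 ≤ 1 - e n := by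
      simp only [he]
      split_ifs <;> simp
    have := mul_nonneg hA0 h2
    linarith
  · have hif := h.integrable_of_le n hfabs
    have hie := h.integrable_of_le n heabs
    have hi1 := hif.sub (integrable_const (f 0))
    have hi2 := ((integrable_const 1).sub hie).const_mul A
    refine ⟨hi1.add hi2, ?_⟩
    have hint : ∫ s, (f (succBefore s n) - f 0 + A * (1 - e (succBefore s n))) ∂Q
        = ∫ s, f (succBefore s n) ∂Q - f 0 + A * (1 - ∫ s, e (succBefore s n) ∂Q) := by
      have h1 := integral_add hi1 hi2
      have h2 := integral_sub hif (integrable_const (f 0))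
      have h3 := integral_sub (integrable_const (μ := Q) (1 : ℝ)) hie
      simp only [Pi.sub_apply] at h1
      rw [h1, h2, integral_const_mul, h3]
      simp
    rw [hint]
    have he0 : 0 ≤ ∫ s, e (succBefore s n) ∂Q := integral_nonneg fun s => by
      simp only [he]
      split_ifs <;> simp
    rcases Nat.eq_zero_or_pos n with rfl | hn
    · simp [succBefore_zero, he]
    · have hen : e n = 0 := by simp [he, hn.ne']
      simp only [hen]
      rcases le_or_gt n₀ n with hle | hlt
      · have h1 := hdrift Q h n hle
        have h2 : ∫ s, f (succBefore s n) ∂Q ≤ f n := by rw [hf]; exact h1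
        nlinarith [mul_nonneg hA0 he0]
      · have hn' : (1 : ℝ) ≤ n := by exact_mod_cast hn
        have hnn : (n : ℝ) ≤ n₀ := by exact_mod_cast hlt.le
        have h0 : c ^ n₀ ≤ ∫ s, e (succBefore s n) ∂Q := by
          have hm : MeasurableSet {s : ℕ → Bool | succBefore s n = 0} :=
            measurable_succBefore n (measurableSet_singleton 0)
          calc c ^ n₀ ≤ c ^ n := pow_le_pow_of_le_one hc.le hc1 hlt.le
            _ ≤ Q.real {s | succBefore s n = 0} := h.zero n
            _ = ∫ s, {s : ℕ → Bool | succBefore s n = 0}.indicator 1 s ∂Q := by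
              rw [integral_indicator_one hm]
            _ = ∫ s, e (succBefore s n) ∂Q := by
              simp only [he, Set.indicator, Set.mem_ofPred_eq, Pi.one_apply]
        have h1 : ∫ s, f (succBefore s n) ∂Q ≤ n₀ + 4 + C * (n₀ : ℝ) ^ 2 := by
          calc ∫ s, f (succBefore s n) ∂Q
              ≤ ∫ s, ((n + 4 : ℝ) + ((succBefore s n : ℝ) - n) ^ 4) ∂Q := by
                refine integral_mono hif ((integrable_const _).add (h.integrable n)) fun s => ?_
                have h1 := (le_abs_self _).trans (hfabs (succBefore s n))
                have h2 := abs_pow_le_one_add_pow_four ((succBefore s n : ℝ) - n)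
                  (show 1 ≤ 4 by norm_num)
                rw [pow_one] at h2
                have h3 := le_abs_self ((succBefore s n : ℝ) - n)
                simp only
                linarith
            _ = n + 4 + ∫ s, ((succBefore s n : ℝ) - n) ^ 4 ∂Q := by
                rw [integral_add (integrable_const _) (h.integrable n)]
                simp
            _ ≤ n₀ + 4 + C * (n₀ : ℝ) ^ 2 := by
                have h5 := h.fourth n hn
                have : C * (n : ℝ) ^ 2 ≤ C * (n₀ : ℝ) ^ 2 := by gcongr
                linarith
        have h2 : n₀ + 4 + C * (n₀ : ℝ) ^ 2 = A * c ^ n₀ := by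
          rw [hA]
          field_simp
        have h3 := mul_le_mul_of_nonneg_left h0 hA0
        have h4 : 0 ≤ f n := by rw [hf]; positivity
        linarith

/-- A bounded Lyapunov function for the branching chain when `ν / 2 < ρ`. -/
lemma exists_lyapunov_bounded (hν : 0 < ν) (hC : 0 ≤ C) (hρ : ν / 2 < ρ) :
    ∃ (g : ℕ → ℝ) (M : ℕ), (∀ n, 0 ≤ g n) ∧ (∀ n, g n ≤ 1) ∧ g 0 = 1 ∧ g M < 1 ∧
      ∀ (Q : Measure (ℕ → Bool)) [IsProbabilityMeasure Q], SiteBounds Q ρ ν C c →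
        (∀ n, ∫ s, g (succBefore s n) ∂Q ≤ g n) ∧
        ∫ s, g (succBefore s 1) ∂Q ≤ 1 - (1 - g M) * c ^ M := by
  obtain ⟨n₀, hdrift⟩ := exists_integral_inv_log_le (c := c) hν hC hρ
  obtain ⟨f, hf⟩ : ∃ f : ℕ → ℝ, f = fun z : ℕ => 1 / Real.log ((z : ℝ) + 3) := ⟨_, rfl⟩
  have hlog : ∀ z : ℕ, 1 ≤ Real.log ((z : ℝ) + 3) := fun z =>
    one_le_log_add_three z (Nat.cast_nonneg z)
  have hf0 : ∀ z, 0 < f z := by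
    intro z
    have := hlog z
    rw [hf]
    positivity
  have hfanti : StrictAnti f := by
    intro a b hab
    have h1 := hlog a
    have : (a : ℝ) < b := by exact_mod_cast hab
    simp only [hf]
    gcongr
  have hfabs : ∀ z, |f z| ≤ z + 3 := fun z => by rw [hf]; exact abs_inv_log_add_three_le z
  obtain ⟨g, hg⟩ : ∃ g : ℕ → ℝ, g = fun z => min 1 (f z / f n₀) := ⟨_, rfl⟩
  have hg0 : ∀ n, 0 ≤ g n := fun n => by
    rw [hg]
    exact le_min zero_le_one (div_nonneg (hf0 n).le (hf0 n₀).le)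
  have hg1 : ∀ n, g n ≤ 1 := fun n => by rw [hg]; exact min_le_left _ _
  have hganti : Antitone g := by
    intro a b hab
    rw [hg]
    exact min_le_min_left 1 (div_le_div_of_nonneg_right (hfanti.antitone hab) (hf0 n₀).le)
  have hgone : ∀ n ≤ n₀, g n = 1 := by
    intro n hn
    rw [hg]
    refine min_eq_left ?_
    rw [le_div_iff₀ (hf0 n₀), one_mul]
    exact hfanti.antitone hn
  have hgM : g (n₀ + 1) < 1 := by
    rw [hg]
    refine min_lt_of_right_lt ?_
    rw [div_lt_one (hf0 n₀)]
    exact hfanti (Nat.lt_succ_self n₀)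
  refine ⟨g, n₀ + 1, hg0, hg1, hgone 0 (Nat.zero_le _), hgM, fun Q _ h => ?_⟩
  have hgi : ∀ n, Integrable (fun s => g (succBefore s n)) Q := fun n =>
    h.integrable_of_le n fun z => by
      have : (0 : ℝ) ≤ z := Nat.cast_nonneg z
      rw [abs_of_nonneg (hg0 z)]
      linarith [hg1 z]
  refine ⟨fun n => ?_, ?_⟩
  · rcases le_total n n₀ with hn | hn
    · rw [hgone n hn]
      calc ∫ s, g (succBefore s n) ∂Q ≤ ∫ _, (1 : ℝ) ∂Q :=
            integral_mono (hgi n) (integrable_const 1) fun s => hg1 _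
        _ = 1 := by simp
    · calc ∫ s, g (succBefore s n) ∂Q ≤ ∫ s, f (succBefore s n) / f n₀ ∂Q :=
            integral_mono (hgi n) ((h.integrable_of_le n hfabs).div_const _) fun s => by
              simp only [hg]
              exact min_le_right _ _
        _ = (∫ s, f (succBefore s n) ∂Q) / f n₀ := integral_div _ _
        _ ≤ f n / f n₀ := by
            refine div_le_div_of_nonneg_right ?_ (hf0 n₀).le
            rw [hf]
            exact hdrift Q h n hn
        _ = g n := by
            simp only [hg]
            refine (min_eq_right ?_).symm
            rw [div_le_one (hf0 n₀)]
            exact hfanti.antitone hn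
  · have hm : MeasurableSet {s : ℕ → Bool | n₀ + 1 ≤ succBefore s 1} :=
      measurable_succBefore 1 measurableSet_Ici
    have hind : Integrable ({s : ℕ → Bool | n₀ + 1 ≤ succBefore s 1}.indicator (1 : (ℕ → Bool) → ℝ)) Q :=
      (integrable_const (1 : ℝ)).indicator hm
    calc ∫ s, g (succBefore s 1) ∂Q
        ≤ ∫ s, (1 - (1 - g (n₀ + 1))
          * {s : ℕ → Bool | n₀ + 1 ≤ succBefore s 1}.indicator (1 : (ℕ → Bool) → ℝ) s) ∂Q := by
          refine integral_mono (hgi 1) ((integrable_const 1).sub (hind.const_mul _)) fun s => ?_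
          by_cases hs : n₀ + 1 ≤ succBefore s 1
          · simp only [Set.indicator, Set.mem_ofPred_eq, if_pos hs, Pi.one_apply]
            linarith [hganti hs]
          · simp only [Set.indicator, Set.mem_ofPred_eq, if_neg hs]
            linarith [hg1 (succBefore s 1)]
      _ = 1 - (1 - g (n₀ + 1)) * Q.real {s | n₀ + 1 ≤ succBefore s 1} := by
          rw [integral_sub (integrable_const 1) (hind.const_mul _), integral_const_mul,
            integral_indicator_one hm]
          simp
      _ ≤ 1 - (1 - g (n₀ + 1)) * c ^ (n₀ + 1) := by
          have := mul_le_mul_of_nonneg_left (h.large (n₀ + 1)) (show 0 ≤ 1 - g (n₀ + 1) by linarith)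
          linarith

end Lyapunov

section WalkCombinatorics

variable {s : ℕ → Bool}

/-- The number of successes among the first `t` tosses. -/
def succCount (s : ℕ → Bool) (t : ℕ) : ℕ := Nat.count (fun j => s j = true) t

lemma succCount_succ (t : ℕ) :
    succCount s (t + 1) = succCount s t + if s t = true then 1 else 0 := Nat.count_succ _ _

lemma succCount_add_failCount (t : ℕ) : succCount s t + failCount s t = t := by
  induction t with
  | zero => simp [succCount, failCount_zero]
  | succ t ih =>
    rw [succCount_succ, failCount_succ]
    cases s t <;> simp <;> omega

lemma succCount_mono : Monotone (succCount s) := Nat.count_monotone _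

lemma failCount_le_add (t k : ℕ) : failCount s (t + k) ≤ failCount s t + k := by
  induction k with
  | zero => simp
  | succ k ih =>
    rw [← add_assoc, failCount_succ]
    split_ifs <;> omega

lemma InfFail.le_failCount (h : InfFail s) (n : ℕ) : n ≤ failCount s (n + succBefore s n) :=
  Nat.sInf_mem (h.nonempty n)

lemma succBefore_failCount_le (t : ℕ) : succBefore s (failCount s t) ≤ succCount s t := by
  refine Nat.sInf_le ?_
  rw [Set.mem_ofPred_eq, add_comm, succCount_add_failCount]

lemma InfFail.succCount_le (h : InfFail s) (t : ℕ) :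
    succCount s t ≤ succBefore s (failCount s t + 1) := by
  have h1 := h.le_failCount (failCount s t + 1)
  by_contra! h2
  have h3 := succCount_add_failCount (s := s) t
  have := failCount_mono (s := s)
    (show failCount s t + 1 + succBefore s (failCount s t + 1) ≤ t by omega)
  omega

lemma InfFail.succBefore_mono (h : InfFail s) : Monotone (succBefore s) := by
  intro n m hnm
  refine Nat.sInf_le ?_
  have h1 := h.le_failCount m
  have h2 := failCount_le_add (s := s) (n + succBefore s m) (m - n)
  rw [show n + succBefore s m + (m - n) = m + succBefore s m by omega] at h2
  rw [Set.mem_ofPred_eq]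
  omega

/-- The chain `V_{k+1}` = number of successes before the `V_k`-th failure at site `a + 1 + k`. -/
def branch (ξ : ℤ → ℕ → Bool) (a : ℤ) (n : ℕ) : ℕ → ℕ
  | 0 => n
  | k + 1 => succBefore (ξ (a + 1 + k)) (branch ξ a n k)

variable (ξ : ℤ → ℕ → Bool)

/-- The number of visits of the walk to `x` strictly before time `k`. -/
def visitCount (x : ℤ) (k : ℕ) : ℕ := (walkHist ξ k).tail.count x

/-- The number of steps of the walk from `x` to the right before time `k`. -/
def upCount (x : ℤ) (k : ℕ) : ℕ := succCount (ξ x) (visitCount ξ x k)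

/-- The number of steps of the walk from `x` to the left before time `k`. -/
def downCount (x : ℤ) (k : ℕ) : ℕ := failCount (ξ x) (visitCount ξ x k)

lemma walk_zero : walk ξ 0 = 0 := rfl

lemma walkHist_eq_cons (k : ℕ) : walkHist ξ k = walk ξ k :: (walkHist ξ k).tail := by
  cases k <;> rfl

lemma walk_succ (k : ℕ) : walk ξ (k + 1)
    = walk ξ k + if ξ (walk ξ k) (visitCount ξ (walk ξ k) k) then 1 else -1 := rfl

lemma visitCount_zero (x : ℤ) : visitCount ξ x 0 = 0 := rfl

lemma visitCount_succ (x : ℤ) (k : ℕ) :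
    visitCount ξ x (k + 1) = visitCount ξ x k + if walk ξ k = x then 1 else 0 := by
  have : (walkHist ξ (k + 1)).tail = walkHist ξ k := rfl
  rw [visitCount, this, walkHist_eq_cons, List.count_cons]
  simp [visitCount]

lemma visitCount_mono (x : ℤ) : Monotone (visitCount ξ x) :=
  monotone_nat_of_le_succ fun k => by rw [visitCount_succ]; omega

lemma upCount_mono (x : ℤ) : Monotone (upCount ξ x) :=
  fun _ _ h => succCount_mono (visitCount_mono ξ x h)

lemma upCount_succ (x : ℤ) (k : ℕ) : upCount ξ x (k + 1)
    = upCount ξ x k + if walk ξ k = x ∧ walk ξ (k + 1) = x + 1 then 1 else 0 := by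
  rw [upCount, upCount, visitCount_succ, walk_succ]
  by_cases h : walk ξ k = x
  · subst h
    simp only [if_true, succCount_succ, true_and]
    cases ξ (walk ξ k) (visitCount ξ (walk ξ k) k) <;> simp
  · simp [h]

lemma downCount_succ (x : ℤ) (k : ℕ) : downCount ξ x (k + 1)
    = downCount ξ x k + if walk ξ k = x ∧ walk ξ (k + 1) = x - 1 then 1 else 0 := by
  rw [downCount, downCount, visitCount_succ, walk_succ]
  by_cases h : walk ξ k = x
  · subst h
    simp only [if_true, failCount_succ, true_and]
    cases ξ (walk ξ k) (visitCount ξ (walk ξ k) k) <;> simp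
    · rfl
    · omega
  · simp [h]

lemma walk_succ_cases (k : ℕ) :
    walk ξ (k + 1) = walk ξ k + 1 ∨ walk ξ (k + 1) = walk ξ k - 1 := by
  rw [walk_succ]
  split_ifs
  · exact Or.inl rfl
  · exact Or.inr rfl

lemma walk_le (k : ℕ) : walk ξ k ≤ k := by
  induction k with
  | zero => simp [walk_zero]
  | succ k ih =>
    push_cast
    rcases walk_succ_cases ξ k with h | h <;> omega

lemma visitCount_eq_zero {x : ℤ} {k : ℕ} (h : (k : ℤ) ≤ x) : visitCount ξ x k = 0 := by
  induction k with
  | zero => rfl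
  | succ k ih =>
    push_cast at h
    rw [visitCount_succ, ih (by omega), if_neg]
    have := walk_le ξ k
    omega

/-- The steps across an edge on the positive side alternate between right and left. -/
lemma upCount_eq {x : ℤ} (hx : 0 ≤ x) (k : ℕ) :
    upCount ξ x k = downCount ξ (x + 1) k + if x < walk ξ k then 1 else 0 := by
  induction k with
  | zero =>
    simp [upCount, downCount, visitCount_zero, succCount, failCount_zero, walk_zero, hx.not_gt]
  | succ k ih =>
    rw [upCount_succ, downCount_succ, ih]
    rcases walk_succ_cases ξ k with h | h <;> rw [h] <;> split_ifs <;> omega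

variable {ξ}

lemma upCount_le_branch (hξ : ∀ x, InfFail (ξ x)) {n T : ℕ} (hn : upCount ξ 0 T ≤ n) (k : ℕ)
    (hk : (k : ℤ) ≤ walk ξ T) : upCount ξ k T ≤ branch ξ 0 n k := by
  induction k with
  | zero => exact hn
  | succ k ih =>
    push_cast at hk ⊢
    have h1 := ih (by omega)
    rw [upCount_eq ξ (by omega), if_pos (by omega)] at h1
    have h2 := (hξ (k + 1)).succCount_le (visitCount ξ (k + 1) T)
    rw [branch, show (0 : ℤ) + 1 + k = k + 1 by ring]
    exact h2.trans ((hξ _).succBefore_mono h1)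

lemma branch_le_upCount (hξ : ∀ x, InfFail (ξ x)) {a : ℤ} (ha : 0 ≤ a) {T : ℕ}
    (h1 : 1 ≤ upCount ξ a T) (hT : walk ξ T ≤ a) (k : ℕ) :
    branch ξ a 1 k ≤ upCount ξ (a + k) T := by
  induction k with
  | zero => simpa [branch] using h1
  | succ k ih =>
    rw [upCount_eq ξ (by omega), if_neg (by omega), add_zero] at ih
    rw [branch]
    have h2 := succBefore_failCount_le (s := ξ (a + 1 + k)) (visitCount ξ (a + 1 + k) T)
    push_cast
    rw [show a + (k + 1 : ℤ) = a + 1 + k by ring]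
    rw [show a + (k : ℤ) + 1 = a + 1 + k by ring] at ih
    exact ((hξ _).succBefore_mono ih).trans h2

lemma exists_branch_ne_zero (hξ : ∀ x, InfFail (ξ x)) (h : Tendsto (walk ξ) atTop atTop) :
    ∃ n, ∀ k, branch ξ 0 n k ≠ 0 := by
  obtain ⟨T₀, hT₀⟩ := (h.eventually_gt_atTop 0).exists_forall_of_atTop
  have hv : ∀ j, visitCount ξ 0 (T₀ + j) = visitCount ξ 0 T₀ := by
    intro j
    induction j with
    | zero => rfl
    | succ j ih =>
      rw [← add_assoc, visitCount_succ, ih, if_neg, add_zero]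
      exact (hT₀ (T₀ + j) (by omega)).ne'
  refine ⟨upCount ξ 0 T₀, fun k => ?_⟩
  obtain ⟨T, hT, hT'⟩ := ((h.eventually_gt_atTop (k : ℤ)).and (eventually_ge_atTop T₀)).exists
  obtain ⟨j, rfl⟩ := Nat.exists_eq_add_of_le hT'
  have h1 := upCount_le_branch hξ (n := upCount ξ 0 T₀) (T := T₀ + j)
    (by rw [upCount, upCount, hv]) k hT.le
  have h2 := upCount_eq ξ (show (0 : ℤ) ≤ k by omega) (T₀ + j)
  rw [if_pos hT] at h2
  omega

lemma lt_walk_of_branch_ne_zero (hξ : ∀ x, InfFail (ξ x)) {a : ℤ} (ha : 0 ≤ a)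
    (hs : ∀ k, branch ξ a 1 k ≠ 0) {T₀ T : ℕ} (hT₀ : a < walk ξ T₀) (hT : T₀ ≤ T) :
    a < walk ξ T := by
  by_contra! h
  have h1 := upCount_eq ξ ha T₀
  rw [if_pos hT₀] at h1
  have h2 := upCount_mono ξ a hT
  have h3 := branch_le_upCount hξ ha (by omega) h T
  rw [upCount, visitCount_eq_zero ξ (by omega)] at h3
  exact hs T (Nat.le_zero.1 h3)

/-- `s` has infinitely many successes. -/
def InfSucc (s : ℕ → Bool) : Prop := ∀ n, ∃ t, n ≤ succCount s t

lemma frequently_step_of_frequently {x : ℤ} (hf : InfFail (ξ x)) (hs : InfSucc (ξ x))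
    (h : ∃ᶠ k in atTop, walk ξ k = x) :
    (∃ᶠ k in atTop, walk ξ k = x + 1) ∧ ∃ᶠ k in atTop, walk ξ k = x - 1 := by
  have hv : ∀ n, ∃ k, n ≤ visitCount ξ x k := by
    intro n
    induction n with
    | zero => exact ⟨0, Nat.zero_le _⟩
    | succ n ih =>
      obtain ⟨k, hk⟩ := ih
      obtain ⟨j, hj, hx⟩ := frequently_atTop.1 h k
      refine ⟨j + 1, ?_⟩
      rw [visitCount_succ, if_pos hx]
      have := visitCount_mono ξ x hj
      omega
  constructor
  · rw [frequently_atTop]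
    intro m
    by_contra! hm
    have hc : ∀ j, upCount ξ x (m + j) = upCount ξ x m := by
      intro j
      induction j with
      | zero => rfl
      | succ j ih =>
        rw [← add_assoc, upCount_succ, ih, if_neg, add_zero]
        exact fun (h : walk ξ (m + j) = x ∧ _) => hm (m + j + 1) (by omega) h.2
    obtain ⟨t, ht⟩ := hs (upCount ξ x m + 1)
    obtain ⟨k, hk⟩ := hv t
    have h1 := succCount_mono (s := ξ x) (hk.trans (visitCount_mono ξ x (Nat.le_add_left k m)))
    have h2 := hc k
    rw [upCount] at h2
    omega
  · rw [frequently_atTop]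
    intro m
    by_contra! hm
    have hc : ∀ j, downCount ξ x (m + j) = downCount ξ x m := by
      intro j
      induction j with
      | zero => rfl
      | succ j ih =>
        rw [← add_assoc, downCount_succ, ih, if_neg, add_zero]
        exact fun (h : walk ξ (m + j) = x ∧ _) => hm (m + j + 1) (by omega) h.2
    obtain ⟨t, ht⟩ := hf (downCount ξ x m + 1)
    obtain ⟨k, hk⟩ := hv t
    have h1 := failCount_mono (s := ξ x) (hk.trans (visitCount_mono ξ x (Nat.le_add_left k m)))
    have h2 := hc k
    rw [downCount] at h2
    omega

lemma walk_trichotomy (hf : ∀ x, InfFail (ξ x)) (hs : ∀ x, InfSucc (ξ x)) :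
    Tendsto (walk ξ) atTop atTop ∨ Tendsto (walk ξ) atTop atBot ∨
      ((∀ M : ℤ, ∃ᶠ k in atTop, M ≤ walk ξ k) ∧ ∀ M : ℤ, ∃ᶠ k in atTop, walk ξ k ≤ M) := by
  by_cases h : ∃ x, ∃ᶠ k in atTop, walk ξ k = x
  · obtain ⟨x, hx⟩ := h
    have hall : ∀ y, ∃ᶠ k in atTop, walk ξ k = y := by
      intro y
      induction y using Int.inductionOn' (b := x) with
      | zero => exact hx
      | succ k _ ih => exact (frequently_step_of_frequently (hf k) (hs k) ih).1
      | pred k _ ih => exact (frequently_step_of_frequently (hf k) (hs k) ih).2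
    exact Or.inr (Or.inr ⟨fun M => (hall M).mono fun _ h => h.ge,
      fun M => (hall M).mono fun _ h => h.le⟩)
  · push Not at h
    obtain ⟨T, hT⟩ := (h 0).exists_forall_of_atTop
    rcases lt_or_gt_of_ne (hT T le_rfl) with h0 | h0
    · right; left
      have hneg : ∀ j, walk ξ (T + j) < 0 := by
        intro j
        induction j with
        | zero => exact h0
        | succ j ih =>
          have h1 := hT (T + j + 1) (by omega)
          rw [← add_assoc]
          rcases walk_succ_cases ξ (T + j) with h2 | h2 <;> omega
      refine tendsto_atBot.2 fun M => ?_
      have h1 : ∀ᶠ k in atTop, ∀ y ∈ Finset.Icc M 0, walk ξ k ≠ y :=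
        (Filter.eventually_all_finset _).2 fun y _ => h y
      filter_upwards [h1, eventually_ge_atTop T] with k hk hkT
      obtain ⟨j, rfl⟩ := Nat.exists_eq_add_of_le hkT
      by_contra! h2
      exact hk _ (Finset.mem_Icc.2 ⟨h2.le, (hneg j).le⟩) rfl
    · left
      have hpos : ∀ j, 0 < walk ξ (T + j) := by
        intro j
        induction j with
        | zero => exact h0
        | succ j ih =>
          have h1 := hT (T + j + 1) (by omega)
          rw [← add_assoc]
          rcases walk_succ_cases ξ (T + j) with h2 | h2 <;> omega
      refine tendsto_atTop.2 fun M => ?_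
      have h1 : ∀ᶠ k in atTop, ∀ y ∈ Finset.Icc 0 M, walk ξ k ≠ y :=
        (Filter.eventually_all_finset _).2 fun y _ => h y
      filter_upwards [h1, eventually_ge_atTop T] with k hk hkT
      obtain ⟨j, rfl⟩ := Nat.exists_eq_add_of_le hkT
      by_contra! h2
      exact hk _ (Finset.mem_Icc.2 ⟨(hpos j).le, h2.le⟩) rfl

/-- The environment seen in the mirror. -/
def reflect (ξ : ℤ → ℕ → Bool) (x : ℤ) (j : ℕ) : Bool := !ξ (-x) j

lemma walkHist_reflect (k : ℕ) :
    walkHist (reflect ξ) k = (walkHist ξ k).map fun x => -x := by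
  induction k with
  | zero => rfl
  | succ k ih =>
    obtain ⟨l, hl⟩ : ∃ l, l = (walkHist ξ k).tail := ⟨_, rfl⟩
    have h0 := walkHist_eq_cons ξ k
    rw [← hl] at h0
    have hc : (l.map fun x => -x).count (-walk ξ k) = l.count (walk ξ k) :=
      List.count_map_of_injective l _ neg_injective _
    simp only [walkHist, ih, h0, List.map_cons, List.headI, List.tail, hc, reflect, neg_neg]
    cases ξ (walk ξ k) (l.count (walk ξ k)) <;> simp <;> omega

lemma walk_reflect (k : ℕ) : walk (reflect ξ) k = -walk ξ k := by
  rw [walk, walkHist_reflect, walkHist_eq_cons]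
  rfl

lemma infFail_reflect_iff {x : ℤ} : InfFail (reflect ξ x) ↔ InfSucc (ξ (-x)) := by
  have : ∀ t, failCount (reflect ξ x) t = succCount (ξ (-x)) t := by
    intro t
    simp [failCount, succCount, reflect]
  simp only [InfFail, InfSucc, this]

end WalkCombinatorics

section Environment

variable {N : ℕ} {K : Matrix (Fin N) (Fin N) ℝ} {p η : Fin N → ℝ}
  {Ω : Type*} [MeasurableSpace Ω] {P : Measure Ω}
  {Rc : ℤ → ℕ → Ω → Fin N} {ξ : ℤ → ℕ → Ω → Bool}

lemma IsCookieEnv.measureReal_eq_prod (henv : IsCookieEnv P K p η Rc ξ) (S : Finset ℤ) (m : ℕ)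
    (f : ℤ → ℕ → Fin N) (b : ℤ → ℕ → Bool) :
    P.real {ω | ∀ x ∈ S, ∀ j ≤ m, Rc x j ω = f x j ∧ ξ x j ω = b x j}
      = ∏ x ∈ S, P.real {ω | ∀ j ≤ m, Rc x j ω = f x j ∧ ξ x j ω = b x j} := by
  rw [measureReal_def, henv.2.2 S m f b]
  refine Finset.prod_congr rfl fun x _ => ?_
  have h := henv.2.2 {x} m f b
  simp only [Finset.mem_singleton, forall_eq, Finset.prod_singleton] at h
  rw [measureReal_def, h]

lemma IsCookieEnv.iIndepFun_initial [IsProbabilityMeasure P] (henv : IsCookieEnv P K p η Rc ξ) (I : Finset ℤ)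
    (m : ℕ) : iIndepFun (fun (x : I) ω (j : Fin (m + 1)) => (Rc x j ω, ξ x j ω)) P := by
  have hmeas : ∀ x : I, Measurable fun ω (j : Fin (m + 1)) => (Rc x j ω, ξ x j ω) := fun x =>
    measurable_pi_lambda _ fun j => (henv.1 x j).prodMk (henv.2.1 x j)
  rw [iIndepFun_iff_map_fun_eq_pi_map fun x => (hmeas x).aemeasurable]
  have : ∀ x : I, IsProbabilityMeasure
      (P.map fun ω (j : Fin (m + 1)) => (Rc x j ω, ξ x j ω)) :=
    fun x => Measure.isProbabilityMeasure_map (hmeas x).aemeasurable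
  have hpi := measurable_pi_lambda (fun ω (x : I) (j : Fin (m + 1)) => (Rc x j ω, ξ x j ω)) hmeas
  have := Measure.isProbabilityMeasure_map (μ := P) hpi.aemeasurable
  refine Measure.ext_of_singleton fun y => ?_
  rw [← ENNReal.toReal_eq_toReal_iff' (measure_ne_top _ _) (measure_ne_top _ _),
    Measure.pi_singleton, ENNReal.toReal_prod, Measure.map_apply hpi (measurableSet_singleton _)]
  obtain ⟨ω₀⟩ : Nonempty Ω := nonempty_of_isProbabilityMeasure P
  let f : ℤ → ℕ → Fin N := fun x j =>
    if h : x ∈ I then (y ⟨x, h⟩ (Fin.ofNat (m + 1) j)).1 else Rc 0 0 ω₀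
  let b : ℤ → ℕ → Bool := fun x j =>
    if h : x ∈ I then (y ⟨x, h⟩ (Fin.ofNat (m + 1) j)).2 else true
  have hsite : ∀ (x : I) ω, (fun j : Fin (m + 1) => (Rc x j ω, ξ x j ω)) = y x ↔
      ∀ j ≤ m, Rc x j ω = f x j ∧ ξ x j ω = b x j := by
    intro x ω
    simp only [f, b, x.2, dite_true, funext_iff, Prod.ext_iff]
    constructor
    · intro h j hj
      have := h (Fin.ofNat (m + 1) j)
      rwa [show (Fin.ofNat (m + 1) j : ℕ) = j from Nat.mod_eq_of_lt (by omega)] at this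
    · intro h j
      have := h j (by omega)
      rwa [show Fin.ofNat (m + 1) (j : ℕ) = j from Fin.ext (Nat.mod_eq_of_lt j.2)] at this
  have hall : (fun ω (x : I) (j : Fin (m + 1)) => (Rc x j ω, ξ x j ω)) ⁻¹' {y}
      = {ω | ∀ x ∈ I, ∀ j ≤ m, Rc x j ω = f x j ∧ ξ x j ω = b x j} := by
    ext ω
    rw [Set.mem_preimage, Set.mem_singleton_iff, funext_iff]
    simp only [hsite, Set.mem_ofPred_eq, Subtype.forall]
  rw [hall, ← measureReal_def, henv.measureReal_eq_prod, ← Finset.prod_coe_sort]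
  refine Finset.prod_congr rfl fun x _ => ?_
  rw [Measure.map_apply (hmeas x) (measurableSet_singleton _), measureReal_def]
  congr 2
  ext ω
  exact (hsite x ω).symm

/-- The tosses at different sites are independent. -/
lemma IsCookieEnv.iIndepFun [IsProbabilityMeasure P] (henv : IsCookieEnv P K p η Rc ξ) :
    iIndepFun (fun x ω j => ξ x j ω) P := by
  refine iIndepFun.iIndepFun_process henv.2.1 fun I J => ?_
  obtain ⟨m, hm⟩ : ∃ m, ∀ x, ∀ j ∈ J x, j ≤ m :=
    ⟨Finset.univ.sup fun x => (J x).sup id, fun x j hj =>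
      (Finset.le_sup (f := id) hj).trans
        (Finset.le_sup (f := fun x => (J x).sup id) (Finset.mem_univ x))⟩
  have := (henv.iIndepFun_initial I m).comp
    (fun x z (j : J x) => (z ⟨j, Nat.lt_succ_of_le (hm x j j.2)⟩).2)
    fun x => measurable_pi_lambda _ fun j => (measurable_pi_apply _).snd
  exact this

lemma IsTossLaw.map {s : ℕ → Ω → Bool} (hs : ∀ j, Measurable (s j)) (h : IsTossLaw P K p η s) :
    IsTossLaw (P.map fun ω j => s j ω) K p η (fun j t => t j) := by
  intro m φ
  have hmeas : Measurable fun t : ℕ → Bool => fun j : Fin m => t j :=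
    measurable_pi_lambda _ fun j => measurable_pi_apply _
  have hφ : Measurable fun z : Fin m → Bool => φ (List.ofFn z) := measurable_of_finite _
  exact (integral_map (measurable_pi_lambda _ hs).aemeasurable
    (hφ.comp hmeas).aestronglyMeasurable).trans (h m φ)

/-- The environment reflected at the origin. -/
lemma IsCookieEnv.reflect (henv : IsCookieEnv P K p η Rc ξ) :
    IsCookieEnv P K (fun i => 1 - p i) η (fun x => Rc (-x)) (fun x j ω => !ξ (-x) j ω) := by
  refine ⟨fun x => henv.1 (-x), fun x j => (measurable_of_finite Bool.not).comp (henv.2.1 (-x) j),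
    fun S m f b => ?_⟩
  have h := henv.2.2 (S.map (Equiv.neg ℤ).toEmbedding) m (fun x => f (-x)) (fun x j => !b (-x) j)
  simp only [Finset.prod_map, Equiv.coe_toEmbedding, Equiv.neg_apply, neg_neg] at h
  convert h using 3
  · ext ω
    simp only [Set.mem_ofPred_eq, Finset.mem_map_equiv, Equiv.neg_symm, Equiv.neg_apply]
    rw [← (Equiv.neg ℤ).forall_congr_right]
    simp [Bool.not_eq_eq_eq_not]
  · refine Finset.prod_congr rfl fun j _ => ?_
    cases b _ j <;> simp

end Environment

section BranchProcess

variable {Ω : Type*} {ρ ν C c : ℝ}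

lemma measurable_uncurry_succBefore :
    Measurable fun z : ℕ × (ℕ → Bool) => succBefore z.2 z.1 :=
  measurable_from_prod_countable_right measurable_succBefore

lemma measurable_branch {mΩ : MeasurableSpace Ω} {s : ℤ → Ω → ℕ → Bool} {a : ℤ} {n : ℕ} (k : ℕ)
    (hs : ∀ x, a < x → x ≤ a + k → Measurable (s x)) :
    Measurable fun ω => branch (fun x => s x ω) a n k := by
  induction k with
  | zero => exact measurable_const
  | succ k ih =>
    push_cast at hs
    exact measurable_uncurry_succBefore.comp
      ((ih fun x h1 h2 => hs x h1 (by omega)).prodMk (hs (a + 1 + k) (by omega) (by omega)))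

variable [MeasurableSpace Ω] {P : Measure Ω} {s : ℤ → Ω → ℕ → Bool}

lemma indepFun_branch (hs : ∀ x, Measurable (s x)) (hind : iIndepFun s P) (a : ℤ) (n k : ℕ) :
    IndepFun (fun ω => branch (fun x => s x ω) a n k) (s (a + 1 + k)) P := by
  have hdisj : Disjoint (Set.Iic (a + k)) {a + 1 + k} := by
    simp
  have h := indep_iSup_of_disjoint (fun x => (hs x).comap_le) hind.iIndep hdisj
  rw [IndepFun_iff_Indep]
  refine indep_of_indep_of_le_left (indep_of_indep_of_le_right h ?_) ?_
  · exact le_iSup₂_of_le (f := fun x _ => MeasurableSpace.comap (s x) inferInstance) _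
      (Set.mem_singleton _) le_rfl
  · refine Measurable.comap_le (measurable_branch k fun x _ hx => ?_)
    exact Measurable.of_comap_le
      (le_iSup₂_of_le (f := fun x _ => MeasurableSpace.comap (s x) inferInstance) x hx le_rfl)

variable [IsProbabilityMeasure P]

lemma lintegral_branch_succ (hs : ∀ x, Measurable (s x)) (hind : iIndepFun s P) (a : ℤ) (n k : ℕ)
    (G : ℕ → ℕ → ENNReal) :
    ∫⁻ ω, G (branch (fun x => s x ω) a n k) (branch (fun x => s x ω) a n (k + 1)) ∂P
      = ∫⁻ ω, ∫⁻ t, G (branch (fun x => s x ω) a n k)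
          (succBefore t (branch (fun x => s x ω) a n k)) ∂(P.map (s (a + 1 + k))) ∂P := by
  have hV : Measurable fun ω => branch (fun x => s x ω) a n k :=
    measurable_branch k fun x _ _ => hs x
  have hG : Measurable fun z : ℕ × (ℕ → Bool) => G z.1 (succBefore z.2 z.1) :=
    (measurable_of_countable fun z : ℕ × ℕ => G z.1 z.2).comp
      (measurable_fst.prodMk measurable_uncurry_succBefore)
  have := Measure.isProbabilityMeasure_map (μ := P) (hs (a + 1 + k)).aemeasurable
  have h := (indepFun_iff_map_prod_eq_prod_map_map hV.aemeasurable
    (hs (a + 1 + k)).aemeasurable).1 (indepFun_branch hs hind a n k)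
  calc _ = ∫⁻ z, G z.1 (succBefore z.2 z.1)
        ∂(P.map fun ω => (branch (fun x => s x ω) a n k, s (a + 1 + k) ω)) :=
        (lintegral_map hG (hV.prodMk (hs _))).symm
    _ = _ := by
      rw [h, lintegral_prod _ hG.aemeasurable, lintegral_map hG.lintegral_prod_right' hV]

lemma lintegral_branch_le (hs : ∀ x, Measurable (s x)) (hind : iIndepFun s P) {w : ℕ → ℝ}
    (hw0 : ∀ n, 0 ≤ w n)
    (hw : ∀ x n, Integrable (fun t => w (succBefore t n)) (P.map (s x)) ∧
      ∫ t, w (succBefore t n) ∂(P.map (s x)) ≤ w n) (a : ℤ) (n : ℕ) :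
    Antitone fun k => ∫⁻ ω, ENNReal.ofReal (w (branch (fun x => s x ω) a n k)) ∂P := by
  refine antitone_nat_of_succ_le fun k => ?_
  rw [lintegral_branch_succ hs hind a n k fun _ v => ENNReal.ofReal (w v)]
  refine lintegral_mono fun ω => ?_
  obtain ⟨h1, h2⟩ := hw (a + 1 + k) (branch (fun x => s x ω) a n k)
  rw [← ofReal_integral_eq_lintegral_ofReal h1 (ae_of_all _ fun t => hw0 _)]
  exact ENNReal.ofReal_le_ofReal h2

lemma measure_branch_extinction_step (hs : ∀ x, Measurable (s x)) (hind : iIndepFun s P)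
    (hc : 0 < c) (hc1 : c ≤ 1) (hzero : ∀ x n, c ^ n ≤ (P.map (s x)).real {t | succBefore t n = 0})
    (a : ℤ) (n k M : ℕ) :
    c ^ M * P.real {ω | branch (fun x => s x ω) a n k ≠ 0 ∧ branch (fun x => s x ω) a n k ≤ M}
      ≤ P.real {ω | branch (fun x => s x ω) a n k ≠ 0}
        - P.real {ω | branch (fun x => s x ω) a n (k + 1) ≠ 0} := by
  have hV : ∀ k, Measurable fun ω => branch (fun x => s x ω) a n k :=
    fun k => measurable_branch k fun x _ _ => hs x
  have hm : ∀ k (A : Set ℕ), MeasurableSet {ω | branch (fun x => s x ω) a n k ∈ A} :=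
    fun k A => hV k (MeasurableSet.of_discrete)
  have hle : ENNReal.ofReal (c ^ M) *
      P {ω | branch (fun x => s x ω) a n k ∈ {v | v ≠ 0 ∧ v ≤ M}}
      ≤ P {ω | branch (fun x => s x ω) a n k ∈ {v | v ≠ 0 ∧ v ≤ M} ∧
        branch (fun x => s x ω) a n (k + 1) ∈ ({0} : Set ℕ)} := by
    have hstep := lintegral_branch_succ hs hind a n k fun v v' =>
      if (v ≠ 0 ∧ v ≤ M) ∧ v' = 0 then 1 else 0
    have hl : P {ω | branch (fun x => s x ω) a n k ∈ {v | v ≠ 0 ∧ v ≤ M} ∧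
        branch (fun x => s x ω) a n (k + 1) ∈ ({0} : Set ℕ)} = ∫⁻ ω,
        (if (branch (fun x => s x ω) a n k ≠ 0 ∧ branch (fun x => s x ω) a n k ≤ M) ∧
          branch (fun x => s x ω) a n (k + 1) = 0 then 1 else 0) ∂P := by
      refine (lintegral_indicator_one
        ((hm k {v | v ≠ 0 ∧ v ≤ M}).inter (hm (k + 1) {0}))).symm.trans ?_
      exact lintegral_congr fun ω => by simp [Set.indicator_apply]
    rw [hl, hstep, ← lintegral_indicator_const (hm k _)]
    refine lintegral_mono fun ω => ?_
    by_cases h : branch (fun x => s x ω) a n k ≠ 0 ∧ branch (fun x => s x ω) a n k ≤ M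
    · rw [Set.indicator_of_mem (by exact h)]
      have hset : MeasurableSet {t | succBefore t (branch (fun x => s x ω) a n k) = 0} :=
        measurable_succBefore _ (measurableSet_singleton 0)
      have : ∫⁻ t, (if (branch (fun x => s x ω) a n k ≠ 0 ∧ branch (fun x => s x ω) a n k ≤ M) ∧
          succBefore t (branch (fun x => s x ω) a n k) = 0 then 1 else 0)
          ∂(P.map (s (a + 1 + k)))
          = P.map (s (a + 1 + k)) {t | succBefore t (branch (fun x => s x ω) a n k) = 0} := by
        rw [← lintegral_indicator_one hset]
        exact lintegral_congr fun t => by simp [Set.indicator_apply, h]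
      rw [this]
      have := Measure.isProbabilityMeasure_map (μ := P) (hs (a + 1 + k)).aemeasurable
      refine ENNReal.ofReal_le_of_le_toReal ?_
      exact (pow_le_pow_of_le_one hc.le hc1 h.2).trans (hzero _ _)
    · rw [Set.indicator_of_notMem (by exact h)]
      exact bot_le
  have hle' := ENNReal.toReal_mono (measure_ne_top _ _) hle
  rw [ENNReal.toReal_mul, ENNReal.toReal_ofReal (by positivity)] at hle'
  have hsub : {ω | branch (fun x => s x ω) a n (k + 1) ∈ ({0} : Set ℕ)ᶜ}
      ⊆ {ω | branch (fun x => s x ω) a n k ∈ ({0} : Set ℕ)ᶜ} := by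
    intro ω h1 h2
    refine h1 ?_
    change succBefore _ (branch (fun x => s x ω) a n k) = 0
    rw [show branch (fun x => s x ω) a n k = 0 from h2, succBefore_zero]
  refine hle'.trans ?_
  change P.real _ ≤ P.real {ω | branch (fun x => s x ω) a n k ∈ ({0} : Set ℕ)ᶜ}
    - P.real {ω | branch (fun x => s x ω) a n (k + 1) ∈ ({0} : Set ℕ)ᶜ}
  rw [← measureReal_sdiff hsub (hm _ _)]
  refine measureReal_mono ?_
  rintro ω ⟨h1, h2⟩
  exact ⟨h1.1, fun h => h h2⟩

/-- The branching process dies out almost surely. -/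
lemma measure_branch_survival_eq_zero (hs : ∀ x, Measurable (s x)) (hind : iIndepFun s P)
    (hν : 0 < ν) (hC : 0 ≤ C) (hc : 0 < c) (hρ : ρ ≤ ν / 2)
    (hb : ∀ x, SiteBounds (P.map (s x)) ρ ν C c) (a : ℤ) (n : ℕ) :
    P {ω | ∀ k, branch (fun x => s x ω) a n k ≠ 0} = 0 := by
  have hprob : ∀ x, IsProbabilityMeasure (P.map (s x)) :=
    fun x => Measure.isProbabilityMeasure_map (hs x).aemeasurable
  have hc1 : c ≤ 1 := by simpa using ((hb 0).zero 1).trans measureReal_le_one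
  obtain ⟨w, -, hw0, hwtop, hw⟩ := exists_lyapunov_atTop hν hC hc hc1 hρ
  have hV : ∀ k, Measurable fun ω => branch (fun x => s x ω) a n k :=
    fun k => measurable_branch k fun x _ _ => hs x
  have hdec : ∀ k, P.real {ω | branch (fun x => s x ω) a n (k + 1) ≠ 0}
      ≤ P.real {ω | branch (fun x => s x ω) a n k ≠ 0} := fun k => by
    have := measure_branch_extinction_step hs hind hc hc1 (fun x => (hb x).zero) a n k 0
    rw [pow_zero, one_mul] at this
    linarith [measureReal_nonneg (μ := P) (s := {ω | branch (fun x => s x ω) a n k ≠ 0 ∧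
      branch (fun x => s x ω) a n k ≤ 0})]
  have hlim := tendsto_atTop_ciInf
    (f := fun k => P.real {ω | branch (fun x => s x ω) a n k ≠ 0}) (antitone_nat_of_succ_le hdec)
    ⟨0, by rintro _ ⟨k, rfl⟩; exact measureReal_nonneg⟩
  have hdiff : Tendsto (fun k => P.real {ω | branch (fun x => s x ω) a n k ≠ 0}
      - P.real {ω | branch (fun x => s x ω) a n (k + 1) ≠ 0}) atTop (nhds 0) := by
    simpa using hlim.sub ((tendsto_add_atTop_iff_nat 1).2 hlim)
  have hmarkov : ∀ L : ℝ, 0 < L → ∀ k,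
      P.real {ω | L ≤ w (branch (fun x => s x ω) a n k)} ≤ w n / L := by
    intro L hL k
    have h1 := lintegral_branch_le hs hind hw0 (fun x => hw _ (hb x)) a n (Nat.zero_le k)
    simp only [branch, lintegral_const, measure_univ, mul_one] at h1
    have h2 := mul_meas_ge_le_lintegral (μ := P)
      ((measurable_of_countable fun v => ENNReal.ofReal (w v)).comp (hV k)) (ENNReal.ofReal L)
    have h3 := ENNReal.toReal_mono ENNReal.ofReal_ne_top (h2.trans h1)
    rw [ENNReal.toReal_mul, ENNReal.toReal_ofReal hL.le, ENNReal.toReal_ofReal (hw0 n)] at h3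
    rw [le_div_iff₀' hL]
    refine le_trans ?_ h3
    gcongr
    refine measureReal_mono fun ω hω => ?_
    exact ENNReal.ofReal_le_ofReal hω
  have hbound : ∀ L : ℝ, 0 < L →
      P.real {ω | ∀ k, branch (fun x => s x ω) a n k ≠ 0} ≤ w n / L := by
    intro L hL
    obtain ⟨M, hM⟩ := (hwtop.eventually_ge_atTop L).exists_forall_of_atTop
    have hk : ∀ k, P.real {ω | ∀ k, branch (fun x => s x ω) a n k ≠ 0} ≤
        (P.real {ω | branch (fun x => s x ω) a n k ≠ 0}
          - P.real {ω | branch (fun x => s x ω) a n (k + 1) ≠ 0}) / c ^ M + w n / L := by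
      intro k
      have h1 := measure_branch_extinction_step hs hind hc hc1 (fun x => (hb x).zero) a n k M
      rw [← le_div_iff₀' (by positivity)] at h1
      refine le_trans (measureReal_mono ?_) (
        (measureReal_union_le _ _).trans (add_le_add h1 (hmarkov L hL k)))
      intro ω hω
      rcases le_or_gt (branch (fun x => s x ω) a n k) M with h | h
      · exact Or.inl ⟨hω k, h⟩
      · exact Or.inr (hM _ h.le)
    refine ge_of_tendsto' (x := atTop) ?_ hk
    simpa using (hdiff.div_const (c ^ M)).add_const (w n / L)
  have h0 : P.real {ω | ∀ k, branch (fun x => s x ω) a n k ≠ 0} ≤ 0 := by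
    refine ge_of_tendsto ?_ ((eventually_gt_atTop (0 : ℝ)).mono hbound)
    exact tendsto_const_nhds.div_atTop tendsto_id
  exact (measureReal_eq_zero_iff).1 (le_antisymm h0 measureReal_nonneg)

/-- A branching process with large drift started from one individual survives with probability
bounded below, uniformly in the starting site. -/
lemma exists_le_measure_branch_survival (hs : ∀ x, Measurable (s x)) (hind : iIndepFun s P)
    (hν : 0 < ν) (hC : 0 ≤ C) (hc : 0 < c) (hρ : ν / 2 < ρ)
    (hb : ∀ x, SiteBounds (P.map (s x)) ρ ν C c) :
    ∃ e : ℝ, 0 < e ∧ ∀ a, ENNReal.ofReal e ≤ P {ω | ∀ k, branch (fun x => s x ω) a 1 k ≠ 0} := by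
  have hprob : ∀ x, IsProbabilityMeasure (P.map (s x)) :=
    fun x => Measure.isProbabilityMeasure_map (hs x).aemeasurable
  obtain ⟨g, M, hg0, hg1, hg, hgM, hdrift⟩ := exists_lyapunov_bounded (c := c) hν hC hρ
  have he : 0 < (1 - g M) * c ^ M := mul_pos (sub_pos.2 hgM) (by positivity)
  refine ⟨_, he, fun a => ?_⟩
  have hV : ∀ k, Measurable fun ω => branch (fun x => s x ω) a 1 k :=
    fun k => measurable_branch k fun x _ _ => hs x
  have hint : ∀ x n, Integrable (fun t => g (succBefore t n)) (P.map (s x)) := fun x n =>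
    Integrable.of_bound ((measurable_of_countable g).comp
      (measurable_succBefore n)).aestronglyMeasurable 1
      (ae_of_all _ fun t => by rw [Real.norm_of_nonneg (hg0 _)]; exact hg1 _)
  have hone : ∫⁻ ω, ENNReal.ofReal (g (branch (fun x => s x ω) a 1 1)) ∂P
      ≤ ENNReal.ofReal (1 - (1 - g M) * c ^ M) := by
    rw [lintegral_branch_succ hs hind a 1 0 fun _ v => ENNReal.ofReal (g v)]
    simp only [branch, lintegral_const, measure_univ, mul_one]
    rw [← ofReal_integral_eq_lintegral_ofReal (hint _ _) (ae_of_all _ fun t => hg0 _)]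
    exact ENNReal.ofReal_le_ofReal (hdrift _ (hb _)).2
  have hk : ∀ k, P {ω | branch (fun x => s x ω) a 1 (k + 1) = 0}
      ≤ ENNReal.ofReal (1 - (1 - g M) * c ^ M) := by
    intro k
    refine le_trans ?_ ((lintegral_branch_le hs hind hg0
      (fun x n => ⟨hint x n, (hdrift _ (hb x)).1 n⟩) a 1 (Nat.le_add_left 1 k)).trans hone)
    have h2 := mul_meas_ge_le_lintegral (μ := P)
      ((measurable_of_countable fun v => ENNReal.ofReal (g v)).comp (hV (k + 1))) 1
    rw [one_mul] at h2
    refine le_trans (measure_mono fun ω hω => ?_) h2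
    simp only [Set.mem_ofPred_eq, Function.comp_apply] at hω ⊢
    rw [hω, hg, ENNReal.ofReal_one]
  have hmono : Monotone fun k => {ω | branch (fun x => s x ω) a 1 (k + 1) = 0} := by
    refine monotone_nat_of_le_succ fun k ω hω => ?_
    change succBefore _ (branch (fun x => s x ω) a 1 (k + 1)) = 0
    rw [show branch (fun x => s x ω) a 1 (k + 1) = 0 from hω, succBefore_zero]
  have hU : P (⋃ k, {ω | branch (fun x => s x ω) a 1 (k + 1) = 0})
      ≤ ENNReal.ofReal (1 - (1 - g M) * c ^ M) :=
    le_of_tendsto' (tendsto_measure_iUnion_atTop hmono) hk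
  have hset : {ω | ∀ k, branch (fun x => s x ω) a 1 k ≠ 0}
      = (⋃ k, {ω | branch (fun x => s x ω) a 1 (k + 1) = 0})ᶜ := by
    ext ω
    simp only [Set.mem_ofPred_eq, Set.mem_compl_iff, Set.mem_iUnion, not_exists]
    refine ⟨fun h k => h (k + 1), fun h k => ?_⟩
    cases k with
    | zero => exact one_ne_zero
    | succ k => exact h k
  have hmeas : MeasurableSet (⋃ k, {ω | branch (fun x => s x ω) a 1 (k + 1) = 0}) :=
    MeasurableSet.iUnion fun k => hV (k + 1) (measurableSet_singleton 0)
  rw [hset, prob_compl_eq_one_sub hmeas]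
  refine ENNReal.le_sub_of_add_le_right (measure_ne_top _ _) ((add_le_add_right hU _).trans ?_)
  have hle : (1 - g M) * c ^ M ≤ 1 := by
    have hc1 : c ≤ 1 := by simpa using ((hb 0).zero 1).trans measureReal_le_one
    exact mul_le_one₀ (by linarith [hg0 M]) (by positivity) (pow_le_one₀ hc.le hc1)
  rw [← ENNReal.ofReal_add he.le (by linarith)]
  simp

/-- Almost surely the branching process survives from infinitely many starting sites. -/
lemma ae_frequently_branch_survival (hs : ∀ x, Measurable (s x)) (hind : iIndepFun s P)
    (hν : 0 < ν) (hC : 0 ≤ C) (hc : 0 < c) (hρ : ν / 2 < ρ)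
    (hb : ∀ x, SiteBounds (P.map (s x)) ρ ν C c) :
    ∀ᵐ ω ∂P, ∃ a : ℕ, ∀ k, branch (fun x => s x ω) a 1 k ≠ 0 := by
  obtain ⟨e, he, hsurv⟩ := exists_le_measure_branch_survival hs hind hν hC hc hρ hb
  obtain ⟨D, hD⟩ : ∃ D : ℕ → Set Ω, D = fun a : ℕ =>
    {ω | ∀ k, branch (fun x => s x ω) a 1 k ≠ 0} := ⟨_, rfl⟩
  have hDmeas : ∀ (m : MeasurableSpace Ω) (a : ℕ), (∀ x : ℕ, a ≤ x → Measurable[m] (s x)) →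
      MeasurableSet[m] (D a) := by
    intro m a h
    have : D a = ⋂ k, (fun ω => branch (fun x => s x ω) a 1 k) ⁻¹' {0}ᶜ := by
      ext ω
      simp [hD]
    rw [this]
    refine MeasurableSet.iInter fun k => measurable_branch k (fun x h1 h2 => ?_)
      MeasurableSet.of_discrete
    lift x to ℕ using by omega
    exact h x (by omega)
  have hindN : iIndepFun (fun x : ℕ => s x) P := hind.precomp Nat.cast_injective
  have htail : MeasurableSet[limsup (fun x : ℕ => MeasurableSpace.comap (s x) inferInstance) atTop]
      (limsup D atTop) := by
    rw [limsup_eq_iInf_iSup_of_nat (u := fun x : ℕ => MeasurableSpace.comap (s x) inferInstance),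
      MeasurableSpace.measurableSet_iInf]
    intro n
    have : limsup D atTop = ⋂ i, ⋃ j, D (j + (i + n)) := by
      rw [← limsup_nat_add D n, limsup_eq_iInf_iSup_of_nat']
      simp only [Set.iInf_eq_iInter, Set.iSup_eq_iUnion, add_assoc]
    rw [this]
    refine MeasurableSet.iInter fun i => MeasurableSet.iUnion fun j => hDmeas _ _ fun x hx => ?_
    exact Measurable.of_comap_le (le_iSup₂_of_le
      (f := fun (x : ℕ) _ => MeasurableSpace.comap (s x) inferInstance) x (by omega) le_rfl)
  have h01 := measure_zero_or_one_of_measurableSet_limsup_atTop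
    (fun x : ℕ => (hs x).comap_le) hindN.iIndep htail
  have hpos : ENNReal.ofReal e ≤ P (limsup D atTop) := by
    have hanti : Antitone fun i => ⋃ j, D (j + i) := by
      refine antitone_nat_of_succ_le fun i => Set.iUnion_subset fun j => ?_
      exact Set.subset_iUnion_of_subset (j + 1) (by rw [add_assoc, add_comm 1 i])
    rw [limsup_eq_iInf_iSup_of_nat']
    refine ge_of_tendsto' (tendsto_measure_iInter_atTop (fun i => ?_) hanti
      ⟨0, measure_ne_top _ _⟩) fun i => ?_
    · exact (MeasurableSet.iUnion fun j => hDmeas _ _ fun x _ => hs x).nullMeasurableSet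
    · refine le_trans ?_ (measure_mono (Set.subset_iUnion _ 0))
      rw [hD]
      exact hsurv _
  have hone : P (limsup D atTop) = 1 := h01.resolve_left fun h => by
    rw [h] at hpos
    exact absurd hpos (by simpa using he)
  have hmeas : MeasurableSet (limsup D atTop) :=
    MeasurableSet.measurableSet_limsup fun a => hDmeas _ _ fun x _ => hs x
  filter_upwards [(mem_ae_iff_prob_eq_one hmeas).2 hone] with ω hω
  obtain ⟨a, ha⟩ := (mem_limsup_iff_frequently_mem.1 hω).exists
  rw [hD] at ha
  exact ⟨a, ha⟩

end BranchProcess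

section AlmostSure

lemma walk_not_neg (ξ : ℤ → ℕ → Bool) :
    walk (fun x j => !ξ (-x) j) = fun k => -walk ξ k :=
  funext fun k => walk_reflect (ξ := ξ) k

variable {N : ℕ} {K : Matrix (Fin N) (Fin N) ℝ} {μ p η : Fin N → ℝ}
  {Ω : Type*} [MeasurableSpace Ω] {P : Measure Ω}
  {Rc : ℤ → ℕ → Ω → Fin N} {ξ : ℤ → ℕ → Ω → Bool}

lemma IsCookieEnv.measurable_site (henv : IsCookieEnv P K p η Rc ξ) (x : ℤ) :
    Measurable fun ω j => ξ x j ω :=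
  measurable_pi_lambda _ (henv.2.1 x)

variable [IsProbabilityMeasure P]

lemma IsCookieEnv.exists_siteBounds (hK : IsStochastic K) (hμ : HasUniqueStationaryDist K μ)
    (hp : ∀ i, p i ∈ Set.Ioo (0 : ℝ) 1) (hη : IsProbVec η) (hcrit : ∑ i, μ i * p i = 1 / 2)
    (henv : IsCookieEnv P K p η Rc ξ) :
    ∃ C c : ℝ, 0 ≤ C ∧ 0 < c ∧ ∀ x, SiteBounds (P.map fun ω j => ξ x j ω)
      (∑ i, η i * rvec K μ p i) (nuVal K μ p) C c := by
  obtain ⟨C, c, hC, hc, h⟩ := IsTossLaw.exists_siteBounds hK hμ hp hη hcrit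
  refine ⟨C, c, hC, hc, fun x => ?_⟩
  have := Measure.isProbabilityMeasure_map (μ := P) (henv.measurable_site x).aemeasurable
  exact h _ ((henv.isTossLaw hK hη x).map (henv.2.1 x))

lemma IsCookieEnv.ae_infFail (hK : IsStochastic K) (hp : ∀ i, p i ∈ Set.Ioo (0 : ℝ) 1)
    (hη : IsProbVec η) (henv : IsCookieEnv P K p η Rc ξ) :
    ∀ᵐ ω ∂P, ∀ x, InfFail fun j => ξ x j ω := by
  refine ae_all_iff.2 fun x => ?_
  have := Measure.isProbabilityMeasure_map (μ := P) (henv.measurable_site x).aemeasurable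
  exact ae_of_ae_map (henv.measurable_site x).aemeasurable
    (((henv.isTossLaw hK hη x).map (henv.2.1 x)).ae_infFail hK hp hη)

lemma one_sub_mem_Ioo (hp : ∀ i, p i ∈ Set.Ioo (0 : ℝ) 1) (i : Fin N) :
    1 - p i ∈ Set.Ioo (0 : ℝ) 1 :=
  ⟨by linarith [(hp i).2], by linarith [(hp i).1]⟩

lemma IsCookieEnv.ae_infSucc (hK : IsStochastic K) (hp : ∀ i, p i ∈ Set.Ioo (0 : ℝ) 1)
    (hη : IsProbVec η) (henv : IsCookieEnv P K p η Rc ξ) :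
    ∀ᵐ ω ∂P, ∀ x, InfSucc fun j => ξ x j ω := by
  filter_upwards [henv.reflect.ae_infFail hK (one_sub_mem_Ioo hp) hη] with ω h x
  have := (infFail_reflect_iff (ξ := fun x j => ξ x j ω) (x := -x)).1 (h (-x))
  rwa [neg_neg] at this

lemma IsCookieEnv.ae_not_tendsto_atTop (hK : IsStochastic K) (hμ : HasUniqueStationaryDist K μ)
    (hp : ∀ i, p i ∈ Set.Ioo (0 : ℝ) 1) (hη : IsProbVec η) (hcrit : ∑ i, μ i * p i = 1 / 2)
    (henv : IsCookieEnv P K p η Rc ξ) (hδ : deltaVal K μ p η ≤ 1) :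
    ∀ᵐ ω ∂P, ¬ Tendsto (walk fun x j => ξ x j ω) atTop atTop := by
  obtain ⟨C, c, hC, hc, hb⟩ := henv.exists_siteBounds hK hμ hp hη hcrit
  have hν := nuVal_pos hK hμ hp hcrit
  have hρ : ∑ i, η i * rvec K μ p i ≤ nuVal K μ p / 2 := by
    rw [deltaVal, div_le_one hν] at hδ
    linarith
  have hext : ∀ᵐ ω ∂P, ∀ n, ¬ ∀ k, branch (fun x j => ξ x j ω) 0 n k ≠ 0 :=
    ae_all_iff.2 fun n => measure_eq_zero_iff_ae_notMem.1
      (measure_branch_survival_eq_zero henv.measurable_site henv.iIndepFun hν hC hc hρ hb 0 n)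
  filter_upwards [hext, henv.ae_infFail hK hp hη] with ω h1 h2 h3
  obtain ⟨n, hn⟩ := exists_branch_ne_zero h2 h3
  exact h1 n hn

lemma IsCookieEnv.ae_eventually_pos (hK : IsStochastic K) (hμ : HasUniqueStationaryDist K μ)
    (hp : ∀ i, p i ∈ Set.Ioo (0 : ℝ) 1) (hη : IsProbVec η) (hcrit : ∑ i, μ i * p i = 1 / 2)
    (henv : IsCookieEnv P K p η Rc ξ) (hδ : 1 < deltaVal K μ p η) :
    ∀ᵐ ω ∂P, (∀ M : ℤ, ∃ᶠ k in atTop, M ≤ walk (fun x j => ξ x j ω) k) →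
      ∀ᶠ k in atTop, 0 < walk (fun x j => ξ x j ω) k := by
  obtain ⟨C, c, hC, hc, hb⟩ := henv.exists_siteBounds hK hμ hp hη hcrit
  have hν := nuVal_pos hK hμ hp hcrit
  have hρ : nuVal K μ p / 2 < ∑ i, η i * rvec K μ p i := by
    rw [deltaVal, one_lt_div hν] at hδ
    linarith
  filter_upwards [ae_frequently_branch_survival henv.measurable_site henv.iIndepFun hν hC hc hρ hb,
    henv.ae_infFail hK hp hη] with ω h1 h2 h3
  obtain ⟨a, ha⟩ := h1
  obtain ⟨T, hT⟩ := (h3 (a + 1)).exists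
  filter_upwards [eventually_ge_atTop T] with k hk
  exact (Int.natCast_nonneg a).trans_lt
    (lt_walk_of_branch_ne_zero h2 (Int.natCast_nonneg a) ha hT hk)

lemma IsCookieEnv.ae_tendsto_atTop (hK : IsStochastic K) (hμ : HasUniqueStationaryDist K μ)
    (hp : ∀ i, p i ∈ Set.Ioo (0 : ℝ) 1) (hη : IsProbVec η) (hcrit : ∑ i, μ i * p i = 1 / 2)
    (henv : IsCookieEnv P K p η Rc ξ) (hδ : 1 < deltaVal K μ p η) :
    ∀ᵐ ω ∂P, Tendsto (walk fun x j => ξ x j ω) atTop atTop := by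
  have hδ' := deltaVal_add_lt_one hK hμ hp hη hcrit
  filter_upwards [henv.ae_eventually_pos hK hμ hp hη hcrit hδ, henv.ae_infFail hK hp hη,
    henv.ae_infSucc hK hp hη, henv.reflect.ae_not_tendsto_atTop hK hμ (one_sub_mem_Ioo hp) hη
      (sum_stationary_one_sub hμ hcrit) (by linarith)] with ω h1 h2 h3 h4
  rcases walk_trichotomy h2 h3 with h | h | ⟨h, h'⟩
  · exact h
  · refine absurd ?_ h4
    rw [walk_not_neg fun x j => ξ x j ω]
    exact tendsto_neg_atBot_atTop.comp h
  · obtain ⟨k, hk, hk'⟩ := ((h' 0).and_eventually (h1 h)).exists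
    exact absurd hk' hk.not_gt

lemma measure_eq_one_of_ae {E : Set Ω} (h : ∀ᵐ ω ∂P, ω ∈ E) : P E = 1 :=
  (measure_congr (eventuallyEq_univ.2 h)).trans measure_univ

end AlmostSure

/-- **Theorem 1.3 (recurrence/transience in the critical case `p̄ = 1/2`).**
With `δ = deltaVal K μ p η` and `δ̃ = deltaVal K μ (1−p) η` one has `δ + δ̃ < 1`, and:
if `δ > 1` the walk is transient to the right a.s.; if `δ̃ > 1` it is transient to the left
a.s.; and if `δ ≤ 1` and `δ̃ ≤ 1` then a.s. `liminf Xₙ = −∞` and `limsup Xₙ = +∞`. -/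
theorem critical_recurrence_transience
    {N : ℕ} {Ω : Type*} [MeasurableSpace Ω] (Pm : Measure Ω) [IsProbabilityMeasure Pm]
    (K : Matrix (Fin N) (Fin N) ℝ) (μ p η : Fin N → ℝ)
    (Rc : ℤ → ℕ → Ω → Fin N) (ξ : ℤ → ℕ → Ω → Bool)
    (hK : IsStochastic K) (hμ : HasUniqueStationaryDist K μ)
    (hp : ∀ i, p i ∈ Set.Ioo (0 : ℝ) 1) (hη : IsProbVec η)
    (henv : IsCookieEnv Pm K p η Rc ξ)
    (hcrit : ∑ i, μ i * p i = 1 / 2)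
    (δ δtil : ℝ) (hδ : δ = deltaVal K μ p η) (hδtil : δtil = deltaVal K μ (fun i => 1 - p i) η) :
    δ + δtil < 1 ∧
    (1 < δ → Pm {ω | Tendsto (fun n => walk (fun x j => ξ x j ω) n) atTop atTop} = 1) ∧
    (1 < δtil → Pm {ω | Tendsto (fun n => walk (fun x j => ξ x j ω) n) atTop atBot} = 1) ∧
    (δ ≤ 1 → δtil ≤ 1 →
      Pm {ω | (∀ M : ℤ, ∃ᶠ n in atTop, M ≤ walk (fun x j => ξ x j ω) n) ∧
              (∀ M : ℤ, ∃ᶠ n in atTop, walk (fun x j => ξ x j ω) n ≤ M)} = 1) := by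
  subst hδ hδtil
  have hp' := one_sub_mem_Ioo hp
  have hcrit' := sum_stationary_one_sub hμ hcrit
  refine ⟨deltaVal_add_lt_one hK hμ hp hη hcrit, fun h => ?_, fun h => ?_, fun h1 h2 => ?_⟩
  · exact measure_eq_one_of_ae (henv.ae_tendsto_atTop hK hμ hp hη hcrit h)
  · refine measure_eq_one_of_ae ?_
    filter_upwards [henv.reflect.ae_tendsto_atTop hK hμ hp' hη hcrit' h] with ω hω
    rw [walk_not_neg fun x j => ξ x j ω] at hω
    exact tendsto_neg_atTop_iff.1 hω
  · refine measure_eq_one_of_ae ?_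
    filter_upwards [henv.ae_infFail hK hp hη, henv.ae_infSucc hK hp hη,
      henv.ae_not_tendsto_atTop hK hμ hp hη hcrit h1,
      henv.reflect.ae_not_tendsto_atTop hK hμ hp' hη hcrit' h2] with ω hf hs htop hbot
    rcases walk_trichotomy hf hs with h | h | h
    · exact absurd h htop
    · rw [walk_not_neg fun x j => ξ x j ω] at hbot
      exact absurd (tendsto_neg_atTop_iff.2 h) hbot
    · exact h

end
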